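/- Let a > b be two natural numbers. There exists a minimal closed subset X of the full shift (([0,1]^a)^ℤ, σ) such that for every equivariant continuous map π : (X, σ) → (([0,1]^b)^ℤ, σ), the topological conditional entropy of π is infinite: h_top(π, σ) = +∞. -/

import Mathlib

open Filter Topology
open scoped ENNReal NNReal

noncomputable section

/-- Diameter (in `ℝ≥0∞`) of a set with respect to a distance function `ρ`. -/
def setEDiam {X : Type*} (ρ : X → X → ℝ) (E : Set X) : ℝ≥0∞ :=
  ⨆ x ∈ E, ⨆ y ∈ E, ENNReal.ofReal (ρ x y)

/-- Openness with respect to a distance function `ρ`. -/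
def ROpen {X : Type*} (ρ : X → X → ℝ) (U : Set X) : Prop :=
  ∀ x ∈ U, ∃ δ > 0, ∀ y, ρ x y < δ → y ∈ U

/-- `#(E, ρ, ε)`: the minimal number `n` of `ρ`-open sets of `ρ`-diameter `< ε` covering `E`
(`0` when `E = ∅`, since the empty family covers it). -/
def covNum {X : Type*} (ρ : X → X → ℝ) (ε : ℝ) (E : Set X) : ℕ :=
  sInf {n : ℕ | ∃ U : Fin n → Set X, (∀ i, ROpen ρ (U i)) ∧
    (∀ i, setEDiam ρ (U i) < ENNReal.ofReal ε) ∧ E ⊆ ⋃ i, U i}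

/-- The dynamical metric `d_N(x,y) = max_{0 ≤ n < N} d(Tⁿx, Tⁿy)`. -/
def dynDist {X : Type*} (T : X → X) (d : X → X → ℝ) (N : ℕ) (x y : X) : ℝ :=
  sSup {r : ℝ | ∃ n, n < N ∧ r = d (T^[n] x) (T^[n] y)}

/-- `sup_{y ∈ Y} log #(π⁻¹(y), ρ, ε)`. -/
def supLogCov {X Y : Type*} (π : X → Y) (ρ : X → X → ℝ) (ε : ℝ) : ℝ :=
  ⨆ y : Y, Real.log (covNum ρ ε (π ⁻¹' {y}) : ℝ)

/-- `sup_{y ∈ Y} log #(π⁻¹(B_δ(y, ρY)), ρX, ε)` where `B_δ` is the closed `δ`-ball. -/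
def supLogCovBall {X Y : Type*} (π : X → Y) (ρX : X → X → ℝ) (ρY : Y → Y → ℝ)
    (ε δ : ℝ) : ℝ :=
  ⨆ y : Y, Real.log (covNum ρX ε (π ⁻¹' {x | ρY x y ≤ δ}) : ℝ)

/-- Topological conditional entropy
`h_top(π, T) = lim_{ε→0} lim_{N→∞} (sup_y log #(π⁻¹(y), d_N, ε))/N`, as an extended real. -/
def condEntropy {X Y : Type*} (π : X → Y) (T : X → X) (d : X → X → ℝ) : EReal :=
  Filter.limsup (fun ε : ℝ => Filter.liminf
      (fun N : ℕ => ((supLogCov π (dynDist T d N) ε / N : ℝ) : EReal)) Filter.atTop)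
    (𝓝[>] (0 : ℝ))

/-- `lim_{N→∞} (sup_y log #(π⁻¹(y), d_N, ε))/(N log(1/ε))` (the limit exists by
subadditivity; it is realized here as a liminf). -/
def condMdimRate {X Y : Type*} (π : X → Y) (T : X → X) (d : X → X → ℝ) (ε : ℝ) : EReal :=
  Filter.liminf (fun N : ℕ =>
    ((supLogCov π (dynDist T d N) ε / (N * Real.log (1 / ε)) : ℝ) : EReal)) Filter.atTop

/-- Lower conditional metric mean dimension of `π : (X,T,d) → Y`. -/
def lowerCondMdimM {X Y : Type*} (π : X → Y) (T : X → X) (d : X → X → ℝ) : EReal :=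
  Filter.liminf (fun ε : ℝ => condMdimRate π T d ε) (𝓝[>] (0 : ℝ))

/-- Upper conditional metric mean dimension of `π : (X,T,d) → Y`. -/
def upperCondMdimM {X Y : Type*} (π : X → Y) (T : X → X) (d : X → X → ℝ) : EReal :=
  Filter.limsup (fun ε : ℝ => condMdimRate π T d ε) (𝓝[>] (0 : ℝ))

/-- `lim_{N→∞} log #(X, d_N, ε)/(N log(1/ε))`. -/
def mdimMRate {X : Type*} (T : X → X) (d : X → X → ℝ) (ε : ℝ) : EReal :=
  Filter.liminf (fun N : ℕ =>
    ((Real.log (covNum (dynDist T d N) ε (Set.univ : Set X) : ℝ) /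
      (N * Real.log (1 / ε)) : ℝ) : EReal)) Filter.atTop

/-- Lower metric mean dimension of `(X, T, d)`. -/
def lowerMdimM {X : Type*} (T : X → X) (d : X → X → ℝ) : EReal :=
  Filter.liminf (fun ε : ℝ => mdimMRate T d ε) (𝓝[>] (0 : ℝ))

/-- Upper metric mean dimension of `(X, T, d)`. -/
def upperMdimM {X : Type*} (T : X → X) (d : X → X → ℝ) : EReal :=
  Filter.limsup (fun ε : ℝ => mdimMRate T d ε) (𝓝[>] (0 : ℝ))

/-- `widim_ε(X, ρ)`: the minimal `k` such that there are a finite simplicial complex of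
dimension `≤ k` (realized in some `ℝ^m`) and a continuous `ε`-embedding `f : X → P`
(all fibers of `f` have `ρ`-diameter `< ε`). -/
def widim (X : Type*) [TopologicalSpace X] (ρ : X → X → ℝ) (ε : ℝ) : ℕ :=
  sInf {k : ℕ | ∃ (m : ℕ) (K : Geometry.SimplicialComplex ℝ (Fin m → ℝ)),
    K.faces.Finite ∧ (∀ s ∈ K.faces, s.card ≤ k + 1) ∧
    ∃ f : X → K.space, Continuous f ∧
      ∀ p : K.space, setEDiam ρ (f ⁻¹' {p}) < ENNReal.ofReal ε}

/-- Mean dimension `mdim(X, T) = lim_{ε→0} lim_{N→∞} widim_ε(X, d_N)/N`. -/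
def mdim (X : Type*) [TopologicalSpace X] (T : X → X) (d : X → X → ℝ) : EReal :=
  Filter.limsup (fun ε : ℝ => Filter.liminf
      (fun N : ℕ => (((widim X (dynDist T d N) ε : ℝ) / N : ℝ) : EReal)) Filter.atTop)
    (𝓝[>] (0 : ℝ))

/-- The cube `[0,1]^a`. -/
abbrev Cube (a : ℕ) := Fin a → unitInterval

/-- The full shift space `([0,1]^a)^ℤ`. -/
abbrev FullShift (a : ℕ) := ℤ → Cube a

/-- The shift map `σ((x_n)_n) = (x_{n+1})_n`. -/
def shift {α : Type*} (x : ℤ → α) : ℤ → α := fun n => x (n + 1)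

/-- The `ℓ^∞`-distance on the cube `[0,1]^a`. -/
def cubeDist {a : ℕ} (x y : Cube a) : ℝ :=
  ‖(fun i => (x i : ℝ)) - fun i => (y i : ℝ)‖

/-- The metric `D((x_n), (y_n)) = Σ_{n∈ℤ} 2^{-|n|} ‖x_n − y_n‖_∞` on the full shift. -/
def shiftDist {a : ℕ} (x y : FullShift a) : ℝ :=
  ∑' n : ℤ, (2 : ℝ) ^ (-|n|) * cubeDist (x n) (y n)

end

section Parity

variable {ι E : Type*} [AddCommGroup E] [Module ℝ E]

/-- `0` is a convex combination of the points `F x`, `x ∈ T`. -/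
def ZeroComb (F : ι → E) (T : Finset ι) : Prop :=
  ∃ c : ι → ℝ, (∀ x ∈ T, 0 ≤ c x) ∧ ∑ x ∈ T, c x = 1 ∧ ∑ x ∈ T, c x • F x = 0

theorem ZeroComb.of_nonneg {F : ι → E} {T : Finset ι} (c : ι → ℝ) (h0 : ∀ x ∈ T, 0 ≤ c x)
    (h1 : ∃ x ∈ T, 0 < c x) (h2 : ∑ x ∈ T, c x • F x = 0) : ZeroComb F T := by
  have hs : 0 < ∑ x ∈ T, c x := Finset.sum_pos' h0 h1
  refine ⟨fun x => (∑ x ∈ T, c x)⁻¹ * c x, fun x hx => ?_, ?_, ?_⟩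
  · exact mul_nonneg (inv_nonneg.2 hs.le) (h0 x hx)
  · rw [← Finset.mul_sum, inv_mul_cancel₀ hs.ne']
  · simp only [mul_smul, ← Finset.smul_sum, h2, smul_zero]

theorem ZeroComb.erase [DecidableEq ι] {F : ι → E} {T : Finset ι} (c : ι → ℝ)
    (h0 : ∀ x ∈ T, 0 ≤ c x) (h1 : ∃ x ∈ T, 0 < c x) (h2 : ∑ x ∈ T, c x • F x = 0) {q : ι}
    (hq : c q = 0) : ZeroComb F (T.erase q) := by
  refine ZeroComb.of_nonneg c (fun x hx => h0 x (Finset.mem_of_mem_erase hx)) ?_ ?_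
  · obtain ⟨x, hx, hx'⟩ := h1
    exact ⟨x, Finset.mem_erase.2 ⟨fun h => by subst h; linarith, hx⟩, hx'⟩
  · rw [← h2]
    apply Finset.sum_subset (Finset.erase_subset _ _)
    intro x hx hx'
    have : x = q := by by_contra h; exact hx' (Finset.mem_erase.2 ⟨h, hx⟩)
    simp [this, hq]

theorem ZeroComb.congr {F G : ι → E} {T : Finset ι} (h : ∀ x ∈ T, F x = G x) :
    ZeroComb F T ↔ ZeroComb G T := by
  unfold ZeroComb
  refine exists_congr fun c => and_congr_right fun _ => and_congr_right fun _ => ?_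
  rw [Finset.sum_congr rfl fun x hx => by rw [h x hx]]

theorem ZeroComb.mono {F : ι → E} {S T : Finset ι} (h : S ⊆ T) (hS : ZeroComb F S) :
    ZeroComb F T := by
  classical
  obtain ⟨c, h0, h1, h2⟩ := hS
  refine ⟨fun x => if x ∈ S then c x else 0, fun x _ => ?_, ?_, ?_⟩
  · dsimp only; split_ifs with hx
    · exact h0 x hx
    · exact le_rfl
  · rw [← h1, Finset.sum_ite_mem, Finset.inter_eq_right.2 h]
  · rw [← h2]
    simp only [ite_smul, zero_smul]
    rw [Finset.sum_ite_mem, Finset.inter_eq_right.2 h]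

/-- A dependency vanishing at a point is a multiple of a positive one. -/
theorem exists_eq_mul_of_dependency [DecidableEq ι] {b : ι → E} {T : Finset ι} {l u : ι → ℝ}
    (hT : T.Nonempty) (hadm : ∀ q ∈ T, ¬ ZeroComb b (T.erase q)) (hl : ∀ x ∈ T, 0 < l x)
    (hl0 : ∑ x ∈ T, l x • b x = 0) (hu0 : ∑ x ∈ T, u x • b x = 0) :
    ∃ c : ℝ, ∀ x ∈ T, u x = c * l x := by
  obtain ⟨q, hq, hmin⟩ := T.exists_min_image (fun x => u x / l x) hT
  refine ⟨u q / l q, ?_⟩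
  by_contra! hne
  obtain ⟨y, hy, hyne⟩ := hne
  have hnn : ∀ x ∈ T, 0 ≤ u x - u q / l q * l x := by
    intro x hx
    have := hmin x hx
    rw [le_div_iff₀ (hl x hx)] at this
    linarith
  refine hadm q hq (ZeroComb.erase (fun x => u x - u q / l q * l x) hnn ?_ ?_ ?_)
  · exact ⟨y, hy, lt_of_le_of_ne (hnn y hy) fun h => hyne (by linarith)⟩
  · simp only [sub_smul, mul_smul, Finset.sum_sub_distrib, ← Finset.smul_sum, hl0, hu0]
    simp
  · have := (hl q hq).ne'
    field_simp
    ring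

theorem exists_dependency {V : Submodule ℝ E} {N : ℕ} [FiniteDimensional ℝ V]
    (hV : Module.finrank ℝ V = N) {T : Finset ι} (hT : N < T.card) {b : ι → E}
    (hb : ∀ i ∈ T, b i ∈ V) :
    ∃ u : ι → ℝ, (∃ x ∈ T, u x ≠ 0) ∧ ∑ x ∈ T, u x • b x = 0 := by
  classical
  have hnl : ¬ LinearIndependent ℝ (fun i : T => (⟨b i, hb i i.2⟩ : V)) := by
    intro h
    have := h.fintype_card_le_finrank
    simp at this
    omega
  rw [Fintype.not_linearIndependent_iff] at hnl
  obtain ⟨g, hg, i, hi⟩ := hnl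
  refine ⟨fun x => if h : x ∈ T then g ⟨x, h⟩ else 0, ⟨i, i.2, by simpa using hi⟩, ?_⟩
  have := congrArg (Subtype.val) hg
  simp only [AddSubmonoidClass.coe_finsetSum, Submodule.coe_smul] at this
  rw [← Finset.sum_coe_sort]
  simpa using this

theorem even_card_zeroComb_erase [DecidableEq ι] {V : Submodule ℝ E} {N : ℕ}
    [FiniteDimensional ℝ V] (hV : Module.finrank ℝ V = N)
    {Q : Finset ι} (hQ : Q.card = N + 2) {b : ι → E} (hb : ∀ i ∈ Q, b i ∈ V)
    (hadm : ∀ i ∈ Q, ∀ j ∈ Q, i ≠ j → ¬ ZeroComb b ((Q.erase i).erase j))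
    (S : Finset ι) (hS : ∀ i, i ∈ S ↔ i ∈ Q ∧ ZeroComb b (Q.erase i)) : Even S.card := by
  rcases S.eq_empty_or_nonempty with rfl | ⟨i₀, hi₀⟩
  · simp
  -- nonnegative dependencies on `Q.erase i` are positive
  have key : ∀ i ∈ S, ∃ l : ι → ℝ, l i = 0 ∧ (∀ x ∈ Q.erase i, 0 < l x) ∧
      ∑ x ∈ Q.erase i, l x • b x = 0 := by
    intro i hi
    obtain ⟨hiQ, c, h0, h1, h2⟩ := (hS i).1 hi
    have hpos : ∃ x ∈ Q.erase i, 0 < c x := by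
      by_contra! h
      have := Finset.sum_nonpos h
      linarith
    have hc : ∀ x ∈ Q.erase i, 0 < c x := by
      intro x hx
      refine lt_of_le_of_ne (h0 x hx) fun h => ?_
      refine hadm i hiQ x (Finset.mem_of_mem_erase hx) (Finset.ne_of_mem_erase hx).symm ?_
      exact ZeroComb.erase c h0 hpos h2 h.symm
    refine ⟨fun x => if x = i then 0 else c x, by simp, fun x hx => ?_, ?_⟩
    · simpa [Finset.ne_of_mem_erase hx] using hc x hx
    · rw [← h2]
      refine Finset.sum_congr rfl fun x hx => ?_
      simp [Finset.ne_of_mem_erase hx]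
  have full : ∀ (i : ι) (l : ι → ℝ), i ∈ Q → l i = 0 →
      ∑ x ∈ Q, l x • b x = ∑ x ∈ Q.erase i, l x • b x := by
    intro i l hi h
    rw [← Finset.add_sum_erase _ _ hi, h]; simp
  obtain ⟨hi₀Q, -⟩ := (hS i₀).1 hi₀
  obtain ⟨l, hl₀, hl, hls⟩ := key i₀ hi₀
  have hne : (Q.erase i₀).Nonempty := by
    rw [← Finset.card_pos, Finset.card_erase_of_mem hi₀Q]; omega
  have adm₀ : ∀ q ∈ Q.erase i₀, ¬ ZeroComb b ((Q.erase i₀).erase q) := fun q hq =>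
    hadm i₀ hi₀Q q (Finset.mem_of_mem_erase hq) (Finset.ne_of_mem_erase hq).symm
  have mult : ∀ u : ι → ℝ, u i₀ = 0 → ∑ x ∈ Q, u x • b x = 0 →
      ∃ c : ℝ, ∀ x ∈ Q, u x = c * l x := by
    intro u hu hus
    rw [full i₀ u hi₀Q hu] at hus
    obtain ⟨c, hc⟩ := exists_eq_mul_of_dependency hne adm₀ hl hls hus
    refine ⟨c, fun x hx => ?_⟩
    by_cases hxi : x = i₀
    · rw [hxi, hu, hl₀, mul_zero]
    · exact hc x (Finset.mem_erase.2 ⟨hxi, hx⟩)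
  -- a dependency with value one at `i₀`
  obtain ⟨u, hu1, hus⟩ : ∃ u : ι → ℝ, u i₀ = 1 ∧ ∑ x ∈ Q, u x • b x = 0 := by
    obtain ⟨q₀, hq₀⟩ := hne
    have hq₀Q := Finset.mem_of_mem_erase hq₀
    obtain ⟨u, ⟨y, hy, hy0⟩, hus⟩ := exists_dependency hV (T := Q.erase q₀) (b := b)
      (by rw [Finset.card_erase_of_mem hq₀Q]; omega)
      (fun i hi => hb i (Finset.mem_of_mem_erase hi))
    set u' : ι → ℝ := fun x => if x = q₀ then 0 else u x with hu'
    have hu's : ∑ x ∈ Q, u' x • b x = 0 := by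
      rw [full q₀ u' hq₀Q (by simp [hu']), ← hus]
      exact Finset.sum_congr rfl fun x hx => by simp [hu', Finset.ne_of_mem_erase hx]
    have hne0 : u' i₀ ≠ 0 := by
      intro h0
      obtain ⟨c, hc⟩ := mult u' h0 hu's
      have h3 := hc q₀ hq₀Q
      have h4 : c = 0 := by
        simpa [hu', (hl q₀ hq₀).ne'] using h3
      have h5 := hc y (Finset.mem_of_mem_erase hy)
      simp [hu', Finset.ne_of_mem_erase hy, h4] at h5
      exact hy0 h5
    refine ⟨fun x => (u' i₀)⁻¹ * u' x, inv_mul_cancel₀ hne0, ?_⟩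
    simp only [mul_smul, ← Finset.smul_sum, hu's, smul_zero]
  obtain ⟨i₁, hi₁, hmin⟩ := (Q.erase i₀).exists_min_image (fun x => u x / l x) hne
  set β := u i₁ / l i₁ with hβ
  set w : ι → ℝ := fun x => u x - β * l x with hw
  have hws : ∑ x ∈ Q, w x • b x = 0 := by
    simp only [hw, sub_smul, mul_smul, Finset.sum_sub_distrib, ← Finset.smul_sum, hus,
      full i₀ l hi₀Q hl₀, hls]
    simp
  have hwnn : ∀ x ∈ Q, 0 ≤ w x := by
    intro x hx
    by_cases hxi : x = i₀
    · simp [hw, hxi, hl₀, hu1]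
    · have hx' := Finset.mem_erase.2 ⟨hxi, hx⟩
      have := hmin x hx'
      rw [le_div_iff₀ (hl x hx')] at this
      simp only [hw]; linarith
  have hw0 : w i₀ = 1 := by simp [hw, hl₀, hu1]
  have hw1 : w i₁ = 0 := by
    have := (hl i₁ hi₁).ne'
    simp only [hw, hβ]; field_simp; ring
  have hi₁S : i₁ ∈ S := (hS i₁).2 ⟨Finset.mem_of_mem_erase hi₁,
    ZeroComb.erase w hwnn ⟨i₀, hi₀Q, by rw [hw0]; norm_num⟩ hws hw1⟩
  have hne01 : i₀ ≠ i₁ := (Finset.ne_of_mem_erase hi₁).symm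
  have hSeq : S = {i₀, i₁} := by
    ext i₂
    simp only [Finset.mem_insert, Finset.mem_singleton]
    refine ⟨fun h => ?_, by rintro (rfl | rfl) <;> assumption⟩
    by_contra! hcon
    obtain ⟨h20, h21⟩ := hcon
    obtain ⟨h2Q, -⟩ := (hS i₂).1 h
    obtain ⟨v, hv2, hv, hvs⟩ := key i₂ h
    have hv0 : 0 < v i₀ := hv i₀ (Finset.mem_erase.2 ⟨h20.symm, hi₀Q⟩)
    have hv1 : 0 < v i₁ := hv i₁ (Finset.mem_erase.2 ⟨h21.symm, Finset.mem_of_mem_erase hi₁⟩)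
    rw [← full i₂ v h2Q hv2] at hvs
    obtain ⟨c, hc⟩ := mult (fun x => v x - v i₀ * w x) (by simp [hw0]) (by
      simp only [sub_smul, mul_smul, Finset.sum_sub_distrib, ← Finset.smul_sum, hvs, hws]; simp)
    have e1 := hc i₁ (Finset.mem_of_mem_erase hi₁)
    have e2 := hc i₂ h2Q
    have l1 := hl i₁ hi₁
    have l2 := hl i₂ (Finset.mem_erase.2 ⟨h20, h2Q⟩)
    have w2 := hwnn i₂ h2Q
    simp only [hw1, hv2] at e1 e2
    have hcpos : 0 < c := by
      by_contra! hle
      nlinarith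
    nlinarith [mul_pos hcpos l2, mul_nonneg hv0.le w2]
  rw [hSeq, Finset.card_pair hne01]
  exact even_two


theorem ZeroComb.map_iff {κ : Type*} (e : ι ↪ κ) (b : κ → E) (T : Finset ι) :
    ZeroComb b (T.map e) ↔ ZeroComb (fun x => b (e x)) T := by
  classical
  constructor
  · rintro ⟨c, h0, h1, h2⟩
    rw [Finset.sum_map] at h1 h2
    exact ⟨fun x => c (e x), fun x hx => h0 _ (Finset.mem_map_of_mem e hx), h1, h2⟩
  · rintro ⟨c, h0, h1, h2⟩
    have hc : ∀ x, Function.extend e c 0 (e x) = c x := fun x => e.injective.extend_apply c 0 x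
    refine ⟨Function.extend e c 0, ?_, ?_, ?_⟩
    · intro y hy
      obtain ⟨x, hx, rfl⟩ := Finset.mem_map.1 hy
      rw [hc]; exact h0 x hx
    · rw [Finset.sum_map]; simpa only [hc] using h1
    · rw [Finset.sum_map]; simpa only [hc] using h2

theorem ZeroComb.of_insert_generic [DecidableEq ι] {b : ι → E} {T : Finset ι} {q : ι}
    (hq : q ∈ T) (hgen : b q ∉ Submodule.span ℝ (b '' ↑(T.erase q))) (h : ZeroComb b T) :
    ZeroComb b (T.erase q) := by
  obtain ⟨c, h0, h1, h2⟩ := h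
  have hpos : ∃ x ∈ T, 0 < c x := by
    by_contra! h
    have := Finset.sum_nonpos h
    linarith
  refine ZeroComb.erase c h0 hpos h2 ?_
  by_contra hc
  apply hgen
  rw [← Finset.add_sum_erase _ _ hq] at h2
  have h3 : b q = (c q)⁻¹ • (-∑ x ∈ T.erase q, c x • b x) := by
    rw [← eq_neg_of_add_eq_zero_left h2, smul_smul, inv_mul_cancel₀ hc, one_smul]
  rw [h3]
  refine Submodule.smul_mem _ _ (Submodule.neg_mem _ (Submodule.sum_mem _ fun x hx => ?_))
  exact Submodule.smul_mem _ _ (Submodule.subset_span ⟨x, hx, rfl⟩)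

section Equivariant

variable {P W : Type*} [DecidableEq P] [Group W] [MulAction W P]
  (ρ : W →* (E →ₗ[ℝ] E))

theorem ZeroComb.image_smul_aux {F : P → E} (hF : ∀ (w : W) x, F (w • x) = ρ w (F x)) (w : W)
    {T : Finset P} (h : ZeroComb F T) : ZeroComb F (T.image (w • ·)) := by
  have : T.image (w • ·) = T.map ⟨(w • ·), MulAction.injective w⟩ := by
    rw [Finset.map_eq_image]; rfl
  rw [this, ZeroComb.map_iff]
  obtain ⟨c, h0, h1, h2⟩ := h
  refine ⟨c, h0, h1, ?_⟩
  have := congrArg (ρ w) h2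
  simpa [hF] using this

theorem image_inv_smul_image (w : W) (T : Finset P) : (T.image (w • ·)).image (w⁻¹ • ·) = T := by
  rw [Finset.image_image]
  simp [Function.comp_def]

theorem ZeroComb.image_smul_iff {F : P → E} (hF : ∀ (w : W) x, F (w • x) = ρ w (F x)) (w : W)
    {T : Finset P} : ZeroComb F (T.image (w • ·)) ↔ ZeroComb F T := by
  refine ⟨fun h => ?_, ZeroComb.image_smul_aux ρ hF w⟩
  have := ZeroComb.image_smul_aux ρ hF w⁻¹ h
  rwa [image_inv_smul_image] at this

/-- The combinatorial data of a pseudomanifold with free group action. -/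
structure FreeComplex (P W : Type*) [DecidableEq P] [Group W] [MulAction W P]
    (TT : Finset (Finset P)) (N : ℕ) : Prop where
  free : ∀ (w : W) (x : P), w • x = x → w = 1
  inv : ∀ (w : W), ∀ T ∈ TT, T.image (w • ·) ∈ TT
  card : ∀ T ∈ TT, T.card = N + 1
  orbit : ∀ T ∈ TT, ∀ x ∈ T, ∀ (w : W), w • x ∈ T → w = 1
  thin : ∀ R : Finset P, R.card = N → Even (TT.filter (R ⊆ ·)).card

variable {ρ} {V : Submodule ℝ E} {N : ℕ} {TT : Finset (Finset P)}

open Classical in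
theorem card_zeroComb_orbit [Fintype W] (hK : FreeComplex P W TT N) {F : P → E}
    (hF : ∀ (w : W) x, F (w • x) = ρ w (F x)) (v : P) :
    (TT.filter (fun T => (∃ w : W, w • v ∈ T) ∧ ZeroComb F T)).card =
      Fintype.card W * (TT.filter (fun T => v ∈ T ∧ ZeroComb F T)).card := by
  rw [← Finset.card_univ, ← Finset.card_product]
  symm
  refine Finset.card_bij (fun p _ => p.2.image (p.1 • ·)) ?_ ?_ ?_
  · rintro ⟨w, T⟩ h
    simp only [Finset.mem_product, Finset.mem_filter, Finset.mem_univ, true_and] at h ⊢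
    exact ⟨hK.inv w T h.1, ⟨w, Finset.mem_image_of_mem _ h.2.1⟩,
      (ZeroComb.image_smul_iff ρ hF w).2 h.2.2⟩
  · rintro ⟨w, T⟩ h ⟨w', T'⟩ h' heq
    simp only [Finset.mem_product, Finset.mem_filter, Finset.mem_univ, true_and] at h h' heq
    have hw : w = w' := by
      have h1 : w' • v ∈ T.image (w • ·) := by
        rw [heq]; exact Finset.mem_image_of_mem _ h'.2.1
      have h2 : w • v ∈ T.image (w • ·) := Finset.mem_image_of_mem _ h.2.1
      have := hK.orbit _ (hK.inv w T h.1) _ h2 (w' * w⁻¹) (by simpa [mul_smul] using h1)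
      rw [mul_inv_eq_one] at this
      exact this.symm
    subst hw
    have := congrArg (Finset.image (w⁻¹ • ·)) heq
    rw [image_inv_smul_image, image_inv_smul_image] at this
    rw [this]
  · intro T h
    simp only [Finset.mem_filter] at h
    obtain ⟨hT, ⟨w, hw⟩, hZ⟩ := h
    refine ⟨(w, T.image (w⁻¹ • ·)), ?_, ?_⟩
    · simp only [Finset.mem_product, Finset.mem_filter, Finset.mem_univ, true_and]
      refine ⟨hK.inv _ _ hT, ?_, (ZeroComb.image_smul_iff ρ hF _).2 hZ⟩
      exact Finset.mem_image.2 ⟨_, hw, inv_smul_smul w v⟩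
    · have := image_inv_smul_image w⁻¹ T
      rwa [inv_inv] at this

open Classical in
theorem even_card_facets (hK : FreeComplex P W TT N) (v : P) (h : Finset P → Prop) :
    Even (∑ T ∈ TT.filter (v ∈ ·), ((T.erase v).filter (fun u => h (T.erase u))).card) := by
  rw [← Finset.card_sigma]
  set D := (TT.filter (v ∈ ·)).sigma fun T => (T.erase v).filter (fun u => h (T.erase u)) with hD
  rw [Finset.card_eq_sum_card_image (fun p : (_ : Finset P) × P => p.1.erase p.2)]
  refine Finset.even_sum _ fun R hR => ?_
  obtain ⟨⟨T, u⟩, hTu, rfl⟩ := Finset.mem_image.1 hR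
  simp only [hD, Finset.mem_sigma, Finset.mem_filter, Finset.mem_erase] at hTu
  obtain ⟨⟨hT, hvT⟩, ⟨huv, huT⟩, hh⟩ := hTu
  have hc : (T.erase u).card = N := by rw [Finset.card_erase_of_mem huT, hK.card T hT]; rfl
  have hthin := hK.thin (T.erase u) hc
  suffices hcard : (D.filter fun p => p.1.erase p.2 = T.erase u).card =
      (TT.filter (T.erase u ⊆ ·)).card by rwa [hcard]
  refine Finset.card_bij (fun p _ => p.1) ?_ ?_ ?_
  · rintro ⟨T', u'⟩ h'
    simp only [hD, Finset.mem_sigma, Finset.mem_filter, Finset.mem_erase] at h' ⊢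
    exact ⟨h'.1.1.1, h'.2 ▸ Finset.erase_subset _ _⟩
  · rintro ⟨T₁, u₁⟩ h₁ ⟨T₂, u₂⟩ h₂ heq
    simp only [hD, Finset.mem_sigma, Finset.mem_filter, Finset.mem_erase] at h₁ h₂ heq
    subst heq
    have : u₁ = u₂ := by
      by_contra hne
      have h3 : u₁ ∈ T₁.erase u₂ := Finset.mem_erase.2 ⟨hne, h₁.1.2.1.2⟩
      rw [h₂.2, ← h₁.2] at h3
      exact Finset.notMem_erase _ _ h3
    rw [this]
  · intro T' hT'
    simp only [Finset.mem_filter] at hT'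
    obtain ⟨hT', hsub⟩ := hT'
    have hc' := hK.card T' hT'
    obtain ⟨u', hu'⟩ : ∃ u', T' \ T.erase u = {u'} := by
      rw [← Finset.card_eq_one, Finset.card_sdiff_of_subset hsub, hc', hc]; omega
    have hu'm : u' ∈ T' \ T.erase u := by rw [hu']; simp
    rw [Finset.mem_sdiff] at hu'm
    have her : T'.erase u' = T.erase u := by
      rw [← Finset.sdiff_singleton_eq_erase, ← hu', Finset.sdiff_sdiff_eq_self hsub]
    have hv : v ∈ T.erase u := Finset.mem_erase.2 ⟨huv.symm, hvT⟩
    refine ⟨⟨T', u'⟩, ?_, rfl⟩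
    simp only [hD, Finset.mem_sigma, Finset.mem_filter, Finset.mem_erase]
    refine ⟨⟨⟨hT', hsub hv⟩, ⟨fun he => hu'm.2 (he ▸ hv), hu'm.1⟩, her ▸ hh⟩, her⟩

/-- Replacing the value of an equivariant map on one orbit by a generic one. -/
theorem zeroComb_step [Fintype P] [Fintype W] [FiniteDimensional ℝ V] (hV : Module.finrank ℝ V = N)
    (hK : FreeComplex P W TT N) {F F' : P → E}
    (hF : ∀ (w : W) x, F (w • x) = ρ w (F x)) (hF' : ∀ (w : W) x, F' (w • x) = ρ w (F' x))
    (hFV : ∀ x, F x ∈ V) (hFV' : ∀ x, F' x ∈ V)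
    (hadm : ∀ T ∈ TT, ∀ u ∈ T, ¬ ZeroComb F (T.erase u)) {v : P}
    (hoff : ∀ x, (∀ w : W, w • v ≠ x) → F' x = F x)
    (hgen : ∀ R : Finset P, R.card < N → F' v ∉ Submodule.span ℝ (F '' ↑R)) :
    (∀ T ∈ TT, ∀ u ∈ T, ¬ ZeroComb F' (T.erase u)) ∧
    ∀ [DecidablePred (ZeroComb F)] [DecidablePred (ZeroComb F')],
      (TT.filter (ZeroComb F)).card ≡ (TT.filter (ZeroComb F')).card
        [MOD 2 * Fintype.card W] := by
  classical
  -- away from `v`, the two maps agree on simplices containing `v`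
  have hagree : ∀ T ∈ TT, v ∈ T → ∀ x ∈ T, x ≠ v → F' x = F x := by
    intro T hT hv x hx hxv
    refine hoff x fun w hw => hxv ?_
    have := hK.orbit T hT v hv w (hw ▸ hx)
    rw [← hw, this, one_smul]
  have hadmv : ∀ T ∈ TT, v ∈ T → ∀ u ∈ T, ¬ ZeroComb F' (T.erase u) := by
    intro T hT hv u hu hZ
    by_cases huv : u = v
    · subst huv
      refine hadm T hT u hu ((ZeroComb.congr fun x hx => ?_).1 hZ)
      exact hagree T hT hv x (Finset.mem_of_mem_erase hx) (Finset.ne_of_mem_erase hx)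
    · have hvu : v ∈ T.erase u := Finset.mem_erase.2 ⟨fun h => huv h.symm, hv⟩
      have hag : ∀ x ∈ (T.erase u).erase v, F' x = F x := fun x hx =>
        hagree T hT hv x (Finset.mem_of_mem_erase (Finset.mem_of_mem_erase hx))
          (Finset.ne_of_mem_erase hx)
      have := ZeroComb.of_insert_generic hvu (by
        rw [Set.image_congr (fun x hx => hag x hx)]
        refine hgen _ ?_
        have h1 := hK.card T hT
        have h2 := Finset.card_erase_of_mem hu
        have h3 := Finset.card_erase_of_mem hvu
        have h4 : 0 < (T.erase u).card := Finset.card_pos.2 ⟨v, hvu⟩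
        omega) hZ
      exact hadm T hT u hu (((ZeroComb.congr hag).1 this).mono (Finset.erase_subset _ _))
  have hadm' : ∀ T ∈ TT, ∀ u ∈ T, ¬ ZeroComb F' (T.erase u) := by
    intro T hT u hu hZ
    by_cases hm : ∃ w : W, w • v ∈ T
    · obtain ⟨w, hw⟩ := hm
      have hw' : v ∈ T.image (w⁻¹ • ·) := Finset.mem_image.2 ⟨_, hw, inv_smul_smul w v⟩
      refine hadmv _ (hK.inv w⁻¹ T hT) hw' (w⁻¹ • u) (Finset.mem_image_of_mem _ hu) ?_
      have := (ZeroComb.image_smul_iff ρ hF' w⁻¹).2 hZ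
      rwa [Finset.image_erase (MulAction.injective w⁻¹)] at this
    · push Not at hm
      refine hadm T hT u hu ((ZeroComb.congr fun x hx => ?_).1 hZ)
      exact hoff x fun w hw => hm w (hw ▸ Finset.mem_of_mem_erase hx)
  refine ⟨hadm', ?_⟩
  intro dF dF'
  have split : ∀ (G : P → E) [DecidablePred (ZeroComb G)],
      (∀ (w : W) x, G (w • x) = ρ w (G x)) → (TT.filter (ZeroComb G)).card =
      Fintype.card W * (TT.filter (fun T => v ∈ T ∧ ZeroComb G T)).card +
      (TT.filter (fun T => (¬ ∃ w : W, w • v ∈ T) ∧ ZeroComb G T)).card := by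
    intro G _ hG
    have h1 : Fintype.card W * (TT.filter (fun T => v ∈ T ∧ ZeroComb G T)).card =
        (TT.filter (fun T => (∃ w : W, w • v ∈ T) ∧ ZeroComb G T)).card := by
      convert (card_zeroComb_orbit hK hG v).symm
    rw [h1, ← Finset.card_filter_add_card_filter_not
      (s := TT.filter (ZeroComb G)) (fun T => ∃ w : W, w • v ∈ T), Finset.filter_filter,
      Finset.filter_filter]
    congr 2 <;> (ext T; simp only [Finset.mem_filter]; tauto)
  rw [split F hF, split F' hF']
  have hsame : TT.filter (fun T => (¬ ∃ w : W, w • v ∈ T) ∧ ZeroComb F T) =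
      TT.filter (fun T => (¬ ∃ w : W, w • v ∈ T) ∧ ZeroComb F' T) := by
    refine Finset.filter_congr fun T _ => and_congr_right fun hm => ?_
    push Not at hm
    exact ZeroComb.congr fun x hx => (hoff x fun w hw => hm w (hw ▸ hx)).symm
  rw [hsame]
  refine Nat.ModEq.add_right _ ?_
  rw [mul_comm 2]
  refine Nat.ModEq.mul_left' _ ?_
  -- parity of the simplices at `v`
  set b : Option P → E := fun o => o.elim (F' v) F with hb
  set h : Finset P → Prop := fun R => ZeroComb b (Finset.insertNone R) with hh
  have hev : ∀ T ∈ TT.filter (v ∈ ·), Even (((if ZeroComb F T then 1 else 0) +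
      (if ZeroComb F' T then 1 else 0)) +
      ((T.erase v).filter (fun u => h (T.erase u))).card) := by
    intro T hT
    obtain ⟨hT, hv⟩ := Finset.mem_filter.1 hT
    have hQc : (Finset.insertNone T).card = N + 2 := by
      rw [Finset.card_insertNone, hK.card T hT]
    have e0 : (Finset.insertNone T).erase none = T.map Function.Embedding.some := by
      ext o; cases o <;> simp
    have e1 : ∀ (T : Finset P) u,
        (Finset.insertNone T).erase (some u) = Finset.insertNone (T.erase u) := by
      intro T u; ext o; cases o <;> simp
    have Z0 : ∀ R : Finset P, ZeroComb b (R.map Function.Embedding.some) ↔ ZeroComb F R := by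
      intro R; rw [ZeroComb.map_iff]; rfl
    have Zv : ∀ R ⊆ T, v ∈ R → (ZeroComb b (Finset.insertNone (R.erase v)) ↔
        ZeroComb F' R) := by
      intro R hRT hvR
      have hinj : Function.Injective (fun x : P => if x = v then none else some x) := by
        intro x y hxy
        dsimp only at hxy
        split_ifs at hxy with h1 h2
        · rw [h1, h2]
        · exact Option.some_injective _ hxy
      have : Finset.insertNone (R.erase v) = R.map ⟨_, hinj⟩ := by
        ext o
        cases o with
        | none => simpa using hvR
        | some y =>
          simp only [Finset.some_mem_insertNone, Finset.mem_erase, Finset.mem_map,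
            Function.Embedding.coeFn_mk]
          constructor
          · rintro ⟨h1, h2⟩; exact ⟨y, h2, by simp [h1]⟩
          · rintro ⟨x, h2, h3⟩
            split_ifs at h3 with h4
            cases h3
            exact ⟨h4, h2⟩
      rw [this, ZeroComb.map_iff]
      refine ZeroComb.congr fun x hx => ?_
      by_cases hxv : x = v
      · simp [hb, hxv]
      · simpa [hb, hxv] using (hagree T hT hv x (hRT hx) hxv).symm
    have main := even_card_zeroComb_erase hV hQc (b := b) (by
      intro i _; cases i with
      | none => exact hFV' v
      | some x => exact hFV x) (by
      have a0 : ∀ j ∈ T, ¬ ZeroComb b (((Finset.insertNone T).erase none).erase (some j)) := by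
        intro j hj
        rw [e0]
        have : (T.map Function.Embedding.some).erase (some j) =
            (T.erase j).map Function.Embedding.some := by
          rw [Finset.map_erase]; rfl
        rw [this, Z0]
        exact hadm T hT j hj
      have av : ∀ j ∈ T, j ≠ v → ¬ ZeroComb b (((Finset.insertNone T).erase (some v)).erase
          (some j)) := by
        intro j hj hjv
        have : ((Finset.insertNone T).erase (some v)).erase (some j) =
            Finset.insertNone ((T.erase j).erase v) := by
          rw [e1, e1, Finset.erase_right_comm]
        rw [this, Zv _ (Finset.erase_subset _ _) (Finset.mem_erase.2 ⟨hjv.symm, hv⟩)]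
        exact hadm' T hT j hj
      have ag : ∀ i ∈ T, ∀ j ∈ T, i ≠ j → i ≠ v → j ≠ v → ¬ ZeroComb b
          (((Finset.insertNone T).erase (some i)).erase (some j)) := by
        intro i hi j hj hij hiv hjv hZ
        have e2 : ((Finset.insertNone T).erase (some i)).erase (some j) =
            Finset.insertNone ((T.erase i).erase j) := by
          rw [e1, e1]
        have e3 : (Finset.insertNone ((T.erase i).erase j)).erase none =
            ((T.erase i).erase j).map Function.Embedding.some := by
          ext o; cases o <;> simp
        rw [e2] at hZ
        have := ZeroComb.of_insert_generic (q := none) (by simp) (by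
          rw [e3]
          have : b '' ↑(((T.erase i).erase j).map Function.Embedding.some) =
              F '' ↑((T.erase i).erase j) := by
            rw [Finset.coe_map, Set.image_image]; rfl
          rw [this]
          refine hgen _ ?_
          have hji : j ∈ T.erase i := Finset.mem_erase.2 ⟨hij.symm, hj⟩
          have h1 := hK.card T hT
          have h2 := Finset.card_erase_of_mem hi
          have h3 := Finset.card_erase_of_mem hji
          have h4 : 0 < (T.erase i).card := Finset.card_pos.2 ⟨j, hji⟩
          omega) hZ
        rw [e3, Z0] at this
        exact hadm T hT i hi (this.mono (Finset.erase_subset _ _))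
      intro i hi j hj hij
      match i, j with
      | none, none => exact absurd rfl hij
      | none, some j => exact a0 j (by simpa using hj)
      | some i, none =>
        rw [Finset.erase_right_comm]; exact a0 i (by simpa using hi)
      | some i, some j =>
        have hi' : i ∈ T := by simpa using hi
        have hj' : j ∈ T := by simpa using hj
        have hij' : i ≠ j := fun h => hij (by rw [h])
        by_cases h1 : i = v
        · subst h1; exact av j hj' hij'.symm
        · by_cases h2 : j = v
          · subst h2; rw [Finset.erase_right_comm]; exact av i hi' hij'
          · exact ag i hi' j hj' hij' h1 h2)
      ((Finset.insertNone T).filter fun i => ZeroComb b ((Finset.insertNone T).erase i))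
      (fun i => by simp only [Finset.mem_filter])
    have hcount : ((Finset.insertNone T).filter fun i =>
        ZeroComb b ((Finset.insertNone T).erase i)).card =
        ((if ZeroComb F T then 1 else 0) + (if ZeroComb F' T then 1 else 0)) +
        ((T.erase v).filter (fun u => h (T.erase u))).card := by
      rw [Finset.card_filter, Finset.card_filter]
      have hsum : ∀ k : Option P → ℕ, ∑ i ∈ Finset.insertNone T, k i =
          k none + ∑ x ∈ T, k (some x) := by
        intro k
        rw [← Finset.add_sum_erase _ _ (show none ∈ Finset.insertNone T by simp), e0,
          Finset.sum_map]
        rfl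
      rw [hsum, ← Finset.add_sum_erase _ _ hv, e0]
      simp only [e1, Z0, Zv T subset_rfl hv, hh]
      ring
    rw [← hcount]
    exact main
  have htot := Finset.even_sum _ hev
  rw [Finset.sum_add_distrib, Nat.even_add] at htot
  have htot' := htot.2 (even_card_facets hK v h)
  rw [Finset.sum_add_distrib, ← Finset.card_filter, ← Finset.card_filter, Finset.filter_filter,
    Finset.filter_filter] at htot'
  rw [Nat.ModEq]
  obtain ⟨k, hk⟩ := htot'
  omega

theorem exists_modify_orbit (hfree : ∀ (w : W) (x : P), w • x = x → w = 1) {F : P → E}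
    (hF : ∀ (w : W) x, F (w • x) = ρ w (F x)) (v : P) (g : E) :
    ∃ F' : P → E, (∀ (w : W) x, F' (w • x) = ρ w (F' x)) ∧ F' v = g ∧
      (∀ x, (∀ w : W, w • v ≠ x) → F' x = F x) := by
  classical
  have hval : ∀ w : W, ∀ h : (∃ w' : W, w' • v = w • v), h.choose = w := by
    intro w h
    have h1 := h.choose_spec
    have := hfree (w⁻¹ * h.choose) v (by rw [mul_smul, h1, inv_smul_smul])
    rw [inv_mul_eq_one] at this
    exact this.symm
  let F' : P → E := fun x => if h : ∃ w : W, w • v = x then ρ h.choose g else F x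
  have hv : ∀ w : W, F' (w • v) = ρ w g := by
    intro w
    have h : ∃ w' : W, w' • v = w • v := ⟨w, rfl⟩
    simp only [F', dif_pos h, hval w h]
  have hoff : ∀ x, (∀ w : W, w • v ≠ x) → F' x = F x := by
    intro x hx
    have h : ¬ ∃ w : W, w • v = x := by push Not; exact hx
    simp only [F', dif_neg h]
  refine ⟨F', fun w x => ?_, by simpa using hv 1, hoff⟩
  by_cases h : ∃ w' : W, w' • v = x
  · obtain ⟨w', rfl⟩ := h
    rw [smul_smul, hv, hv, map_mul]; rfl
  · push Not at h
    rw [hoff x h, hoff (w • x), hF]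
    intro w' hw'
    exact h (w⁻¹ * w') (by rw [mul_smul, hw', inv_smul_smul])

theorem exists_generic [Fintype P] [FiniteDimensional ℝ V] (hV : Module.finrank ℝ V = N)
    (F₀ F₁ : P → E) :
    ∃ g ∈ V, ∀ R : Finset P, R.card < N → g ∉ Submodule.span ℝ (F₀ '' ↑R) ∧
      g ∉ Submodule.span ℝ (F₁ '' ↑R) := by
  classical
  let S : Finset (Submodule ℝ V) :=
    (Finset.univ.filter fun R : Finset P => R.card < N).image
      (fun R : Finset P => (Submodule.span ℝ (F₀ '' ↑R)).comap V.subtype) ∪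
    (Finset.univ.filter fun R : Finset P => R.card < N).image
      (fun R : Finset P => (Submodule.span ℝ (F₁ '' ↑R)).comap V.subtype)
  have hproper : ∀ (F : P → E) (R : Finset P), R.card < N →
      (Submodule.span ℝ (F '' ↑R)).comap V.subtype ≠ ⊤ := by
    intro F R hR h
    have hle : V ≤ Submodule.span ℝ (F '' ↑R) := by
      intro x hx
      have : (⟨x, hx⟩ : V) ∈ (Submodule.span ℝ (F '' ↑R)).comap V.subtype := by rw [h]; trivial
      exact this
    rw [← Finset.coe_image] at hle
    have h1 := Submodule.finrank_mono hle
    have h2 := finrank_span_finset_le_card (R := ℝ) (R.image F)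
    have h3 := Finset.card_image_le (s := R) (f := F)
    simp only [Set.finrank] at h2
    omega
  have htop : ⊤ ∉ S := by
    simp only [S, Finset.mem_union, Finset.mem_image, Finset.mem_filter, Finset.mem_univ,
      true_and]
    rintro (⟨R, hR, h⟩ | ⟨R, hR, h⟩)
    · exact hproper F₀ R hR h
    · exact hproper F₁ R hR h
  have := Subspace.biUnion_ne_univ_of_top_notMem htop
  rw [Set.ne_univ_iff_exists_notMem] at this
  obtain ⟨g, hg⟩ := this
  simp only [Set.mem_iUnion, not_exists] at hg
  refine ⟨g, g.2, fun R hR => ⟨fun h => ?_, fun h => ?_⟩⟩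
  · exact hg _ (Finset.mem_union_left _ (Finset.mem_image.2 ⟨R, by simpa using hR, rfl⟩)) h
  · exact hg _ (Finset.mem_union_right _ (Finset.mem_image.2 ⟨R, by simpa using hR, rfl⟩)) h

/-- The number of zeros of an admissible equivariant simplexwise affine map is, modulo twice the
order of the group, independent of the map. -/
theorem card_zeroComb_modEq [Fintype P] [Fintype W] [FiniteDimensional ℝ V] (hV : Module.finrank ℝ V = N)
    (hVinv : ∀ (w : W), ∀ v ∈ V, ρ w v ∈ V)
    (hK : FreeComplex P W TT N) {F₀ F₁ : P → E}
    (h₀ : ∀ (w : W) x, F₀ (w • x) = ρ w (F₀ x)) (h₁ : ∀ (w : W) x, F₁ (w • x) = ρ w (F₁ x))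
    (hV₀ : ∀ x, F₀ x ∈ V) (hV₁ : ∀ x, F₁ x ∈ V)
    (a₀ : ∀ T ∈ TT, ∀ u ∈ T, ¬ ZeroComb F₀ (T.erase u))
    (a₁ : ∀ T ∈ TT, ∀ u ∈ T, ¬ ZeroComb F₁ (T.erase u))
    [DecidablePred (ZeroComb F₀)] [DecidablePred (ZeroComb F₁)] :
    (TT.filter (ZeroComb F₀)).card ≡ (TT.filter (ZeroComb F₁)).card
      [MOD 2 * Fintype.card W] := by
  classical
  induction hn : (Finset.univ.filter fun x => F₀ x ≠ F₁ x).card using Nat.strong_induction_on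
    generalizing F₀ F₁ with
  | _ n ih =>
  by_cases heq : F₀ = F₁
  · subst heq; congr!
  obtain ⟨v, hv⟩ := Function.ne_iff.1 heq
  obtain ⟨g, hgV, hg⟩ := exists_generic hV F₀ F₁
  have hVof : ∀ {F F' : P → E}, (∀ x, F x ∈ V) → (∀ (w : W) x, F' (w • x) = ρ w (F' x)) →
      F' v = g → (∀ x, (∀ w : W, w • v ≠ x) → F' x = F x) → ∀ x, F' x ∈ V := by
    intro F F' hF hF' hFv hoff x
    by_cases h : ∃ w : W, w • v = x
    · obtain ⟨w, rfl⟩ := h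
      rw [hF', hFv]; exact hVinv w g hgV
    · push Not at h
      rw [hoff x h]; exact hF x
  obtain ⟨G₀, e₀, v₀, o₀⟩ := exists_modify_orbit hK.free h₀ v g
  obtain ⟨G₁, e₁, v₁, o₁⟩ := exists_modify_orbit hK.free h₁ v g
  have W₀ := hVof hV₀ e₀ v₀ o₀
  have W₁ := hVof hV₁ e₁ v₁ o₁
  obtain ⟨b₀, c₀⟩ := zeroComb_step hV hK h₀ e₀ hV₀ W₀ a₀ o₀ (fun R hR => v₀ ▸ (hg R hR).1)
  obtain ⟨b₁, c₁⟩ := zeroComb_step hV hK h₁ e₁ hV₁ W₁ a₁ o₁ (fun R hR => v₁ ▸ (hg R hR).2)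
  refine c₀.trans (Nat.ModEq.trans (ih _ ?_ e₀ e₁ W₀ W₁ b₀ b₁ rfl) c₁.symm)
  rw [← hn]
  refine Finset.card_lt_card ?_
  rw [Finset.ssubset_iff_of_subset]
  · exact ⟨v, by simpa using hv, by simp [v₀, v₁]⟩
  · intro x hx
    simp only [Finset.mem_filter, Finset.mem_univ, true_and] at hx ⊢
    by_cases h : ∃ w : W, w • v = x
    · obtain ⟨w, rfl⟩ := h
      rw [e₀, e₁, v₀, v₁] at hx
      exact absurd rfl hx
    · push Not at h
      rwa [o₀ x h, o₁ x h] at hx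

end Equivariant

end Parity

section Tree

/-- `v` or `-v` according to a boolean. -/
def bflip {A : Type*} [Neg A] (b : Bool) (v : A) : A := if b then v else -v

theorem bflip_true {A : Type*} [Neg A] (v : A) : bflip true v = v := rfl

theorem bflip_false {A : Type*} [Neg A] (v : A) : bflip false v = -v := rfl

theorem bflip_bflip {A : Type*} [InvolutiveNeg A] (b c : Bool) (v : A) :
    bflip b (bflip c v) = bflip (b == c) v := by
  cases b <;> cases c <;> simp [bflip]

theorem bflip_apply {α A : Type*} [Neg A] (b : Bool) (v : α → A) (a : α) :
    bflip b v a = bflip b (v a) := by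
  cases b <;> rfl

/-- Leaves of the binary tree of depth `d`; bits of higher index are closer to the root. -/
abbrev Leaf (d : ℕ) := Fin d → Bool

/-- Inner nodes of the binary tree of depth `d`. -/
abbrev Node (d : ℕ) := Σ i : Fin d, ({l : Fin d // i < l} → Bool)

variable {d : ℕ}

/-- The node at level `i` on the way to the leaf `s`. -/
def nodeOf (s : Leaf d) (i : Fin d) : Node d := ⟨i, fun l => s l⟩

/-- A leaf below a node. -/
def leafOf (ν : Node d) : Leaf d := fun l => if h : ν.1 < l then ν.2 ⟨l, h⟩ else true

theorem nodeOf_eq_iff {s t : Leaf d} {i : Fin d} :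
    nodeOf s i = nodeOf t i ↔ ∀ l, i < l → s l = t l := by
  unfold nodeOf
  rw [Sigma.mk.injEq]
  simp only [heq_eq_eq, true_and, funext_iff, Subtype.forall]

theorem nodeOf_leafOf (ν : Node d) : nodeOf (leafOf ν) ν.1 = ν := by
  obtain ⟨i, f⟩ := ν
  unfold nodeOf leafOf
  congr 1
  ext ⟨l, hl⟩
  simp [hl]

theorem leafOf_self (ν : Node d) : leafOf ν ν.1 = true := by simp [leafOf]

theorem leafOf_nodeOf (s : Leaf d) (i l : Fin d) (h : i < l) : leafOf (nodeOf s i) l = s l := by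
  simp [leafOf, nodeOf, h]

/-- The labels met on the way to a leaf, with signs. -/
def path {A : Type*} [Neg A] (x : Node d → A) (s : Leaf d) (i : Fin d) : A :=
  bflip (s i) (x (nodeOf s i))

theorem path_leafOf {A : Type*} [Neg A] (x : Node d → A) (ν : Node d) :
    path x (leafOf ν) ν.1 = x ν := by
  rw [path, leafOf_self, nodeOf_leafOf, bflip_true]

theorem path_left_injective {A : Type*} [Neg A] {x y : Node d → A}
    (h : ∀ s, path x s = path y s) : x = y := by
  ext ν
  rw [← path_leafOf x, ← path_leafOf y, h]

theorem path_right_injective {A : Type*} [Neg A] {x : Node d → A} (hx : ∀ ν, -x ν ≠ x ν)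
    {s t : Leaf d} (h : path x s = path x t) : s = t := by
  by_contra hne
  obtain ⟨i₀, hi₀⟩ := Function.ne_iff.1 hne
  obtain ⟨i, hi, hmax⟩ := (Finset.univ.filter fun i => s i ≠ t i).exists_max_image id
    ⟨i₀, by simpa using hi₀⟩
  have hnd : nodeOf s i = nodeOf t i := by
    rw [nodeOf_eq_iff]
    intro l hl
    by_contra hc
    exact absurd (hmax l (by simpa using hc)) (not_le.2 hl)
  have h1 := congrFun h i
  simp only [path, hnd] at h1
  have hi' : s i ≠ t i := by simpa using hi
  cases hs : s i <;> cases ht : t i <;> simp [hs, ht, bflip] at h1 hi'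
  · exact hx _ h1
  · exact hx _ h1.symm

/-- The automorphism group of the binary tree. -/
def treeGroup (d : ℕ) : Subgroup (Equiv.Perm (Leaf d)) where
  carrier := {σ | ∀ (i : ℕ) (s t : Leaf d), (∀ l : Fin d, i ≤ l → σ s l = σ t l) ↔
    ∀ l : Fin d, i ≤ l → s l = t l}
  mul_mem' := fun {σ τ} hσ hτ i s t => by
    rw [Equiv.Perm.mul_apply, Equiv.Perm.mul_apply]
    exact (hσ i _ _).trans (hτ i _ _)
  one_mem' := fun i s t => Iff.rfl
  inv_mem' := fun {σ} hσ i s t => by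
    have := hσ i (σ⁻¹ s) (σ⁻¹ t)
    have e : ∀ u, σ (σ⁻¹ u) = u := σ.apply_symm_apply
    rw [e, e] at this
    exact this.symm

/-- The sign by which a tree automorphism acts at a node. -/
def nodeSign (σ : treeGroup d) (ν : Node d) : Bool := σ.1 (leafOf ν) ν.1

/-- The action of a tree automorphism on nodes. -/
def nodeMap (σ : treeGroup d) (ν : Node d) : Node d := nodeOf (σ.1 (leafOf ν)) ν.1

theorem nodeOf_smul (σ : treeGroup d) (s : Leaf d) (i : Fin d) :
    nodeOf (σ.1 s) i = nodeMap σ (nodeOf s i) := by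
  unfold nodeMap
  change _ = nodeOf (σ.1 (leafOf (nodeOf s i))) i
  rw [nodeOf_eq_iff]
  exact (σ.2 (i + 1) s (leafOf (nodeOf s i))).2 fun l hl =>
    (leafOf_nodeOf s i l (Nat.lt_of_succ_le hl)).symm

theorem smul_leaf_apply (σ : treeGroup d) (s : Leaf d) (i : Fin d) :
    σ.1 s i = (s i == nodeSign σ (nodeOf s i)) := by
  unfold nodeSign
  change _ = (s i == σ.1 (leafOf (nodeOf s i)) i)
  have hup : ∀ l : Fin d, i < l → s l = leafOf (nodeOf s i) l := fun l hl =>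
    (leafOf_nodeOf s i l hl).symm
  have hself : leafOf (nodeOf s i) i = true := leafOf_self (nodeOf s i)
  have h1 := (σ.2 (i + 1) s (leafOf (nodeOf s i))).2 fun l hl => hup l (Nat.lt_of_succ_le hl)
  have h2 := σ.2 i s (leafOf (nodeOf s i))
  have h3 : (∀ l : Fin d, (i : ℕ) ≤ l → s l = leafOf (nodeOf s i) l) ↔ s i = true := by
    refine ⟨fun h => (h i le_rfl).trans hself, fun h l hl => ?_⟩
    rcases (show i ≤ l from hl).eq_or_lt with rfl | hl
    · rw [h, hself]
    · exact hup l hl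
  have h4 : (∀ l : Fin d, (i : ℕ) ≤ l → σ.1 s l = σ.1 (leafOf (nodeOf s i)) l) ↔
      σ.1 s i = σ.1 (leafOf (nodeOf s i)) i := by
    refine ⟨fun h => h i le_rfl, fun h l hl => ?_⟩
    rcases (show i ≤ l from hl).eq_or_lt with rfl | hl
    · exact h
    · exact h1 l hl
  rw [h3, h4] at h2
  generalize σ.1 (leafOf (nodeOf s i)) i = q at *
  generalize σ.1 s i = p at *
  generalize s i = r at *
  revert h2
  cases p <;> cases q <;> cases r <;> simp

theorem nodeMap_mul (σ τ : treeGroup d) (ν : Node d) :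
    nodeMap (σ * τ) ν = nodeMap σ (nodeMap τ ν) := by
  rw [← nodeOf_leafOf ν, ← nodeOf_smul, ← nodeOf_smul, ← nodeOf_smul]
  rfl

theorem nodeMap_one (ν : Node d) : nodeMap 1 ν = ν := nodeOf_leafOf ν

/-- Nodes are permuted by a tree automorphism. -/
def nodePerm (σ : treeGroup d) : Equiv.Perm (Node d) where
  toFun := nodeMap σ
  invFun := nodeMap σ⁻¹
  left_inv ν := by rw [← nodeMap_mul, inv_mul_cancel, nodeMap_one]
  right_inv ν := by rw [← nodeMap_mul, mul_inv_cancel, nodeMap_one]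

/-- The action of tree automorphisms on labellings of the nodes. -/
def treeAct {A : Type*} [Neg A] (σ : treeGroup d) (x : Node d → A) : Node d → A :=
  fun ν => bflip (nodeSign σ⁻¹ ν) (x (nodeMap σ⁻¹ ν))

theorem path_treeAct {A : Type*} [InvolutiveNeg A] (σ : treeGroup d) (x : Node d → A)
    (s : Leaf d) : path (treeAct σ x) s = path x (σ⁻¹.1 s) := by
  ext i
  rw [path, path, treeAct, bflip_bflip, smul_leaf_apply σ⁻¹ s i, nodeOf_smul]

theorem treeAct_nodeMap {A : Type*} [InvolutiveNeg A] (σ : treeGroup d) (x : Node d → A)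
    (ν : Node d) : treeAct σ x (nodeMap σ ν) = bflip (nodeSign σ ν) (x ν) := by
  have h := congrFun (path_treeAct σ x (σ.1 (leafOf ν))) ν.1
  have h2 : σ⁻¹.1 (σ.1 (leafOf ν)) = leafOf ν := by simp
  rw [h2, path_leafOf, path] at h
  rw [nodeOf_smul, nodeOf_leafOf] at h
  have h3 : σ.1 (leafOf ν) ν.1 = nodeSign σ ν := rfl
  rw [h3] at h
  rw [← h, bflip_bflip]
  simp [bflip_true]

/-- The tree automorphism flipping the branches below the nodes with sign `false`. -/
theorem exists_treeGroup_sign (ε : Node d → Bool) : ∃ σ : treeGroup d, ∀ ν, nodeSign σ ν = ε ν := by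
  let f : Leaf d → Leaf d := fun s i => (s i == ε (nodeOf s i))
  have hf : ∀ (i : ℕ) (s t : Leaf d), (∀ l : Fin d, i ≤ l → f s l = f t l) ↔
      ∀ l : Fin d, i ≤ l → s l = t l := by
    intro i s t
    refine ⟨fun h => ?_, fun h l hl => ?_⟩
    · by_contra! hc
      obtain ⟨l₀, hl₀, hne₀⟩ := hc
      obtain ⟨l, hl, hmax⟩ := (Finset.univ.filter fun l : Fin d => s l ≠ t l).exists_max_image id
        ⟨l₀, by simpa using hne₀⟩
      have hnd : nodeOf s l = nodeOf t l := by
        rw [nodeOf_eq_iff]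
        intro l' hl'
        by_contra hc
        exact absurd (hmax l' (by simpa using hc)) (not_le.2 hl')
      have h1 := h l (hl₀.trans (hmax l₀ (by simpa using hne₀)))
      have hl' : s l ≠ t l := by simpa using hl
      simp only [f, hnd] at h1
      revert h1 hl'
      cases s l <;> cases t l <;> cases ε (nodeOf t l) <;> simp
    · have hnd : nodeOf s l = nodeOf t l := by
        rw [nodeOf_eq_iff]
        intro l' hl'
        exact h l' (hl.trans hl'.le)
      simp only [f, hnd, h l hl]
  have hinj : Function.Injective f := fun s t h =>
    funext fun l => (hf 0 s t).1 (fun l _ => by rw [h]) l (Nat.zero_le _)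
  refine ⟨⟨Equiv.ofBijective f (Finite.injective_iff_bijective.1 hinj), hf⟩, fun ν => ?_⟩
  change (leafOf ν ν.1 == ε (nodeOf (leafOf ν) ν.1)) = _
  rw [leafOf_self, nodeOf_leafOf]
  simp

theorem card_node (d : ℕ) : Fintype.card (Node d) = 2 ^ d - 1 := by
  have h1 : ∀ i : Fin d, Fintype.card ({l : Fin d // i < l} → Bool) = 2 ^ (d - 1 - i) := by
    intro i
    rw [Fintype.card_fun, Fintype.card_bool, Fintype.card_subtype]
    congr 1
    have : (Finset.univ.filter fun l : Fin d => i < l) = Finset.Ioi i := by ext; simp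
    rw [this, Fin.card_Ioi]
  rw [Fintype.card_sigma, Finset.sum_congr rfl fun i _ => h1 i,
    Fin.sum_univ_eq_sum_range (fun i => 2 ^ (d - 1 - i)) d,
    Finset.sum_range_reflect (fun i => 2 ^ i),
    Nat.geomSum_eq le_rfl]
  simp

end Tree

theorem Finset.even_card_of_involution {α : Type*} (s : Finset α) (g : ∀ a ∈ s, α)
    (hne : ∀ a ha, g a ha ≠ a) (hmem : ∀ a ha, g a ha ∈ s)
    (hinv : ∀ a ha, g (g a ha) (hmem a ha) = a) : Even s.card := by
  have : ∑ _a ∈ s, (1 : ZMod 2) = 0 :=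
    Finset.sum_involution g (fun a ha => by decide) (fun a ha _ => hne a ha) hmem hinv
  rw [Finset.sum_const, nsmul_eq_mul, mul_one] at this
  exact ZMod.natCast_eq_zero_iff_even.1 this

section Cells

variable {B : Type*} {m : ℕ}

/-- Cells of the boundary of a cube of side `4 M` subdivided into unit cubes, in doubled
coordinates (odd coordinates stand for edges), for a product of boundaries indexed by `B`. -/
def IsCell (M : ℕ) (x : B → Fin (m + 1) → ℤ) : Prop :=
  (∀ ν a, |x ν a| ≤ 2 * M) ∧ ∀ ν, ∃ a, |x ν a| = 2 * M

/-- The face relation between cells. -/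
def Face (x y : B → Fin (m + 1) → ℤ) : Prop :=
  ∀ ν a, x ν a = y ν a ∨ (Odd (y ν a) ∧ |x ν a - y ν a| = 1)

/-- The set of directions spanned by a cell. -/
def oddSet [Fintype B] (x : B → Fin (m + 1) → ℤ) : Finset (B × Fin (m + 1)) :=
  Finset.univ.filter fun c => Odd (x c.1 c.2)

theorem mem_oddSet [Fintype B] {x : B → Fin (m + 1) → ℤ} {c : B × Fin (m + 1)} :
    c ∈ oddSet x ↔ Odd (x c.1 c.2) := by simp [oddSet]

theorem Face.refl (x : B → Fin (m + 1) → ℤ) : Face x x := fun _ _ => Or.inl rfl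

theorem odd_abs_sub_one {p q : ℤ} (hq : Odd q) (h : |p - q| = 1) : Even p := by
  rcases (abs_eq (by norm_num : (0 : ℤ) ≤ 1)).1 h with h | h <;>
  · rw [Int.odd_iff] at hq; rw [Int.even_iff]; omega

theorem Face.trans {x y z : B → Fin (m + 1) → ℤ} (h : Face x y) (h' : Face y z) : Face x z := by
  intro ν a
  rcases h ν a with h1 | ⟨h1, h2⟩
  · rw [h1]; exact h' ν a
  · rcases h' ν a with h3 | ⟨h3, h4⟩
    · rw [← h3]; exact Or.inr ⟨h1, h2⟩
    · exact absurd h1 (Int.not_odd_iff_even.2 (odd_abs_sub_one h3 h4))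

theorem Face.eq_of_odd {x y : B → Fin (m + 1) → ℤ} (h : Face x y) {ν a} (ho : Odd (x ν a)) :
    x ν a = y ν a :=
  (h ν a).resolve_right fun ⟨h1, h2⟩ => Int.not_odd_iff_even.2 (odd_abs_sub_one h1 h2) ho

theorem Face.eq_of_even {x y : B → Fin (m + 1) → ℤ} (h : Face x y) {ν a} (he : Even (y ν a)) :
    x ν a = y ν a :=
  (h ν a).resolve_right fun ⟨h1, _⟩ => Int.not_odd_iff_even.2 he h1

variable [Fintype B]

theorem Face.oddSet_subset {x y : B → Fin (m + 1) → ℤ} (h : Face x y) :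
    oddSet x ⊆ oddSet y := by
  intro c hc
  rw [mem_oddSet] at hc ⊢
  rwa [← h.eq_of_odd hc]

theorem Face.eq_of_card_le {x y : B → Fin (m + 1) → ℤ} (h : Face x y)
    (hc : (oddSet y).card ≤ (oddSet x).card) : x = y := by
  have he := Finset.eq_of_subset_of_card_le h.oddSet_subset hc
  ext ν a
  by_cases ho : Odd (y ν a)
  · refine h.eq_of_odd (mem_oddSet (c := (ν, a)).1 ?_)
    rw [he]; exact mem_oddSet.2 ho
  · exact h.eq_of_even (Int.not_odd_iff_even.1 ho)

open Classical in
theorem exists_even_pair {M : ℕ} {x : B → Fin (m + 1) → ℤ} (hx : IsCell M x) :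
    (oddSet x).card ≤ m * Fintype.card B ∧
    ((oddSet x).card = m * Fintype.card B → ∀ ν a a', Even (x ν a) → Even (x ν a') → a = a') ∧
    ((oddSet x).card + 1 = m * Fintype.card B → ∃ ν a a', a ≠ a' ∧ Even (x ν a) ∧
      Even (x ν a')) := by
  set ev := (oddSet x)ᶜ with hev
  have hmem : ∀ c : B × Fin (m + 1), c ∈ ev ↔ Even (x c.1 c.2) := by
    intro c; rw [hev, Finset.mem_compl, mem_oddSet, Int.not_odd_iff_even]
  have hcard : (oddSet x).card + ev.card = m * Fintype.card B + Fintype.card B := by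
    rw [hev, Finset.card_add_card_compl, Fintype.card_prod, Fintype.card_fin]; ring
  have hsurj : Set.SurjOn Prod.fst (ev : Set (B × Fin (m + 1)))
      ((Finset.univ : Finset B) : Set B) := by
    intro ν _
    obtain ⟨a, ha⟩ := hx.2 ν
    refine ⟨(ν, a), ?_, rfl⟩
    rw [Finset.mem_coe, hmem]
    rw [← even_abs, ha]
    exact even_two_mul _
  have hle := Finset.card_le_card_of_surjOn _ hsurj
  rw [Finset.card_univ] at hle
  refine ⟨by omega, fun h ν a a' ha ha' => ?_, fun h => ?_⟩
  · have hinj := Finset.injOn_of_surjOn_of_card_le (s := ev) (t := Finset.univ) Prod.fst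
      (fun _ _ => by simp) hsurj (by rw [Finset.card_univ]; omega)
    have := hinj (x₁ := (ν, a)) (x₂ := (ν, a')) ((hmem _).2 ha) ((hmem _).2 ha') rfl
    exact congrArg Prod.snd this
  · obtain ⟨c, hc, c', hc', hne, heq⟩ := Finset.exists_ne_map_eq_of_card_lt_of_maps_to
      (s := ev) (t := Finset.univ) (f := Prod.fst) (by rw [Finset.card_univ]; omega)
      (fun _ _ => by simp)
    obtain ⟨ν, a⟩ := c
    obtain ⟨ν', a'⟩ := c'
    dsimp only at heq
    subst heq
    exact ⟨ν, a, a', fun h => hne (by rw [h]), (hmem _).1 hc, (hmem _).1 hc'⟩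

/-- Reflecting a cell in the middle of a flag. -/
theorem reflect_mid {M : ℕ} {z y z' : B → Fin (m + 1) → ℤ} (hz' : IsCell M z')
    (hz : IsCell M z)
    (h : Face z y) (h' : Face y z') : IsCell M (z + z' - y) ∧ Face z (z + z' - y) ∧
      Face (z + z' - y) z' ∧
      (oddSet (z + z' - y)).card + (oddSet y).card = (oddSet z).card + (oddSet z').card := by
  have hcase : ∀ ν a, (z + z' - y) ν a = z ν a + z' ν a - y ν a := fun _ _ => rfl
  have hval : ∀ ν a, (z ν a = y ν a ∧ z ν a + z' ν a - y ν a = z' ν a) ∨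
      (y ν a = z' ν a ∧ z ν a + z' ν a - y ν a = z ν a) := by
    intro ν a
    rcases h ν a with h1 | ⟨h1, -⟩
    · left; exact ⟨h1, by rw [h1]; ring⟩
    · right; have := h'.eq_of_odd h1; exact ⟨this, by rw [this]; ring⟩
  have hzz := h.trans h'
  refine ⟨⟨fun ν a => ?_, fun ν => ?_⟩, fun ν a => ?_, fun ν a => ?_, ?_⟩
  · rw [hcase]
    rcases hval ν a with h1 | h1
    · rw [h1.2]; exact hz'.1 ν a
    · rw [h1.2]; exact hz.1 ν a
  · obtain ⟨a, ha⟩ := hz'.2 ν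
    have he : Even (z' ν a) := by rw [← even_abs, ha]; exact even_two_mul _
    refine ⟨a, ?_⟩
    rw [hcase, hzz.eq_of_even he, h'.eq_of_even he]
    rw [← ha]; congr 1; ring
  · rw [hcase]
    rcases hval ν a with h1 | h1
    · rw [h1.2]; exact hzz ν a
    · rw [h1.2]; left; rfl
  · rw [hcase]
    rcases hval ν a with h1 | h1
    · rw [h1.2]; left; rfl
    · rw [h1.2]; exact hzz ν a
  · simp only [oddSet, Finset.card_filter, ← Finset.sum_add_distrib]
    refine Finset.sum_congr rfl fun c _ => ?_
    rw [hcase]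
    rcases hval c.1 c.2 with h1 | h1
    · rw [h1.2, h1.1]; ring
    · rw [h1.2, h1.1]

/-- Reflecting a vertex of an edge. -/
theorem reflect_bot {M : ℕ} {y z' : B → Fin (m + 1) → ℤ} (hz' : IsCell M z')
    (h' : Face y z') : IsCell M ((2 : ℤ) • z' - y) ∧ Face ((2 : ℤ) • z' - y) z' ∧
      (oddSet ((2 : ℤ) • z' - y)).card = (oddSet y).card := by
  have hcase : ∀ ν a, ((2 : ℤ) • z' - y) ν a = 2 * z' ν a - y ν a := fun _ _ => by simp
  have hodd : ∀ ν a, y ν a = z' ν a → 2 * z' ν a - y ν a = z' ν a := fun ν a h => by rw [h]; ring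
  refine ⟨⟨fun ν a => ?_, fun ν => ?_⟩, fun ν a => ?_, ?_⟩
  · rw [hcase]
    rcases h' ν a with h1 | ⟨h1, h2⟩
    · rw [hodd ν a h1]; exact hz'.1 ν a
    · have h3 := hz'.1 ν a
      have h4 : (z' ν a) % 2 = 1 := Int.odd_iff.1 h1
      rw [abs_le] at h3 ⊢
      rcases (abs_eq (by norm_num : (0 : ℤ) ≤ 1)).1 h2 with h2 | h2 <;> omega
  · obtain ⟨a, ha⟩ := hz'.2 ν
    have he : Even (z' ν a) := by rw [← even_abs, ha]; exact even_two_mul _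
    exact ⟨a, by rw [hcase, hodd ν a (h'.eq_of_even he), ha]⟩
  · rw [hcase]
    rcases h' ν a with h1 | ⟨h1, h2⟩
    · rw [hodd ν a h1]; left; rfl
    · right
      refine ⟨h1, ?_⟩
      rw [← h2, ← abs_neg]; congr 1; ring
  · congr 1
    ext c
    rw [mem_oddSet, mem_oddSet, hcase, Int.odd_iff, Int.odd_iff]
    omega

open Classical in
/-- The maximal cells above a cell of codimension one come in pairs. -/
theorem exists_reflect_top {M : ℕ} {z : B → Fin (m + 1) → ℤ} (hz : IsCell M z)
    (hzc : (oddSet z).card + 1 = m * Fintype.card B) :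
    ∃ A : B → Fin (m + 1) → ℤ, ∀ y, IsCell M y → Face z y →
      (oddSet y).card = m * Fintype.card B →
      IsCell M (A - y) ∧ Face z (A - y) ∧ (oddSet (A - y)).card = m * Fintype.card B ∧
      A - y ≠ y := by
  obtain ⟨ν₀, a₀, a₁, hne, he0, he1⟩ := (exists_even_pair hz).2.2 hzc
  -- a maximal cell above `z` differs from it exactly in one of these coordinates
  have hstruct : ∀ y, IsCell M y → Face z y → (oddSet y).card = m * Fintype.card B →
      ∃ p p', ((p = a₀ ∧ p' = a₁) ∨ (p = a₁ ∧ p' = a₀)) ∧ |z ν₀ p - y ν₀ p| = 1 ∧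
        Odd (y ν₀ p) ∧ y ν₀ p' = z ν₀ p' ∧ (∀ ν a, (ν, a) ≠ (ν₀, p) → y ν a = z ν a) := by
    intro y hy hf hyc
    have huniq := (exists_even_pair hy).2.1 hyc
    have hsub := hf.oddSet_subset
    obtain ⟨q, hq⟩ : ∃ q, oddSet y \ oddSet z = {q} := by
      rw [← Finset.card_eq_one, Finset.card_sdiff_of_subset hsub]; omega
    have hother : ∀ ν a, (ν, a) ≠ q → y ν a = z ν a := by
      intro ν a hna
      rcases hf ν a with h1 | ⟨h1, h2⟩
      · exact h1.symm
      · exfalso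
        apply hna
        have : (ν, a) ∈ oddSet y \ oddSet z := by
          rw [Finset.mem_sdiff, mem_oddSet, mem_oddSet, Int.not_odd_iff_even]
          exact ⟨h1, odd_abs_sub_one h1 h2⟩
        rw [hq] at this
        exact Finset.mem_singleton.1 this
    have hqm : q ∈ oddSet y \ oddSet z := by rw [hq]; simp
    rw [Finset.mem_sdiff, mem_oddSet, mem_oddSet] at hqm
    have hqd : |z q.1 q.2 - y q.1 q.2| = 1 := by
      rcases hf q.1 q.2 with h1 | ⟨h1, h2⟩
      · rw [← h1] at hqm; exact absurd hqm.1 hqm.2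
      · exact h2
    have hq01 : q = (ν₀, a₀) ∨ q = (ν₀, a₁) := by
      by_contra! hcon
      refine hne (huniq ν₀ a₀ a₁ ?_ ?_)
      · rw [hother _ _ hcon.1.symm]; exact he0
      · rw [hother _ _ hcon.2.symm]; exact he1
    rcases hq01 with rfl | rfl
    · exact ⟨a₀, a₁, Or.inl ⟨rfl, rfl⟩, hqd, hqm.1,
        hother _ _ fun h => hne (congrArg Prod.snd h).symm, hother⟩
    · exact ⟨a₁, a₀, Or.inr ⟨rfl, rfl⟩, hqd, hqm.1,
        hother _ _ fun h => hne (congrArg Prod.snd h), hother⟩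
  have hz0 := hz.1 ν₀ a₀
  have hz1 := hz.1 ν₀ a₁
  -- verification of a reflected cell
  have verify : ∀ (y w : B → Fin (m + 1) → ℤ) (p p' : Fin (m + 1)), p ≠ p' → IsCell M y →
      (oddSet y).card = m * Fintype.card B → Odd (y ν₀ p) → Even (z ν₀ p) →
      (∀ ν a, (ν, a) ≠ (ν₀, p) → y ν a = z ν a) → ∀ r r', r ≠ r' →
      ((r = p ∧ r' = p') ∨ (r = p' ∧ r' = p)) → |z ν₀ r - w ν₀ r| = 1 → Even (z ν₀ r) →
      (∀ ν a, (ν, a) ≠ (ν₀, r) → w ν a = z ν a) → |w ν₀ r| ≤ 2 * M → |z ν₀ r'| = 2 * M →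
      IsCell M w ∧ Face z w ∧ (oddSet w).card = m * Fintype.card B := by
    intro y w p p' hpp hy hyc hyo hzpe hoff r r' hrr hr hd hre hwoff hwle hr'
    have hwo : Odd (w ν₀ r) := by
      rw [Int.odd_iff]; rw [Int.even_iff] at hre
      rcases (abs_eq (by norm_num : (0 : ℤ) ≤ 1)).1 hd with h2 | h2 <;> omega
    refine ⟨⟨fun ν a => ?_, fun ν => ?_⟩, fun ν a => ?_, ?_⟩
    · by_cases h : (ν, a) = (ν₀, r)
      · obtain ⟨rfl, rfl⟩ := Prod.mk.inj h; exact hwle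
      · rw [hwoff ν a h]; exact hz.1 ν a
    · by_cases h : ν = ν₀
      · subst h
        exact ⟨r', by rw [hwoff ν r' fun h => hrr (congrArg Prod.snd h).symm, hr']⟩
      · obtain ⟨a, ha⟩ := hz.2 ν
        exact ⟨a, by rw [hwoff ν a fun h' => h (congrArg Prod.fst h'), ha]⟩
    · by_cases h : (ν, a) = (ν₀, r)
      · obtain ⟨rfl, rfl⟩ := Prod.mk.inj h
        exact Or.inr ⟨hwo, hd⟩
      · exact Or.inl (hwoff ν a h).symm
    · have : oddSet w = insert (ν₀, r) (oddSet z) := by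
        ext ⟨ν, a⟩
        rw [Finset.mem_insert, mem_oddSet, mem_oddSet]
        by_cases h : (ν, a) = (ν₀, r)
        · obtain ⟨rfl, rfl⟩ := Prod.mk.inj h
          simp [hwo]
        · simp only [h, false_or, hwoff ν a h]
      rw [this, Finset.card_insert_of_notMem, hzc]
      rw [mem_oddSet, Int.not_odd_iff_even]; exact hre
  by_cases hboth : |z ν₀ a₀| = 2 * M ∧ |z ν₀ a₁| = 2 * M
  · -- both coordinates are extreme
    obtain ⟨hb0, hb1⟩ := hboth
    set e : B → Fin (m + 1) → ℤ := fun ν a =>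
      if ν = ν₀ ∧ (a = a₀ ∨ a = a₁) then (z ν a).sign else 0 with he
    refine ⟨(2 : ℤ) • z - e, fun y hy hf hyc => ?_⟩
    obtain ⟨p, p', hp, hd, ho, hp', hoff⟩ := hstruct y hy hf hyc
    have hpp : p ≠ p' := by rcases hp with ⟨rfl, rfl⟩ | ⟨rfl, rfl⟩; exacts [hne, hne.symm]
    have hzp : |z ν₀ p| = 2 * M ∧ Even (z ν₀ p) ∧ e ν₀ p = (z ν₀ p).sign := by
      rcases hp with ⟨rfl, rfl⟩ | ⟨rfl, rfl⟩
      · exact ⟨hb0, he0, by simp [he]⟩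
      · exact ⟨hb1, he1, by simp [he]⟩
    have hzp' : |z ν₀ p'| = 2 * M ∧ Even (z ν₀ p') ∧ e ν₀ p' = (z ν₀ p').sign := by
      rcases hp with ⟨rfl, rfl⟩ | ⟨rfl, rfl⟩
      · exact ⟨hb1, he1, by simp [he]⟩
      · exact ⟨hb0, he0, by simp [he]⟩
    have hcase : ∀ ν a, ((2 : ℤ) • z - e - y) ν a = 2 * z ν a - e ν a - y ν a :=
      fun _ _ => by simp
    have hMpos : 0 < M := by
      rcases Nat.eq_zero_or_pos M with h0 | h0
      · exfalso
        subst h0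
        have h1 := hy.1 ν₀ p
        rw [Int.odd_iff] at ho
        simp at h1
        rw [h1] at ho; norm_num at ho
      · exact h0
    have hyp : y ν₀ p = z ν₀ p - (z ν₀ p).sign := by
      have h1 := hy.1 ν₀ p
      rw [abs_le] at h1
      rcases lt_trichotomy (z ν₀ p) 0 with h | h | h
      · rw [Int.sign_eq_neg_one_of_neg h]
        have := hzp.1; rw [abs_of_neg h] at this
        rcases (abs_eq (by norm_num : (0 : ℤ) ≤ 1)).1 hd with h2 | h2 <;> omega
      · have := hzp.1; rw [h] at this; simp at this; omega
      · rw [Int.sign_eq_one_of_pos h]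
        have := hzp.1; rw [abs_of_pos h] at this
        rcases (abs_eq (by norm_num : (0 : ℤ) ≤ 1)).1 hd with h2 | h2 <;> omega
    have hwp : ((2 : ℤ) • z - e - y) ν₀ p = z ν₀ p := by
      rw [hcase, hzp.2.2, hyp]; ring
    have hwp' : ((2 : ℤ) • z - e - y) ν₀ p' = z ν₀ p' - (z ν₀ p').sign := by
      rw [hcase, hzp'.2.2, hp']; ring
    have hz'ne : z ν₀ p' ≠ 0 := by
      intro h; have := hzp'.1; rw [h] at this; simp at this; omega
    have hsign : |(z ν₀ p').sign| = 1 := by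
      rcases lt_or_gt_of_ne hz'ne with h | h
      · rw [Int.sign_eq_neg_one_of_neg h]; rfl
      · rw [Int.sign_eq_one_of_pos h]; rfl
    obtain ⟨v1, v2, v3⟩ := verify y ((2 : ℤ) • z - e - y) p p' hpp hy hyc ho hzp.2.1 hoff p' p
      hpp.symm (Or.inr ⟨rfl, rfl⟩) (by rw [hwp', sub_sub_cancel]; exact hsign) hzp'.2.1 (by
        intro ν a hna
        by_cases h : (ν, a) = (ν₀, p)
        · obtain ⟨rfl, rfl⟩ := Prod.mk.inj h; exact hwp
        · rw [hcase, hoff ν a h]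
          have : e ν a = 0 := by
            simp only [he]
            rw [if_neg]
            rintro ⟨rfl, h2⟩
            rcases hp with ⟨rfl, rfl⟩ | ⟨rfl, rfl⟩ <;> rcases h2 with rfl | rfl <;> simp at h hna
          rw [this]; ring) (by
        rw [hwp']
        have := hzp'.1
        rcases lt_or_gt_of_ne hz'ne with h | h
        · rw [Int.sign_eq_neg_one_of_neg h]
          rw [abs_of_neg h] at this
          rw [abs_le]; omega
        · rw [Int.sign_eq_one_of_pos h]
          rw [abs_of_pos h] at this
          rw [abs_le]; omega) hzp.1
    refine ⟨v1, v2, v3, fun h => ?_⟩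
    have h1 := congrFun (congrFun h ν₀) p
    rw [hwp] at h1
    rw [← h1] at ho
    exact Int.not_odd_iff_even.2 hzp.2.1 ho
  · -- only one coordinate is extreme
    refine ⟨(2 : ℤ) • z, fun y hy hf hyc => ?_⟩
    obtain ⟨p, p', hp, hd, ho, hp', hoff⟩ := hstruct y hy hf hyc
    have hpp : p ≠ p' := by rcases hp with ⟨rfl, rfl⟩ | ⟨rfl, rfl⟩; exacts [hne, hne.symm]
    have huniq := (exists_even_pair hy).2.1 hyc
    have hzp : Even (z ν₀ p) := by rcases hp with ⟨rfl, rfl⟩ | ⟨rfl, rfl⟩ <;> assumption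
    have hzp' : Even (z ν₀ p') := by rcases hp with ⟨rfl, rfl⟩ | ⟨rfl, rfl⟩ <;> assumption
    have hext : |z ν₀ p'| = 2 * M := by
      obtain ⟨a, ha⟩ := hy.2 ν₀
      have hea : Even (y ν₀ a) := by rw [← even_abs, ha]; exact even_two_mul _
      have := huniq ν₀ a p' hea (by rw [hp']; exact hzp')
      rw [← hp', ← this, ha]
    have hlt : |z ν₀ p| < 2 * M := by
      refine lt_of_le_of_ne (hz.1 ν₀ p) fun h => hboth ?_
      rcases hp with ⟨rfl, rfl⟩ | ⟨rfl, rfl⟩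
      exacts [⟨h, hext⟩, ⟨hext, h⟩]
    have hcase : ∀ ν a, ((2 : ℤ) • z - y) ν a = 2 * z ν a - y ν a := fun _ _ => by simp
    obtain ⟨v1, v2, v3⟩ := verify y ((2 : ℤ) • z - y) p p' hpp hy hyc ho hzp hoff p p' hpp
      (Or.inl ⟨rfl, rfl⟩) (by rw [hcase, ← hd, ← abs_neg]; congr 1; ring) hzp (by
        intro ν a hna
        rw [hcase, hoff ν a hna]; ring) (by
        rw [hcase]
        rw [abs_lt] at hlt
        rw [abs_le]
        rcases (abs_eq (by norm_num : (0 : ℤ) ≤ 1)).1 hd with h2 | h2 <;> omega) hext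
    refine ⟨v1, v2, v3, fun h => ?_⟩
    have h1 := congrFun (congrFun h ν₀) p
    rw [hcase] at h1
    rcases (abs_eq (by norm_num : (0 : ℤ) ≤ 1)).1 hd with h2 | h2 <;> omega

end Cells

section CellComplex

/-- The type of cells. -/
abbrev CellT (B : Type*) (m M : ℕ) := {x : B → Fin (m + 1) → ℤ // IsCell M x}

instance {B : Type*} [Finite B] {m M : ℕ} : Finite (CellT B m M) := by
  refine Finite.of_injective (β := B → Fin (m + 1) → Set.Icc (-(2 * M : ℤ)) (2 * M))
    (fun x ν a => ⟨x.1 ν a, abs_le.1 (x.2.1 ν a)⟩) fun x y h => ?_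
  ext ν a
  exact congrArg Subtype.val (congrFun (congrFun h ν) a)

noncomputable instance {B : Type*} [Finite B] {m M : ℕ} : Fintype (CellT B m M) :=
  Fintype.ofFinite _

open Classical in
/-- Full flags of cells. -/
noncomputable def flags (B : Type*) [Fintype B] (m M : ℕ) : Finset (Finset (CellT B m M)) :=
  Finset.univ.filter fun T => T.card = m * Fintype.card B + 1 ∧
    ∀ x ∈ T, ∀ y ∈ T, Face x.1 y.1 ∨ Face y.1 x.1

variable {B : Type*} [Fintype B] {m M : ℕ}

theorem mem_flags {T : Finset (CellT B m M)} : T ∈ flags B m M ↔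
    T.card = m * Fintype.card B + 1 ∧ ∀ x ∈ T, ∀ y ∈ T, Face x.1 y.1 ∨ Face y.1 x.1 := by
  simp [flags]

theorem card_oddSet_le (x : CellT B m M) : (oddSet x.1).card ≤ m * Fintype.card B := by
  classical exact (exists_even_pair x.2).1

theorem face_of_card_le {T : Finset (CellT B m M)}
    (hT : ∀ x ∈ T, ∀ y ∈ T, Face x.1 y.1 ∨ Face y.1 x.1) {x y : CellT B m M} (hx : x ∈ T)
    (hy : y ∈ T) (h : (oddSet x.1).card ≤ (oddSet y.1).card) : Face x.1 y.1 := by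
  rcases hT x hx y hy with h1 | h1
  · exact h1
  · rw [h1.eq_of_card_le h]; exact Face.refl _

theorem card_oddSet_injOn {T : Finset (CellT B m M)}
    (hT : ∀ x ∈ T, ∀ y ∈ T, Face x.1 y.1 ∨ Face y.1 x.1) :
    Set.InjOn (fun x : CellT B m M => (oddSet x.1).card) (T : Set (CellT B m M)) := by
  intro x hx y hy h
  exact Subtype.ext ((face_of_card_le hT hx hy h.le).eq_of_card_le h.ge)

theorem image_card_oddSet {T : Finset (CellT B m M)} (hT : T ∈ flags B m M) :
    T.image (fun x : CellT B m M => (oddSet x.1).card) =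
      Finset.range (m * Fintype.card B + 1) := by
  obtain ⟨h1, h2⟩ := mem_flags.1 hT
  refine Finset.eq_of_subset_of_card_le (fun k hk => ?_) ?_
  · obtain ⟨x, -, rfl⟩ := Finset.mem_image.1 hk
    exact Finset.mem_range.2 (Nat.lt_succ_of_le (card_oddSet_le x))
  · rw [Finset.card_range, Finset.card_image_of_injOn (card_oddSet_injOn h2), h1]

theorem exists_mem_flag {T : Finset (CellT B m M)} (hT : T ∈ flags B m M) {k : ℕ}
    (hk : k ≤ m * Fintype.card B) : ∃ x ∈ T, (oddSet x.1).card = k := by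
  have : k ∈ T.image (fun x : CellT B m M => (oddSet x.1).card) := by
    rw [image_card_oddSet hT]; exact Finset.mem_range.2 (Nat.lt_succ_of_le hk)
  exact Finset.mem_image.1 this

open Classical in
theorem even_card_flags_above (hN : 0 < m * Fintype.card B) (R : Finset (CellT B m M))
    (hR : R.card = m * Fintype.card B) : Even ((flags B m M).filter (R ⊆ ·)).card := by
  by_cases hch : ∀ x ∈ R, ∀ y ∈ R, Face x.1 y.1 ∨ Face y.1 x.1
  swap
  · have h0 : (flags B m M).filter (R ⊆ ·) = ∅ := by
      rw [Finset.filter_eq_empty_iff]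
      intro T hT hRT
      exact hch fun x hx y hy => (mem_flags.1 hT).2 x (hRT hx) y (hRT hy)
    rw [h0]; simp
  set rk : CellT B m M → ℕ := fun x => (oddSet x.1).card with hrk
  have hinj := card_oddSet_injOn hch
  have hsubr : R.image rk ⊆ Finset.range (m * Fintype.card B + 1) := by
    intro k hk
    obtain ⟨x, -, rfl⟩ := Finset.mem_image.1 hk
    exact Finset.mem_range.2 (Nat.lt_succ_of_le (card_oddSet_le x))
  obtain ⟨l, hl⟩ : ∃ l, Finset.range (m * Fintype.card B + 1) \ R.image rk = {l} := by
    rw [← Finset.card_eq_one, Finset.card_sdiff_of_subset hsubr, Finset.card_range,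
      Finset.card_image_of_injOn hinj, hR]; omega
  have hlm : l ∈ Finset.range (m * Fintype.card B + 1) \ R.image rk := by rw [hl]; simp
  rw [Finset.mem_sdiff, Finset.mem_range] at hlm
  have hex : ∀ k, k ≤ m * Fintype.card B → k ≠ l → ∃ x ∈ R, rk x = k := by
    intro k hk hkl
    by_contra hc
    have : k ∈ Finset.range (m * Fintype.card B + 1) \ R.image rk :=
      Finset.mem_sdiff.2 ⟨Finset.mem_range.2 (by omega), fun h => hc (Finset.mem_image.1 h)⟩
    rw [hl] at this
    exact hkl (Finset.mem_singleton.1 this)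
  have hnl : ∀ x ∈ R, rk x ≠ l := fun x hx h => hlm.2 (Finset.mem_image.2 ⟨x, hx, h⟩)
  set Y : Finset (CellT B m M) := Finset.univ.filter fun y =>
    rk y = l ∧ ∀ x ∈ R, Face x.1 y.1 ∨ Face y.1 x.1 with hY
  have hYmem : ∀ y, y ∈ Y ↔ rk y = l ∧ ∀ x ∈ R, Face x.1 y.1 ∨ Face y.1 x.1 := by
    intro y; simp [hY]
  -- completions correspond to elements of `Y`
  have hbij : Y.card = ((flags B m M).filter (R ⊆ ·)).card := by
    refine Finset.card_bij (fun y _ => insert y R) ?_ ?_ ?_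
    · intro y hy
      obtain ⟨hy1, hy2⟩ := (hYmem y).1 hy
      rw [Finset.mem_filter, mem_flags]
      refine ⟨⟨?_, ?_⟩, Finset.subset_insert _ _⟩
      · rw [Finset.card_insert_of_notMem fun h => hnl y h hy1, hR]
      · intro x hx x' hx'
        rcases Finset.mem_insert.1 hx with rfl | hxR <;>
          rcases Finset.mem_insert.1 hx' with rfl | hxR'
        · exact Or.inl (Face.refl _)
        · exact (hy2 x' hxR').symm
        · exact hy2 x hxR
        · exact hch x hxR x' hxR'
    · intro y hy y' hy' heq
      have h1 : y ∈ insert y' R := heq ▸ Finset.mem_insert_self y R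
      exact (Finset.mem_insert.1 h1).resolve_right fun h => hnl y h ((hYmem y).1 hy).1
    · intro T hT
      rw [Finset.mem_filter] at hT
      obtain ⟨hT, hRT⟩ := hT
      obtain ⟨y, hy, hyl⟩ := exists_mem_flag hT (k := l) (by omega)
      have hyR : y ∉ R := fun h => hnl y h hyl
      refine ⟨y, (hYmem y).2 ⟨hyl, fun x hx => (mem_flags.1 hT).2 x (hRT hx) y hy⟩, ?_⟩
      refine Finset.eq_of_subset_of_card_le (Finset.insert_subset hy hRT) ?_
      rw [Finset.card_insert_of_notMem hyR, hR, (mem_flags.1 hT).1]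
  rw [← hbij]
  -- comparability in terms of the neighbouring ranks
  have below : ∀ y : CellT B m M, rk y = l → (∀ x ∈ R, Face x.1 y.1 ∨ Face y.1 x.1) →
      ∀ x ∈ R, rk x < l → Face x.1 y.1 := by
    intro y hy h x hx hxl
    rcases h x hx with h1 | h1
    · exact h1
    · have := Finset.card_le_card h1.oddSet_subset
      simp only [hrk] at hxl hy; omega
  have above : ∀ y : CellT B m M, rk y = l → (∀ x ∈ R, Face x.1 y.1 ∨ Face y.1 x.1) →
      ∀ x ∈ R, l < rk x → Face y.1 x.1 := by
    intro y hy h x hx hxl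
    rcases h x hx with h1 | h1
    · have := Finset.card_le_card h1.oddSet_subset
      simp only [hrk] at hxl hy; omega
    · exact h1
  have compl : ∀ y : CellT B m M, (∀ z ∈ R, rk z + 1 = l → Face z.1 y.1) →
      (∀ z ∈ R, rk z = l + 1 → Face y.1 z.1) → ∀ x ∈ R, Face x.1 y.1 ∨ Face y.1 x.1 := by
    intro y h1 h2 x hx
    rcases lt_or_gt_of_ne (hnl x hx) with h | h
    · obtain ⟨z, hz, hzl⟩ := hex (l - 1) (by omega) (by omega)
      left
      refine (face_of_card_le hch hx hz ?_).trans (h1 z hz (by omega))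
      change rk x ≤ rk z
      omega
    · have hxle := card_oddSet_le x
      obtain ⟨z, hz, hzl⟩ := hex (l + 1) (by change rk x ≤ _ at hxle; omega) (by omega)
      right
      refine (h2 z hz hzl).trans (face_of_card_le hch hz hx ?_)
      change rk z ≤ rk x
      omega
  suffices hA : ∃ A : B → Fin (m + 1) → ℤ, ∀ y ∈ Y, ∃ h : IsCell M (A - y.1),
      (⟨A - y.1, h⟩ : CellT B m M) ∈ Y ∧ A - y.1 ≠ y.1 by
    obtain ⟨A, hA⟩ := hA
    refine Finset.even_card_of_involution Y (fun y hy => ⟨A - y.1, (hA y hy).choose⟩) ?_ ?_ ?_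
    · intro y hy h
      exact (hA y hy).choose_spec.2 (congrArg Subtype.val h)
    · intro y hy; exact (hA y hy).choose_spec.1
    · intro y hy; exact Subtype.ext (sub_sub_cancel A y.1)
  rcases Nat.eq_zero_or_pos l with hl0 | hl0
  · obtain ⟨z', hz', hz'l⟩ := hex 1 (by omega) (by omega)
    refine ⟨(2 : ℤ) • z'.1, fun y hy => ?_⟩
    obtain ⟨hy1, hy2⟩ := (hYmem y).1 hy
    have hf := above y hy1 hy2 z' hz' (by omega)
    obtain ⟨r1, r2, r3⟩ := reflect_bot z'.2 hf
    refine ⟨r1, (hYmem _).2 ⟨by rw [← hy1]; exact r3, compl _ (fun z hz hzl => by omega) ?_⟩, ?_⟩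
    · intro z hz hzl
      have : z = z' := hinj hz hz' (by change rk z = rk z'; omega)
      rw [this]; exact r2
    · intro h
      have h2 : z'.1 = y.1 := by
        ext ν a
        have := congrFun (congrFun h ν) a
        simp only [Pi.sub_apply, Pi.smul_apply, smul_eq_mul] at this
        omega
      have h3 : z' = y := Subtype.ext h2
      rw [h3] at hz'l; omega
  · obtain ⟨z, hz, hzl⟩ := hex (l - 1) (by omega) (by omega)
    by_cases hlN : l = m * Fintype.card B
    · obtain ⟨A, hA⟩ := exists_reflect_top z.2 (by change rk z + 1 = _; omega)
      refine ⟨A, fun y hy => ?_⟩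
      obtain ⟨hy1, hy2⟩ := (hYmem y).1 hy
      have hf := below y hy1 hy2 z hz (by omega)
      obtain ⟨r1, r2, r3, r4⟩ := hA y.1 y.2 hf (by change rk y = _; omega)
      refine ⟨r1, (hYmem _).2 ⟨by rw [hlN]; exact r3, compl _ ?_ ?_⟩, r4⟩
      · intro z₂ hz₂ hzl₂
        have : z₂ = z := hinj hz₂ hz (by change rk z₂ = rk z; omega)
        rw [this]; exact r2
      · intro z₂ hz₂ hzl₂
        have := card_oddSet_le z₂
        change rk z₂ ≤ _ at this
        omega
    · obtain ⟨z', hz', hz'l⟩ := hex (l + 1) (by omega) (by omega)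
      refine ⟨z.1 + z'.1, fun y hy => ?_⟩
      obtain ⟨hy1, hy2⟩ := (hYmem y).1 hy
      have hf := below y hy1 hy2 z hz (by omega)
      have hf' := above y hy1 hy2 z' hz' (by omega)
      obtain ⟨r1, r2, r3, r4⟩ := reflect_mid z'.2 z.2 hf hf'
      refine ⟨r1, (hYmem _).2 ⟨?_, compl _ ?_ ?_⟩, ?_⟩
      · change (oddSet (z.1 + z'.1 - y.1)).card + rk y = rk z + rk z' at r4
        change (oddSet (z.1 + z'.1 - y.1)).card = l
        omega
      · intro z₂ hz₂ hzl₂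
        have : z₂ = z := hinj hz₂ hz (by change rk z₂ = rk z; omega)
        rw [this]; exact r2
      · intro z₂ hz₂ hzl₂
        have : z₂ = z' := hinj hz₂ hz' (by change rk z₂ = rk z'; omega)
        rw [this]; exact r3
      · intro h
        have h2 : z.1 = y.1 := by
          ext ν a
          have := congrFun (congrFun h ν) a
          simp only [Pi.sub_apply, Pi.add_apply] at this
          rcases hf ν a with h3 | ⟨h3, -⟩
          · exact h3
          · have := hf'.eq_of_odd h3
            omega
        have h3 : z = y := Subtype.ext h2
        rw [h3] at hzl; omega

end CellComplex

section TreeCells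

variable {d m M : ℕ}

theorem IsCell.treeAct {x : Node d → Fin (m + 1) → ℤ} (hx : IsCell M x) (σ : treeGroup d) :
    IsCell M (treeAct σ x) := by
  have h : ∀ ν a, |_root_.treeAct σ x ν a| = |x (nodeMap σ⁻¹ ν) a| := by
    intro ν a
    unfold _root_.treeAct
    cases nodeSign σ⁻¹ ν <;> simp [bflip]
  exact ⟨fun ν a => by rw [h]; exact hx.1 _ a, fun ν => by simpa only [h] using hx.2 _⟩

instance : MulAction (treeGroup d) (CellT (Node d) m M) where
  smul σ x := ⟨treeAct σ x.1, x.2.treeAct σ⟩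
  one_smul x := Subtype.ext <| path_left_injective fun s => by
    change path (treeAct 1 x.1) s = _
    rw [path_treeAct]; simp
  mul_smul σ τ x := Subtype.ext <| path_left_injective fun s => by
    change path (treeAct (σ * τ) x.1) s = path (treeAct σ (treeAct τ x.1)) s
    rw [path_treeAct, path_treeAct, path_treeAct, mul_inv_rev]
    rfl

theorem coe_smul_cell (σ : treeGroup d) (x : CellT (Node d) m M) :
    (σ • x).1 = treeAct σ x.1 := rfl

theorem face_treeAct {x y : Node d → Fin (m + 1) → ℤ} (h : Face x y) (σ : treeGroup d) :
    Face (treeAct σ x) (treeAct σ y) := by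
  intro ν a
  rcases h (nodeMap σ⁻¹ ν) a with h1 | ⟨h1, h2⟩
  · left; simp only [treeAct, bflip_apply, h1]
  · right
    simp only [treeAct, bflip_apply]
    cases nodeSign σ⁻¹ ν
    · simp only [bflip_false]
      refine ⟨h1.neg, ?_⟩
      rw [← h2, ← abs_neg]; congr 1; ring
    · exact ⟨h1, h2⟩

theorem card_oddSet_treeAct (x : Node d → Fin (m + 1) → ℤ) (σ : treeGroup d) :
    (oddSet (treeAct σ x)).card = (oddSet x).card := by
  refine Finset.card_equiv ((nodePerm σ⁻¹).prodCongr (Equiv.refl _)) fun c => ?_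
  rw [mem_oddSet, mem_oddSet]
  simp only [treeAct, bflip_apply, Equiv.prodCongr_apply, Prod.map_fst, Prod.map_snd,
    Equiv.refl_apply, nodePerm, Equiv.coe_fn_mk]
  cases nodeSign σ⁻¹ c.1 <;> simp [bflip]

open Classical in
theorem freeComplex_flags (hN : 0 < m * Fintype.card (Node d)) (hM : 0 < M) :
    FreeComplex (CellT (Node d) m M) (treeGroup d) (flags (Node d) m M)
      (m * Fintype.card (Node d)) := by
  have hfree : ∀ (w : treeGroup d) (x : CellT (Node d) m M), w • x = x → w = 1 := by
    intro w x h
    have hx : ∀ ν, -x.1 ν ≠ x.1 ν := by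
      intro ν hν
      obtain ⟨a, ha⟩ := x.2.2 ν
      have h2 := congrFun hν a
      simp only [Pi.neg_apply] at h2
      have h3 : x.1 ν a = 0 := by omega
      rw [h3] at ha; simp at ha; omega
    have hinv : ∀ s, w⁻¹.1 s = s := by
      intro s
      refine path_right_injective hx ?_
      rw [← path_treeAct, ← coe_smul_cell, h]
    have : w⁻¹ = 1 := Subtype.ext (Equiv.ext hinv)
    exact inv_eq_one.1 this
  refine ⟨hfree, fun w T hT => ?_, fun T hT => (mem_flags.1 hT).1, fun T hT x hx w hw => ?_,
    fun R hR => even_card_flags_above hN R hR⟩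
  · rw [mem_flags] at hT ⊢
    refine ⟨?_, ?_⟩
    · rw [Finset.card_image_of_injective _ (MulAction.injective w), hT.1]
    · intro x hx y hy
      obtain ⟨x, hxT, rfl⟩ := Finset.mem_image.1 hx
      obtain ⟨y, hyT, rfl⟩ := Finset.mem_image.1 hy
      rw [coe_smul_cell, coe_smul_cell]
      exact (hT.2 x hxT y hyT).imp (face_treeAct · w) (face_treeAct · w)
  · refine hfree w x (card_oddSet_injOn (mem_flags.1 hT).2 hw hx ?_)
    exact card_oddSet_treeAct x.1 w

end TreeCells

section LeafRep

variable {d m M : ℕ}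

/-- The permutation representation of the tree group on vector-valued functions on leaves. -/
def leafRep (d m : ℕ) :
    treeGroup d →* ((Leaf d → Fin m → ℝ) →ₗ[ℝ] (Leaf d → Fin m → ℝ)) where
  toFun σ := LinearMap.funLeft ℝ (Fin m → ℝ) (σ⁻¹).1
  map_one' := by ext; simp [LinearMap.funLeft]
  map_mul' σ τ := by
    apply LinearMap.ext
    intro g
    funext s
    simp [LinearMap.funLeft]

theorem leafRep_apply (σ : treeGroup d) (g : Leaf d → Fin m → ℝ) (s : Leaf d) :
    leafRep d m σ g s = g (σ⁻¹.1 s) := rfl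

/-- Functions on leaves with vanishing sum. -/
def leafZeroSum (d m : ℕ) : Submodule ℝ (Leaf d → Fin m → ℝ) :=
  LinearMap.ker (∑ s : Leaf d, LinearMap.proj (R := ℝ) (φ := fun _ : Leaf d => Fin m → ℝ) s)

theorem mem_leafZeroSum {g : Leaf d → Fin m → ℝ} : g ∈ leafZeroSum d m ↔ ∑ s, g s = 0 := by
  simp [leafZeroSum]

theorem finrank_leafZeroSum : Module.finrank ℝ (leafZeroSum d m) = m * Fintype.card (Node d) := by
  set φ := ∑ s : Leaf d, LinearMap.proj (R := ℝ) (φ := fun _ : Leaf d => Fin m → ℝ) s with hφ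
  have hsurj : LinearMap.range φ = ⊤ := by
    rw [LinearMap.range_eq_top]
    intro v
    refine ⟨Pi.single (fun _ => true) v, ?_⟩
    simp [hφ]
  have h := LinearMap.finrank_range_add_finrank_ker φ
  rw [hsurj, finrank_top] at h
  have h2 : Module.finrank ℝ (Leaf d → Fin m → ℝ) = 2 ^ d * m := by
    rw [Module.finrank_pi_fintype]
    simp
  have h3 : Module.finrank ℝ (leafZeroSum d m) = Module.finrank ℝ (LinearMap.ker φ) := rfl
  rw [h2] at h
  rw [h3, card_node, Nat.mul_sub, mul_one, mul_comm m]
  simp only [Module.finrank_fintype_fun_eq_card, Fintype.card_fin] at h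
  omega

theorem leafRep_mem (σ : treeGroup d) {g : Leaf d → Fin m → ℝ} (hg : g ∈ leafZeroSum d m) :
    leafRep d m σ g ∈ leafZeroSum d m := by
  rw [mem_leafZeroSum] at hg ⊢
  rw [← hg]
  exact Equiv.sum_comp (σ⁻¹).1 g

/-- The leaf values of `f` along a cell, normalized to have vanishing sum. -/
noncomputable def leafMap (f : (Fin d → Fin (m + 1) → ℤ) → Fin m → ℝ) (x : CellT (Node d) m M)
    (s : Leaf d) : Fin m → ℝ :=
  f (path x.1 s) - ((2 : ℝ) ^ d)⁻¹ • ∑ t, f (path x.1 t)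

theorem leafMap_mem (f : (Fin d → Fin (m + 1) → ℤ) → Fin m → ℝ) (x : CellT (Node d) m M) :
    leafMap f x ∈ leafZeroSum d m := by
  rw [mem_leafZeroSum]
  simp only [leafMap, Finset.sum_sub_distrib, Finset.sum_const, Finset.card_univ]
  rw [sub_eq_zero, ← Nat.cast_smul_eq_nsmul ℝ, smul_smul]
  simp

theorem leafMap_smul (f : (Fin d → Fin (m + 1) → ℤ) → Fin m → ℝ) (σ : treeGroup d)
    (x : CellT (Node d) m M) : leafMap f (σ • x) = leafRep d m σ (leafMap f x) := by
  funext s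
  rw [leafRep_apply]
  simp only [leafMap, coe_smul_cell, path_treeAct]
  congr 2
  exact Equiv.sum_comp (σ⁻¹).1 fun t => f (path x.1 t)

theorem zeroComb_leafMap_iff {f : (Fin d → Fin (m + 1) → ℤ) → Fin m → ℝ}
    {T : Finset (CellT (Node d) m M)} :
    ZeroComb (leafMap f) T ↔ ∃ c : CellT (Node d) m M → ℝ, (∀ x ∈ T, 0 ≤ c x) ∧ ∑ x ∈ T, c x = 1 ∧
      ∀ s t : Leaf d, ∑ x ∈ T, c x • f (path x.1 s) = ∑ x ∈ T, c x • f (path x.1 t) := by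
  refine exists_congr fun c => and_congr_right fun _ => and_congr_right fun _ => ?_
  have key : ∀ s, (∑ x ∈ T, c x • leafMap f x) s = ∑ x ∈ T, c x • f (path x.1 s) -
      ((2 : ℝ) ^ d)⁻¹ • ∑ t, ∑ x ∈ T, c x • f (path x.1 t) := by
    intro s
    rw [Finset.sum_apply, Finset.sum_comm (s := Finset.univ)]
    simp only [Pi.smul_apply, leafMap, smul_sub, Finset.sum_sub_distrib]
    congr 1
    rw [Finset.smul_sum]
    refine Finset.sum_congr rfl fun x _ => ?_
    rw [← Finset.smul_sum, smul_comm]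
  constructor
  · intro h s t
    have h1 := key s
    have h2 := key t
    rw [h] at h1 h2
    simp only [Pi.zero_apply] at h1 h2
    rw [sub_eq_zero.1 h1.symm, sub_eq_zero.1 h2.symm]
  · intro h
    funext s
    rw [key, Finset.sum_congr rfl fun t _ => h t s, Finset.sum_const, Finset.card_univ,
      ← Nat.cast_smul_eq_nsmul ℝ, smul_smul]
    simp

end LeafRep

section Model

variable {d m M : ℕ}

/-- The contribution of one level to the model map. -/
noncomputable def modelTerm (M : ℕ) (η : Node d × Fin m → ℝ) (v : Fin d → Fin (m + 1) → ℤ)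
    (j : Fin d) (i : Fin m) : ℝ :=
  v j i.succ - η (⟨j, fun l => decide (0 < v l 0)⟩, i) * (v j 0 / (2 * M))

/-- A map whose zeros form a single orbit. -/
noncomputable def modelMap (M : ℕ) (η : Node d × Fin m → ℝ) (v : Fin d → Fin (m + 1) → ℤ)
    (i : Fin m) : ℝ := ∑ j, modelTerm M η v j i

theorem path_eq_of_above {A : Type*} [Neg A] {x : Node d → A} {s t : Leaf d} {i : Fin d}
    (h : ∀ l, i < l → s l = t l) {l : Fin d} (hl : i < l) : path x s l = path x t l := by
  rw [path, path, h l hl, nodeOf_eq_iff.2 fun k hk => h k (hl.trans hk)]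

theorem path_update_not {A : Type*} [InvolutiveNeg A] {x : Node d → A} {s : Leaf d} {i : Fin d} :
    path x (Function.update s i (!s i)) i = -path x s i := by
  have : nodeOf (Function.update s i (!s i)) i = nodeOf s i :=
    nodeOf_eq_iff.2 fun l hl => by rw [Function.update_of_ne hl.ne']
  rw [path, path, this, Function.update_self]
  cases s i <;> simp [bflip]

theorem modelTerm_congr {η : Node d × Fin m → ℝ} {v w : Fin d → Fin (m + 1) → ℤ} {j : Fin d}
    (h : ∀ l, j < l → v l = w l) (hj : v j = w j) (i : Fin m) :
    modelTerm M η v j i = modelTerm M η w j i := by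
  unfold modelTerm
  rw [hj]
  have : (fun l : {l : Fin d // j < l} => decide (0 < v l 0)) =
      fun l : {l : Fin d // j < l} => decide (0 < w l 0) := by
    ext l; rw [h l l.2]
  rw [this]

theorem modelTerm_neg {η : Node d × Fin m → ℝ} {v w : Fin d → Fin (m + 1) → ℤ} {j : Fin d}
    (h : ∀ l, j < l → v l = w l) (hj : v j = -w j) (i : Fin m) :
    modelTerm M η v j i = -modelTerm M η w j i := by
  unfold modelTerm
  rw [hj]
  have : (fun l : {l : Fin d // j < l} => decide (0 < v l 0)) =
      fun l : {l : Fin d // j < l} => decide (0 < w l 0) := by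
    ext l; rw [h l l.2]
  rw [this]
  simp only [Pi.neg_apply, Int.cast_neg]
  ring

theorem sum_modelTerm_eq_zero {η : Node d × Fin m → ℝ} {T : Finset (CellT (Node d) m M)}
    {c : CellT (Node d) m M → ℝ}
    (h : ∀ s t : Leaf d, ∑ x ∈ T, c x • modelMap M η (path x.1 s) =
      ∑ x ∈ T, c x • modelMap M η (path x.1 t)) (j : Fin d) :
    ∀ (s : Leaf d) (i : Fin m), ∑ x ∈ T, c x * modelTerm M η (path x.1 s) j i = 0 := by
  induction j using WellFoundedLT.induction with
  | ind j ih =>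
  intro s i
  set s' := Function.update s j (!s j) with hs'
  have hexp : ∀ s : Leaf d, (∑ x ∈ T, c x • modelMap M η (path x.1 s)) i =
      ∑ l, ∑ x ∈ T, c x * modelTerm M η (path x.1 s) l i := by
    intro s
    rw [Finset.sum_apply, Finset.sum_comm]
    simp only [Pi.smul_apply, smul_eq_mul, modelMap, Finset.mul_sum]
  have h1 := congrFun (h s s') i
  rw [hexp, hexp, ← sub_eq_zero, ← Finset.sum_sub_distrib] at h1
  have hab : ∀ l, j < l → s' l = s l := fun l hl => by rw [hs', Function.update_of_ne hl.ne']
  rw [Finset.sum_eq_single j] at h1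
  · have h2 : ∑ x ∈ T, c x * modelTerm M η (path x.1 s') j i =
        -∑ x ∈ T, c x * modelTerm M η (path x.1 s) j i := by
      rw [← Finset.sum_neg_distrib]
      refine Finset.sum_congr rfl fun x _ => ?_
      rw [modelTerm_neg (fun l hl => path_eq_of_above hab hl) path_update_not, mul_neg]
    rw [h2] at h1
    linarith
  · intro l _ hl
    rcases lt_or_gt_of_ne hl with hl | hl
    · rw [ih l hl, ih l hl, sub_zero]
    · rw [sub_eq_zero]
      refine Finset.sum_congr rfl fun x _ => ?_
      rw [modelTerm_congr (fun k hk => path_eq_of_above hab (hl.trans hk))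
        (path_eq_of_above hab hl)]
  · simp

/-- Strictly decreasing weights in `(0,1)` along an enumeration. -/
noncomputable def weightOf {N : ℕ} (o : Node d × Fin m ≃ Fin N) (c : Node d × Fin m) : ℝ :=
  ((N : ℝ) - (o c : ℕ)) / (N + 1)

theorem weightOf_pos {N : ℕ} (o : Node d × Fin m ≃ Fin N) (c : Node d × Fin m) :
    0 < weightOf o c := by
  have : ((o c : ℕ) : ℝ) < N := by exact_mod_cast (o c).2
  exact div_pos (by linarith) (by positivity)

theorem weightOf_le {N : ℕ} (o : Node d × Fin m ≃ Fin N) (c : Node d × Fin m) :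
    weightOf o c ≤ N / (N + 1) := by
  have : (0 : ℝ) ≤ (o c : ℕ) := by positivity
  unfold weightOf
  gcongr
  linarith

theorem weightOf_lt_one {N : ℕ} (o : Node d × Fin m ≃ Fin N) (c : Node d × Fin m) :
    weightOf o c < 1 := by
  refine (weightOf_le o c).trans_lt ?_
  rw [div_lt_one (by positivity)]
  linarith

theorem weightOf_lt {N : ℕ} (o : Node d × Fin m ≃ Fin N) {c c' : Node d × Fin m}
    (h : o c' < o c) : weightOf o c < weightOf o c' := by
  have : ((o c' : ℕ) : ℝ) < (o c : ℕ) := by exact_mod_cast h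
  unfold weightOf
  gcongr

theorem mem_iff_lt_card_of_lower {N : ℕ} {S : Finset (Fin N)} (h : ∀ k ∈ S, ∀ l < k, l ∈ S)
    (k : Fin N) : k ∈ S ↔ (k : ℕ) < S.card := by
  constructor
  · intro hk
    have : Finset.Iic k ⊆ S := fun l hl => by
      rcases (Finset.mem_Iic.1 hl).eq_or_lt with rfl | h'
      · exact hk
      · exact h k hk l h'
    have := Finset.card_le_card this
    rw [Fin.card_Iic] at this
    omega
  · intro hk
    by_contra hc
    have : S ⊆ Finset.Iio k := fun l hl => by
      rw [Finset.mem_Iio]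
      by_contra hlk
      rcases (not_lt.1 hlk).eq_or_lt with rfl | h'
      · exact hc hl
      · exact hc (h l hl k h')
    have := Finset.card_le_card this
    rw [Fin.card_Iio] at this
    omega

/-- The vertices of the flag on which the model map vanishes. -/
def plusFun {N : ℕ} (M : ℕ) (o : Node d × Fin m ≃ Fin N) (τ : ℕ) (ν : Node d) :
    Fin (m + 1) → ℤ :=
  Fin.cons (2 * M) fun i => if (o (ν, i) : ℕ) < τ then 1 else 0

theorem isCell_plusFun {N : ℕ} (hM : 0 < M) (o : Node d × Fin m ≃ Fin N) (τ : ℕ) :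
    IsCell M (plusFun M o τ) := by
  refine ⟨fun ν a => ?_, fun ν => ⟨0, ?_⟩⟩
  · refine Fin.cases ?_ (fun i => ?_) a
    · simp [plusFun]
    · simp only [plusFun, Fin.cons_succ]
      split_ifs <;> simp
      omega
  · simp [plusFun]

/-- The vertices of the flag on which the model map vanishes, as cells. -/
def plusCell {N : ℕ} (hM : 0 < M) (o : Node d × Fin m ≃ Fin N) (τ : ℕ) : CellT (Node d) m M :=
  ⟨plusFun M o τ, isCell_plusFun hM o τ⟩

theorem plusFun_face {N : ℕ} (o : Node d × Fin m ≃ Fin N) {τ τ' : ℕ} (h : τ ≤ τ') :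
    Face (plusFun M o τ) (plusFun M o τ') := by
  intro ν a
  refine Fin.cases ?_ (fun i => ?_) a
  · simp [plusFun]
  · simp only [plusFun, Fin.cons_succ]
    split_ifs <;> simp
    omega

theorem plusCell_injOn {N : ℕ} (hM : 0 < M) (o : Node d × Fin m ≃ Fin N) :
    Set.InjOn (plusCell hM o) (Finset.range (N + 1) : Finset ℕ) := by
  have key : ∀ τ τ' : ℕ, τ < τ' → τ' ≤ N → plusCell hM o τ ≠ plusCell hM o τ' := by
    intro τ τ' h h' heq
    have h1 := congrFun (congrFun (congrArg Subtype.val heq) (o.symm ⟨τ, by omega⟩).1)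
      (o.symm ⟨τ, by omega⟩).2.succ
    simp [plusCell, plusFun, h] at h1
  intro τ hτ τ' hτ' heq
  simp only [Finset.coe_range, Set.mem_Iio] at hτ hτ'
  rcases lt_trichotomy τ τ' with h | h | h
  · exact absurd heq (key _ _ h (by omega))
  · exact h
  · exact absurd heq.symm (key _ _ h (by omega))

open Classical in
/-- The flag on which the model map vanishes. -/
noncomputable def plusFlag {N : ℕ} (hM : 0 < M) (o : Node d × Fin m ≃ Fin N) :
    Finset (CellT (Node d) m M) := (Finset.range (N + 1)).image (plusCell hM o)

theorem card_plusFlag {N : ℕ} (hM : 0 < M) (o : Node d × Fin m ≃ Fin N) :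
    (plusFlag hM o).card = N + 1 := by
  classical
  rw [plusFlag, Finset.card_image_of_injOn (plusCell_injOn hM o), Finset.card_range]

variable {N : ℕ}

theorem plusFlag_mem (hN : N = m * Fintype.card (Node d)) (hM : 0 < M)
    (o : Node d × Fin m ≃ Fin N) : plusFlag hM o ∈ flags (Node d) m M := by
  classical
  rw [mem_flags, card_plusFlag]
  refine ⟨by rw [hN], ?_⟩
  intro x hx y hy
  obtain ⟨τ, -, rfl⟩ := Finset.mem_image.1 hx
  obtain ⟨τ', -, rfl⟩ := Finset.mem_image.1 hy
  exact (le_total τ τ').imp (plusFun_face o) (plusFun_face o)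

theorem sum_range_ite_lt (k N : ℕ) (hk : k < N) :
    ∑ τ ∈ Finset.range (N + 1), (if k < τ then (1 : ℝ) else 0) = N - k := by
  rw [Finset.sum_ite, Finset.sum_const_zero, add_zero, Finset.sum_const, nsmul_eq_mul, mul_one]
  have : (Finset.range (N + 1)).filter (k < ·) = Finset.Ioc k N := by
    ext; simp; omega
  rw [this, Nat.card_Ioc, Nat.cast_sub hk.le]

theorem zeroComb_plusFlag (hM : 0 < M) (o : Node d × Fin m ≃ Fin N) :
    ZeroComb (leafMap (modelMap M (weightOf o))) (plusFlag hM o) := by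
  classical
  rw [zeroComb_leafMap_iff]
  have hN1 : (0 : ℝ) < N + 1 := by positivity
  refine ⟨fun _ => ((N : ℝ) + 1)⁻¹, fun _ _ => (inv_pos.2 hN1).le, ?_, ?_⟩
  · rw [Finset.sum_const, card_plusFlag, nsmul_eq_mul]
    push_cast
    exact mul_inv_cancel₀ hN1.ne'
  have key : ∀ s : Leaf d, ∑ x ∈ plusFlag hM o, ((N : ℝ) + 1)⁻¹ •
      modelMap M (weightOf o) (path x.1 s) = 0 := by
    intro s
    rw [← Finset.smul_sum]
    suffices h : ∑ x ∈ plusFlag hM o, modelMap M (weightOf o) (path x.1 s) = 0 by rw [h, smul_zero]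
    rw [plusFlag, Finset.sum_image (plusCell_injOn hM o)]
    funext i
    rw [Finset.sum_apply, Pi.zero_apply]
    simp only [modelMap]
    rw [Finset.sum_comm]
    refine Finset.sum_eq_zero fun j _ => ?_
    have hterm : ∀ τ, modelTerm M (weightOf o) (path (plusCell hM o τ).1 s) j i =
        bflip (s j) ((if (o (nodeOf s j, i) : ℕ) < τ then (1 : ℝ) else 0) -
          weightOf o (nodeOf s j, i)) := by
      intro τ
      have hM' : (M : ℝ) ≠ 0 := by exact_mod_cast hM.ne'
      have hnode : (⟨j, fun l => decide (0 < path (plusCell hM o τ).1 s l 0)⟩ : Node d) =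
          nodeOf s j := by
        unfold nodeOf
        congr 1
        ext l
        rw [path, bflip_apply]
        cases s l <;> simp [bflip, plusCell, plusFun, hM]
      unfold modelTerm
      rw [hnode, path, bflip_apply, bflip_apply]
      cases s j <;> simp [bflip, plusCell, plusFun, hM']
      ring
    simp only [hterm]
    have hlin : ∀ (b : Bool) (g : ℕ → ℝ), ∑ τ ∈ Finset.range (N + 1), bflip b (g τ) =
        bflip b (∑ τ ∈ Finset.range (N + 1), g τ) := by
      intro b g; cases b <;> simp [bflip]
    rw [hlin, Finset.sum_sub_distrib, sum_range_ite_lt _ _ (o _).2, Finset.sum_const,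
      Finset.card_range, nsmul_eq_mul]
    have : ((N : ℝ) - (o (nodeOf s j, i) : ℕ)) -
        ((N + 1 : ℕ) : ℝ) * weightOf o (nodeOf s j, i) = 0 := by
      unfold weightOf
      push_cast
      field_simp
      ring
    rw [this]
    cases s j <;> simp [bflip]
  intro s t
  rw [key, key]

end Model

section ModelZeros

variable {d m M N : ℕ}

theorem eq_plusFlag_of_zero (hN : N = m * Fintype.card (Node d)) (hM : 0 < M)
    (o : Node d × Fin m ≃ Fin N) {T : Finset (CellT (Node d) m M)} (hT : T ∈ flags (Node d) m M)
    (hpos : ∀ x ∈ T, ∀ ν, x.1 ν 0 = 2 * M) {c : CellT (Node d) m M → ℝ} (hc0 : ∀ x ∈ T, 0 ≤ c x)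
    (hc1 : ∑ x ∈ T, c x = 1)
    (hsum : ∀ ν i, ∑ x ∈ T, c x * x.1 ν i.succ = weightOf o (ν, i)) 
    {y : CellT (Node d) m M} (hy : y ∈ T) (hyc : (oddSet y.1).card = m * Fintype.card (Node d))
    (hyo : ∀ ν (i : Fin m), Odd (y.1 ν i.succ)) :
    T = plusFlag hM o := by
  classical
  obtain ⟨hTc, hch⟩ := mem_flags.1 hT
  -- comparison principle for averages
  have havg : ∀ (g g' : CellT (Node d) m M → ℝ), (∀ x ∈ T, g x ≤ g' x) →
      ∑ x ∈ T, c x * g x ≤ ∑ x ∈ T, c x * g' x := fun g g' h =>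
    Finset.sum_le_sum fun x hx => mul_le_mul_of_nonneg_left (h x hx) (hc0 x hx)
  have hconst : ∀ r : ℝ, ∑ x ∈ T, c x * r = r := fun r => by
    rw [← Finset.sum_mul, hc1, one_mul]
  have hle_top : ∀ x ∈ T, Face x.1 y.1 := fun x hx =>
    face_of_card_le hch hx hy (by rw [hyc]; exact card_oddSet_le x)
  obtain ⟨z, hz, hzc⟩ := exists_mem_flag hT (k := 0) (Nat.zero_le _)
  have hge_bot : ∀ x ∈ T, Face z.1 x.1 := fun x hx =>
    face_of_card_le hch hz hx (by rw [hzc]; exact Nat.zero_le _)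
  have hzeven : ∀ ν a, Even (z.1 ν a) := fun ν a => by
    rw [← Int.not_odd_iff_even]
    intro h
    have : (ν, a) ∈ oddSet z.1 := mem_oddSet.2 h
    rw [Finset.card_eq_zero.1 hzc] at this
    simp at this
  have hdist : ∀ {u v : Node d → Fin (m + 1) → ℤ}, Face u v → ∀ ν a, |u ν a - v ν a| ≤ 1 := by
    intro u v h ν a
    rcases h ν a with h | h
    · rw [h]; simp
    · exact h.2.le
  have hbase : ∀ ν (i : Fin m), y.1 ν i.succ = 1 ∧ z.1 ν i.succ = 0 := by
    intro ν i
    have hp := weightOf_pos o (ν, i)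
    have hl := weightOf_lt_one o (ν, i)
    rw [← hsum ν i] at hp hl
    have hlow : ∀ k : ℤ, (∀ x ∈ T, k ≤ x.1 ν i.succ) → k < 1 := by
      intro k hk
      have := havg (fun _ => (k : ℝ)) (fun x => (x.1 ν i.succ : ℝ)) fun x hx => by
        exact_mod_cast hk x hx
      rw [hconst] at this
      exact_mod_cast this.trans_lt hl
    have hup : ∀ k : ℤ, (∀ x ∈ T, x.1 ν i.succ ≤ k) → 0 < k := by
      intro k hk
      have := havg (fun x => (x.1 ν i.succ : ℝ)) (fun _ => (k : ℝ)) fun x hx => by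
        exact_mod_cast hk x hx
      rw [hconst] at this
      exact_mod_cast hp.trans_le this
    have h1 := hlow (y.1 ν i.succ - 1) fun x hx => by
      have := abs_le.1 (hdist (hle_top x hx) ν i.succ); omega
    have h2 := hup (y.1 ν i.succ + 1) fun x hx => by
      have := abs_le.1 (hdist (hle_top x hx) ν i.succ); omega
    have h3 := hyo ν i
    rw [Int.odd_iff] at h3
    have hy1 : y.1 ν i.succ = 1 := by omega
    have h4 := hlow (z.1 ν i.succ - 1) fun x hx => by
      have := abs_le.1 (hdist (hge_bot x hx) ν i.succ); omega
    have h5 := abs_le.1 (hdist (hge_bot y hy) ν i.succ)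
    have h6 := hzeven ν i.succ
    rw [Int.even_iff] at h6
    refine ⟨hy1, ?_⟩
    by_contra hne
    have hz2 : z.1 ν i.succ = 2 := by omega
    have h7 := hlow 1 fun x hx => by
      have := abs_le.1 (hdist (hge_bot x hx) ν i.succ); omega
    omega
  have hval : ∀ x ∈ T, ∀ ν (i : Fin m), x.1 ν i.succ = 0 ∨ x.1 ν i.succ = 1 := by
    intro x hx ν i
    obtain ⟨h1, h2⟩ := hbase ν i
    have h3 := abs_le.1 (hdist (hge_bot x hx) ν i.succ)
    have h4 := abs_le.1 (hdist (hle_top x hx) ν i.succ)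
    have h5 : Even (x.1 ν i.succ) → x.1 ν i.succ = 0 := fun h => by
      rw [← h2]; exact ((hge_bot x hx).eq_of_even h).symm
    rcases Int.even_or_odd (x.1 ν i.succ) with h | h
    · exact Or.inl (h5 h)
    · right; rw [← h1]; exact (hle_top x hx).eq_of_odd h
  have hsub : T ⊆ plusFlag hM o := by
    intro x hx
    set S : Finset (Fin N) := Finset.univ.filter fun k =>
      x.1 (o.symm k).1 (o.symm k).2.succ = 1 with hS
    have hlow : ∀ k ∈ S, ∀ l < k, l ∈ S := by
      intro k hk l hl
      have hk1 : x.1 (o.symm k).1 (o.symm k).2.succ = 1 := by simpa [hS] using hk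
      by_contra hcon
      have hl1 : x.1 (o.symm l).1 (o.symm l).2.succ = 0 :=
        (hval x hx _ _).resolve_right (by simpa [hS] using hcon)
      have hw : weightOf o (o.symm k) < weightOf o (o.symm l) :=
        weightOf_lt o (by simpa using hl)
      have hcmp : weightOf o (o.symm l) ≤ weightOf o (o.symm k) := by
        have e1 := hsum (o.symm l).1 (o.symm l).2
        have e2 := hsum (o.symm k).1 (o.symm k).2
        rw [Prod.mk.eta] at e1 e2
        rw [← e1, ← e2]
        refine havg _ _ fun x' hx' => ?_
        rcases hval x' hx' (o.symm l).1 (o.symm l).2 with h0 | h0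
        · rw [h0]
          rcases hval x' hx' (o.symm k).1 (o.symm k).2 with h1 | h1 <;> simp [h1]
        · rcases hch x hx x' hx' with hf | hf
          · have := hf.eq_of_odd (ν := (o.symm k).1) (a := (o.symm k).2.succ) (by rw [hk1]; simp)
            rw [← this, h0, hk1]
          · have := hf.eq_of_odd (ν := (o.symm l).1) (a := (o.symm l).2.succ) (by rw [h0]; simp)
            rw [hl1, h0] at this
            exact absurd this (by norm_num)
      exact absurd hw (not_lt.2 hcmp)
    refine Finset.mem_image.2 ⟨S.card, ?_, ?_⟩
    · rw [Finset.mem_range, Nat.lt_succ_iff]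
      exact (Finset.card_le_univ S).trans (by simp)
    · apply Subtype.ext
      funext ν a
      refine Fin.cases ?_ (fun i => ?_) a
      · rw [hpos x hx]; simp [plusCell, plusFun]
      · have h1 := mem_iff_lt_card_of_lower hlow (o (ν, i))
        have h2 : o (ν, i) ∈ S ↔ x.1 ν i.succ = 1 := by simp [hS]
        rw [h2] at h1
        simp only [plusCell, plusFun, Fin.cons_succ, ← h1]
        rcases hval x hx ν i with h | h <;> simp [h]
  refine Finset.eq_of_subset_of_card_le hsub ?_
  rw [card_plusFlag, hTc, hN]

open Classical in
theorem exists_image_eq_plusFlag (hN : N = m * Fintype.card (Node d)) (hM : 0 < M)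
    (o : Node d × Fin m ≃ Fin N) {T : Finset (CellT (Node d) m M)} (hT : T ∈ flags (Node d) m M)
    (hz : ZeroComb (leafMap (modelMap M (weightOf o))) T) (hN0 : 0 < N) :
    ∃ w : treeGroup d, T.image (w • ·) = plusFlag hM o := by
  have hMR : (0 : ℝ) < M := by exact_mod_cast hM
  have hK := freeComplex_flags (d := d) (m := m) (M := M) (hN ▸ hN0) hM
  -- at a zero, the first coordinates are extremal
  have hfirst : ∀ T ∈ flags (Node d) m M, ZeroComb (leafMap (modelMap M (weightOf o))) T →
      ∃ y ∈ T, (oddSet y.1).card = m * Fintype.card (Node d) ∧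
      (∀ ν (i : Fin m), Odd (y.1 ν i.succ)) ∧ (∀ ν, |y.1 ν 0| = 2 * M) ∧
      ∀ x ∈ T, ∀ ν, x.1 ν 0 = y.1 ν 0 := by
    intro T hT hz
    obtain ⟨c, hc0, hc1, hc⟩ := zeroComb_leafMap_iff.1 hz
    have hzero := sum_modelTerm_eq_zero hc
    obtain ⟨y, hy, hyc⟩ := exists_mem_flag hT (k := m * Fintype.card (Node d)) le_rfl
    obtain ⟨-, hch⟩ := mem_flags.1 hT
    have hle_top : ∀ x ∈ T, Face x.1 y.1 := fun x hx =>
      face_of_card_le hch hx hy (by rw [hyc]; exact card_oddSet_le x)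
    have hsmall : ∀ ν (i : Fin m), |∑ x ∈ T, c x * x.1 ν i.succ| < 1 := by
      intro ν i
      have h1 := hzero ν.1 (leafOf ν) i
      simp only [modelTerm, path_leafOf, mul_sub, Finset.sum_sub_distrib] at h1
      rw [sub_eq_zero.1 h1]
      refine (Finset.abs_sum_le_sum_abs _ _).trans_lt ?_
      have h2 : ∀ x ∈ T, |c x * (weightOf o ((⟨ν.1, fun l => decide (0 < path x.1 (leafOf ν) l 0)⟩ :
          Node d), i) * (x.1 ν 0 / (2 * M)))| ≤ c x * (N / (N + 1)) := by
        intro x hx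
        rw [abs_mul, abs_of_nonneg (hc0 x hx)]
        refine mul_le_mul_of_nonneg_left ?_ (hc0 x hx)
        rw [abs_mul, abs_of_pos (weightOf_pos _ _)]
        have h3 : |(x.1 ν 0 : ℝ) / (2 * M)| ≤ 1 := by
          rw [abs_div, abs_of_pos (by positivity : (0 : ℝ) < 2 * M), div_le_one (by positivity)]
          exact_mod_cast x.2.1 ν 0
        calc _ ≤ weightOf o _ * 1 := mul_le_mul_of_nonneg_left h3 (weightOf_pos _ _).le
          _ ≤ _ := by rw [mul_one]; exact weightOf_le _ _
      refine (Finset.sum_le_sum h2).trans_lt ?_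
      rw [← Finset.sum_mul, hc1, one_mul, div_lt_one (by positivity)]
      linarith
    have hy0 : ∀ ν, |y.1 ν 0| = 2 * M := by
      intro ν
      obtain ⟨a, ha⟩ := y.2.2 ν
      revert ha
      refine Fin.cases id (fun i ha => ?_) a
      have hev : Even (y.1 ν i.succ) := by rw [← even_abs, ha]; exact even_two_mul _
      have hT2 : ∑ x ∈ T, c x * (x.1 ν i.succ : ℝ) = y.1 ν i.succ := by
        rw [Finset.sum_congr rfl fun x hx => by rw [(hle_top x hx).eq_of_even hev],
          ← Finset.sum_mul, hc1, one_mul]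
      have h2 := hsmall ν i
      rw [hT2] at h2
      have h3 : |y.1 ν i.succ| < 1 := by exact_mod_cast h2
      omega
    have hev0 : ∀ ν, Even (y.1 ν 0) := fun ν => by
      rw [← even_abs, hy0]; exact even_two_mul _
    refine ⟨y, hy, hyc, fun ν i => ?_, hy0, fun x hx ν => (hle_top x hx).eq_of_even (hev0 ν)⟩
    rw [← Int.not_even_iff_odd]
    intro h
    exact absurd ((exists_even_pair y.2).2.1 hyc ν _ _ (hev0 ν) h) (Fin.succ_ne_zero i).symm
  obtain ⟨y, hy, -, -, hy0, hxy⟩ := hfirst T hT hz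
  obtain ⟨σ, hσ⟩ := exists_treeGroup_sign fun ν => decide (0 < y.1 ν 0)
  refine ⟨σ, ?_⟩
  set T' := T.image (σ • ·) with hT'
  have hTm : T' ∈ flags (Node d) m M := hK.inv σ T hT
  have hz' : ZeroComb (leafMap (modelMap M (weightOf o))) T' :=
    (ZeroComb.image_smul_iff (leafRep d m) (fun w x => leafMap_smul _ w x) σ).2 hz
  have hpos : ∀ x ∈ T', ∀ ν, x.1 ν 0 = 2 * M := by
    intro x' hx' ν
    obtain ⟨x, hx, rfl⟩ := Finset.mem_image.1 hx'
    obtain ⟨ν, rfl⟩ := (nodePerm σ).surjective ν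
    change (σ • x).1 (nodeMap σ ν) 0 = _
    rw [coe_smul_cell, treeAct_nodeMap, hσ, bflip_apply, hxy x hx]
    have h1 := hy0 ν
    by_cases h : 0 < y.1 ν 0
    · rw [abs_of_pos h] at h1
      rw [decide_eq_true h, bflip_true, h1]
    · rw [abs_of_nonpos (not_lt.1 h)] at h1
      rw [decide_eq_false h, bflip_false, h1]
  obtain ⟨y', hy', hyc', hyo', -, -⟩ := hfirst T' hTm hz'
  obtain ⟨c, hc0, hc1, hc⟩ := zeroComb_leafMap_iff.1 hz'
  have hzero := sum_modelTerm_eq_zero hc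
  refine eq_plusFlag_of_zero hN hM o hTm hpos hc0 hc1 (fun ν i => ?_) hy' hyc' hyo'
  have h1 := hzero ν.1 (leafOf ν) i
  have h2 : ∀ x ∈ T', c x * modelTerm M (weightOf o) (path x.1 (leafOf ν)) ν.1 i =
      c x * x.1 ν i.succ - c x * weightOf o (ν, i) := by
    intro x hx
    have hnode : (⟨ν.1, fun l => decide (0 < path x.1 (leafOf ν) l 0)⟩ : Node d) = ν := by
      conv_rhs => rw [← nodeOf_leafOf ν]
      unfold nodeOf
      congr 1
      ext l
      rw [path, bflip_apply, hpos x hx]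
      cases leafOf ν l <;> simp [bflip, hM]
    rw [modelTerm, path_leafOf, hpos x hx, hnode]
    push_cast
    rw [div_self (by positivity), mul_one, mul_sub]
  rw [Finset.sum_congr rfl h2, Finset.sum_sub_distrib, ← Finset.sum_mul, hc1, one_mul,
    sub_eq_zero] at h1
  exact h1

open Classical in
theorem exists_eq_image_plusFlag (hN : N = m * Fintype.card (Node d)) (hM : 0 < M)
    (o : Node d × Fin m ≃ Fin N) {T : Finset (CellT (Node d) m M)} (hT : T ∈ flags (Node d) m M)
    (hz : ZeroComb (leafMap (modelMap M (weightOf o))) T) (hN0 : 0 < N) :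
    ∃ w : treeGroup d, T = (plusFlag hM o).image (w • ·) := by
  obtain ⟨w, hw⟩ := exists_image_eq_plusFlag hN hM o hT hz hN0
  exact ⟨w⁻¹, by rw [← hw, image_inv_smul_image]⟩

open Classical in
theorem image_plusFlag_inj (hN : N = m * Fintype.card (Node d)) (hM : 0 < M)
    (o : Node d × Fin m ≃ Fin N) (hN0 : 0 < N) {w w' : treeGroup d} {r : CellT (Node d) m M}
    (h : r ∈ (plusFlag hM o).image (w • ·)) (h' : r ∈ (plusFlag hM o).image (w' • ·)) :
    w = w' := by
  have hK := freeComplex_flags (d := d) (m := m) (M := M) (hN ▸ hN0) hM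
  obtain ⟨p, hp, rfl⟩ := Finset.mem_image.1 h
  obtain ⟨p', hp', he⟩ := Finset.mem_image.1 h'
  have h1 : (w'⁻¹ * w) • p = p' := by rw [mul_smul, ← he, inv_smul_smul]
  have h2 := hK.orbit _ (plusFlag_mem hN hM o) p hp (w'⁻¹ * w) (h1 ▸ hp')
  exact (inv_mul_eq_one.1 h2).symm

open Classical in
theorem card_zeroComb_model (hN : N = m * Fintype.card (Node d)) (hM : 0 < M)
    (o : Node d × Fin m ≃ Fin N) (hN0 : 0 < N) :
    ((flags (Node d) m M).filter (ZeroComb (leafMap (modelMap M (weightOf o))))).card =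
      Fintype.card (treeGroup d) := by
  have hK := freeComplex_flags (d := d) (m := m) (M := M) (hN ▸ hN0) hM
  rw [← Finset.card_univ]
  symm
  refine Finset.card_bij (fun w _ => (plusFlag hM o).image (w • ·)) ?_ ?_ ?_
  · intro w _
    rw [Finset.mem_filter]
    exact ⟨hK.inv w _ (plusFlag_mem hN hM o),
      (ZeroComb.image_smul_iff (leafRep d m) (fun w x => leafMap_smul _ w x) w).2
        (zeroComb_plusFlag hM o)⟩
  · intro w _ w' _ h
    obtain ⟨p, hp⟩ : (plusFlag hM o).Nonempty := by
      rw [← Finset.card_pos, card_plusFlag]; omega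
    have hmem : w • p ∈ (plusFlag hM o).image (w • ·) := Finset.mem_image_of_mem _ hp
    exact image_plusFlag_inj hN hM o hN0 hmem (h ▸ hmem)
  · intro T hT
    obtain ⟨hT, hz⟩ := Finset.mem_filter.1 hT
    obtain ⟨w, hw⟩ := exists_eq_image_plusFlag hN hM o hT hz hN0
    exact ⟨w, Finset.mem_univ _, hw.symm⟩

open Classical in
theorem model_admissible (hN : N = m * Fintype.card (Node d)) (hM : 0 < M)
    (o : Node d × Fin m ≃ Fin N) (hN0 : 0 < N) {T : Finset (CellT (Node d) m M)}
    (hT : T ∈ flags (Node d) m M) {u : CellT (Node d) m M} (hu : u ∈ T) :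
    ¬ ZeroComb (leafMap (modelMap M (weightOf o))) (T.erase u) := by
  intro hz
  have hK := freeComplex_flags (d := d) (m := m) (M := M) (hN ▸ hN0) hM
  have hRc : (T.erase u).card = m * Fintype.card (Node d) := by
    rw [Finset.card_erase_of_mem hu, (mem_flags.1 hT).1]; rfl
  have heven := hK.thin _ hRc
  have hTmem : T ∈ (flags (Node d) m M).filter (T.erase u ⊆ ·) :=
    Finset.mem_filter.2 ⟨hT, Finset.erase_subset _ _⟩
  obtain ⟨T', hT', hne⟩ : ∃ T' ∈ (flags (Node d) m M).filter (T.erase u ⊆ ·), T' ≠ T := by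
    by_contra! hc
    rw [Finset.eq_singleton_iff_unique_mem.2 ⟨hTmem, hc⟩] at heven
    simp at heven
  obtain ⟨hT'm, hT's⟩ := Finset.mem_filter.1 hT'
  obtain ⟨w, hw⟩ := exists_eq_image_plusFlag hN hM o hT (hz.mono (Finset.erase_subset _ _)) hN0
  obtain ⟨w', hw'⟩ := exists_eq_image_plusFlag hN hM o hT'm (hz.mono hT's) hN0
  obtain ⟨r, hr⟩ : (T.erase u).Nonempty := by rw [← Finset.card_pos, hRc, ← hN]; exact hN0
  have := image_plusFlag_inj hN hM o hN0 (hw ▸ Finset.mem_of_mem_erase hr) (hw' ▸ hT's hr)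
  exact hne (by rw [hw, hw', this])

end ModelZeros

section TreeBorsukUlam

/-- A Borsuk-Ulam type theorem for binary trees of antipodal choices: a continuous map to `ℝ^m`
has nearly equal values at all leaves, for a suitable labelling of the nodes by points of the
sphere of dimension `m`. -/
theorem exists_leaf_values_close {d m : ℕ} (g : (Fin d → Fin (m + 1) → ℝ) → Fin m → ℝ)
    (hg : Continuous g) {δ : ℝ} (hδ : 0 < δ) :
    ∃ e : Node d → Fin (m + 1) → ℝ, (∀ ν, ‖e ν‖ = 1) ∧
      ∀ s t i, |g (path e s) i - g (path e t) i| < δ := by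
  classical
  rcases Nat.eq_zero_or_pos (m * Fintype.card (Node d)) with hN0 | hN0
  · refine ⟨fun _ _ => 1, fun ν => by simp [pi_norm_const], fun s t i => ?_⟩
    rcases mul_eq_zero.1 hN0 with rfl | h
    · exact i.elim0
    · rw [card_node] at h
      have hd : d = 0 := by
        by_contra hd
        have := Nat.one_lt_two_pow hd
        omega
      subst hd
      rw [Subsingleton.elim s t]
      simpa using hδ
  set N := m * Fintype.card (Node d) with hN
  have huc :=
    (isCompact_closedBall (0 : Fin d → Fin (m + 1) → ℝ) 1).uniformContinuousOn_of_continuous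
    hg.continuousOn
  rw [Metric.uniformContinuousOn_iff] at huc
  obtain ⟨r, hr, huc⟩ := huc (δ / 3) (by positivity)
  obtain ⟨M, hM⟩ := exists_nat_gt (1 / r)
  have hMR : (0 : ℝ) < M := (by positivity : (0 : ℝ) < 1 / r).trans hM
  have hM0 : 0 < M := by exact_mod_cast hMR
  set sc : (Fin d → Fin (m + 1) → ℤ) → Fin d → Fin (m + 1) → ℝ :=
    fun v j a => (v j a : ℝ) / (2 * M) with hsc
  set f₁ : (Fin d → Fin (m + 1) → ℤ) → Fin m → ℝ := fun v => g (sc v) with hf₁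
  have hball : ∀ (x : CellT (Node d) m M) s, sc (path x.1 s) ∈ Metric.closedBall 0 1 := by
    intro x s
    rw [mem_closedBall_zero_iff]
    refine (pi_norm_le_iff_of_nonneg zero_le_one).2 fun j =>
      (pi_norm_le_iff_of_nonneg zero_le_one).2 fun a => ?_
    rw [Real.norm_eq_abs]
    simp only [hsc]
    rw [abs_div, abs_of_pos (by positivity : (0 : ℝ) < 2 * M), div_le_one (by positivity), path,
      bflip_apply]
    have : |bflip (s j) (x.1 (nodeOf s j) a)| ≤ 2 * M := by
      have := x.2.1 (nodeOf s j) a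
      cases s j <;> simpa [bflip] using this
    exact_mod_cast this
  have hK := freeComplex_flags (d := d) (m := m) (M := M) hN0 hM0
  obtain ⟨T, hT, hz⟩ : ∃ T ∈ flags (Node d) m M, ZeroComb (leafMap f₁) T := by
    by_contra! hno
    have hcard : Fintype.card (Node d × Fin m) = N := by
      rw [Fintype.card_prod, Fintype.card_fin, hN, mul_comm]
    have hmod := card_zeroComb_modEq (ρ := leafRep d m) (V := leafZeroSum d m) (N := N)
      (F₀ := leafMap (modelMap M (weightOf (Fintype.equivFinOfCardEq hcard)))) (F₁ := leafMap f₁)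
      finrank_leafZeroSum (fun w v hv => leafRep_mem w hv) hK
      (fun w x => leafMap_smul _ w x) (fun w x => leafMap_smul _ w x) (leafMap_mem _)
      (leafMap_mem _) (fun T hT u hu => model_admissible hN hM0 _ hN0 hT hu)
      (fun T hT u _ hz => hno T hT (hz.mono (Finset.erase_subset _ _)))
    rw [card_zeroComb_model hN hM0 _ hN0, Finset.filter_false_of_mem hno, Finset.card_empty] at hmod
    have hW : 0 < Fintype.card (treeGroup d) := Fintype.card_pos
    have := (Nat.modEq_zero_iff_dvd.1 hmod)
    have := Nat.le_of_dvd hW this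
    omega
  obtain ⟨c, hc0, hc1, hc⟩ := zeroComb_leafMap_iff.1 hz
  obtain ⟨y, hy, hyc⟩ := exists_mem_flag hT (k := m * Fintype.card (Node d)) le_rfl
  obtain ⟨-, hch⟩ := mem_flags.1 hT
  have hface : ∀ x ∈ T, Face x.1 y.1 := fun x hx =>
    face_of_card_le hch hx hy (by rw [hyc]; exact card_oddSet_le x)
  have hdist : ∀ x ∈ T, ∀ s, dist (sc (path x.1 s)) (sc (path y.1 s)) < r := by
    intro x hx s
    have h1 : 1 / (2 * M) < r := by
      rw [div_lt_iff₀ (by positivity)]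
      rw [div_lt_iff₀ hr] at hM
      nlinarith
    refine lt_of_le_of_lt ?_ h1
    have h0 : (0 : ℝ) ≤ 1 / (2 * M) := by positivity
    refine (dist_pi_le_iff h0).2 fun j => (dist_pi_le_iff h0).2 fun a => ?_
    rw [Real.dist_eq]
    simp only [hsc]
    rw [← sub_div, abs_div, abs_of_pos (by positivity : (0 : ℝ) < 2 * M)]
    refine div_le_div_of_nonneg_right ?_ (by positivity)
    rw [path, path, bflip_apply, bflip_apply]
    have h2 : |x.1 (nodeOf s j) a - y.1 (nodeOf s j) a| ≤ 1 := by
      rcases hface x hx (nodeOf s j) a with h | h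
      · rw [h]; simp
      · exact h.2.le
    have h3 : |bflip (s j) (x.1 (nodeOf s j) a) - bflip (s j) (y.1 (nodeOf s j) a)| ≤ 1 := by
      cases s j
      · rw [bflip_false, bflip_false, neg_sub_neg, abs_sub_comm]; exact h2
      · exact h2
    exact_mod_cast h3
  have hclose : ∀ s i, |(∑ x ∈ T, c x • f₁ (path x.1 s)) i - g (sc (path y.1 s)) i| ≤ δ / 3 := by
    intro s i
    have h1 : (∑ x ∈ T, c x • f₁ (path x.1 s)) i - g (sc (path y.1 s)) i =
        ∑ x ∈ T, c x * (g (sc (path x.1 s)) i - g (sc (path y.1 s)) i) := by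
      simp only [mul_sub, Finset.sum_sub_distrib, ← Finset.sum_mul, hc1, one_mul, Finset.sum_apply,
        Pi.smul_apply, smul_eq_mul, hf₁]
    rw [h1]
    refine (Finset.abs_sum_le_sum_abs _ _).trans ?_
    rw [show δ / 3 = ∑ x ∈ T, c x * (δ / 3) by rw [← Finset.sum_mul, hc1, one_mul]]
    refine Finset.sum_le_sum fun x hx => ?_
    rw [abs_mul, abs_of_nonneg (hc0 x hx)]
    refine mul_le_mul_of_nonneg_left ?_ (hc0 x hx)
    have := huc _ (hball x s) _ (hball y s) (hdist x hx s)
    exact (dist_le_pi_dist _ _ i).trans this.le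
  refine ⟨fun ν a => (y.1 ν a : ℝ) / (2 * M), fun ν => ?_, fun s t i => ?_⟩
  · refine le_antisymm ((pi_norm_le_iff_of_nonneg zero_le_one).2 fun a => ?_) ?_
    · rw [Real.norm_eq_abs, abs_div, abs_of_pos (by positivity : (0 : ℝ) < 2 * M),
        div_le_one (by positivity)]
      exact_mod_cast y.2.1 ν a
    · obtain ⟨a, ha⟩ := y.2.2 ν
      refine le_trans ?_ (norm_le_pi_norm _ a)
      rw [Real.norm_eq_abs, abs_div, abs_of_pos (by positivity : (0 : ℝ) < 2 * M),
        one_le_div (by positivity)]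
      exact_mod_cast ha.ge
  · have hpath : ∀ s, path (fun ν a => (y.1 ν a : ℝ) / (2 * M)) s = sc (path y.1 s) := by
      intro s
      funext j a
      simp only [hsc, path, bflip_apply]
      cases s j
      · simp only [bflip_false]; push_cast; ring
      · rfl
    rw [hpath, hpath]
    have h1 := abs_le.1 (hclose s i)
    have h2 := abs_le.1 (hclose t i)
    rw [hc s t] at h1
    rw [abs_lt]
    constructor <;> linarith

end TreeBorsukUlam

section LinearForms

/-- Finitely many linear forms on `ℝ^(m+1)` of which at most `m` are small at any point of the
unit sphere. -/
theorem exists_forms_few_small (R : Type*) [Fintype R] (m : ℕ) :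
    ∃ Θ : R → (Fin (m + 1) → ℝ) →ₗ[ℝ] ℝ, ∀ v, ‖v‖ = 1 →
      (Finset.univ.filter fun κ => |Θ κ v| < 1).card ≤ m := by
  classical
  let t : R → ℝ := fun κ => (Fintype.equivFin R κ : ℕ)
  have ht : Function.Injective t := fun κ κ' h => by
    have h1 : ((Fintype.equivFin R κ : ℕ) : ℝ) = (Fintype.equivFin R κ' : ℕ) := h
    exact (Fintype.equivFin R).injective (Fin.ext (by exact_mod_cast h1))
  let Ψ : R → (Fin (m + 1) → ℝ) →ₗ[ℝ] ℝ := fun κ =>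
    ∑ a : Fin (m + 1), (t κ ^ (a : ℕ)) • LinearMap.proj a
  have hΨ : ∀ κ v, Ψ κ v = ∑ a : Fin (m + 1), t κ ^ (a : ℕ) * v a := fun κ v => by
    simp [Ψ]
  have hbound : ∀ S : Finset R, ∃ C : ℝ, 0 < C ∧ (S.card = m + 1 → ∀ v, ‖v‖ = 1 →
      ∃ κ ∈ S, 1 ≤ C * |Ψ κ v|) := by
    intro S
    by_cases hS : S.card = m + 1
    swap
    · exact ⟨1, one_pos, fun h => absurd h hS⟩
    let e := (S.equivFinOfCardEq hS).symm
    let Φ : (Fin (m + 1) → ℝ) →ₗ[ℝ] (Fin (m + 1) → ℝ) := LinearMap.pi fun j => Ψ (e j)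
    have hker : LinearMap.ker Φ = ⊥ := by
      rw [LinearMap.ker_eq_bot']
      intro v hv
      refine Matrix.eq_zero_of_forall_index_sum_pow_mul_eq_zero (f := fun j => t (e j))
        (ht.comp (Subtype.val_injective.comp e.injective)) fun j => ?_
      rw [← hΨ]
      exact congrFun hv j
    obtain ⟨C, hC, hanti⟩ := Φ.exists_antilipschitzWith hker
    refine ⟨C, hC, fun _ v hv => ?_⟩
    by_contra! hc
    have h1 : ‖v‖ ≤ C * ‖Φ v‖ := by
      have := hanti.le_mul_dist v 0
      simpa [dist_eq_norm] using this
    have hC' : (0 : ℝ) < C := hC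
    have h2 : ‖Φ v‖ < (C : ℝ)⁻¹ := by
      rw [pi_norm_lt_iff (inv_pos.2 hC')]
      intro j
      have h4 : C * |Ψ (e j) v| < 1 := hc (e j) (e j).2
      rw [← one_div, lt_div_iff₀ hC', mul_comm]
      exact h4
    have h3 : C * ‖Φ v‖ < 1 := by
      calc (C : ℝ) * ‖Φ v‖ < C * (C : ℝ)⁻¹ := mul_lt_mul_of_pos_left h2 hC'
        _ = 1 := mul_inv_cancel₀ hC'.ne'
    linarith
  choose C hC0 hC using hbound
  have hle : ∀ S, C S ≤ ∑ S, C S := fun S =>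
    Finset.single_le_sum (f := C) (fun S _ => (hC0 S).le) (Finset.mem_univ S)
  refine ⟨fun κ => (∑ S, C S) • Ψ κ, fun v hv => ?_⟩
  by_contra! hc
  obtain ⟨S, hS, hSc⟩ := Finset.exists_subset_card_eq (Nat.succ_le_of_lt hc)
  obtain ⟨κ, hκ, h1⟩ := hC S hSc v hv
  have h2 := (Finset.mem_filter.1 (hS hκ)).2
  rw [LinearMap.smul_apply, smul_eq_mul, abs_mul,
    abs_of_nonneg ((hC0 S).le.trans (hle S))] at h2
  have h3 := mul_le_mul_of_nonneg_right (hle S) (abs_nonneg (Ψ κ v))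
  linarith

open Classical in
/-- The number of sign patterns of finitely many linear forms. -/
theorem card_sign_patterns_le (R : Type*) [Fintype R] (m : ℕ)
    (Θ : R → (Fin (m + 1) → ℝ) →ₗ[ℝ] ℝ) :
    (Finset.univ.filter fun S : Finset R => ∃ v, S = Finset.univ.filter fun κ => Θ κ v < 0).card ≤
      ∑ l ∈ Finset.range (m + 2), (Fintype.card R).choose l := by
  set 𝒩 := Finset.univ.filter fun S : Finset R => ∃ v, S = Finset.univ.filter fun κ => Θ κ v < 0
    with h𝒩
  have hvc : 𝒩.vcDim ≤ m + 1 := by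
    refine Finset.sup_le fun s hs => ?_
    rw [Finset.mem_shatterer] at hs
    by_contra! hc
    have hrank : Module.finrank ℝ (⊤ : Submodule ℝ ((Fin (m + 1) → ℝ) →ₗ[ℝ] ℝ)) = m + 1 := by
      rw [finrank_top]
      exact Subspace.dual_finrank_eq.trans (by simp)
    obtain ⟨u, hu, hsum⟩ := exists_dependency hrank hc (b := Θ) fun _ _ => Submodule.mem_top
    have key : ∀ u : R → ℝ, (∃ x ∈ s, 0 < u x) → ∑ x ∈ s, u x • Θ x = 0 → False := by
      rintro u ⟨x, hx, hux⟩ hsum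
      obtain ⟨N, hN, hsN⟩ := hs (Finset.filter_subset (fun x => 0 < u x) s)
      obtain ⟨v, rfl⟩ := (Finset.mem_filter.1 hN).2
      have hmem : ∀ y ∈ s, (Θ y v < 0 ↔ 0 < u y) := by
        intro y hy
        have := Finset.ext_iff.1 hsN y
        simpa [hy] using this
      have h0 : ∑ y ∈ s, u y * Θ y v = 0 := by
        have := LinearMap.congr_fun hsum v
        simpa using this
      have hneg : ∑ y ∈ s, u y * Θ y v < 0 := by
        refine Finset.sum_neg' (fun y hy => ?_)
          ⟨x, hx, mul_neg_of_pos_of_neg hux ((hmem x hx).2 hux)⟩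
        by_cases h : 0 < u y
        · exact (mul_neg_of_pos_of_neg h ((hmem y hy).2 h)).le
        · have h' : ¬ Θ y v < 0 := fun h' => h ((hmem y hy).1 h')
          exact mul_nonpos_of_nonpos_of_nonneg (not_lt.1 h) (not_lt.1 h')
      linarith
    obtain ⟨x, hx, hux⟩ := hu
    rcases lt_or_gt_of_ne hux with h | h
    · refine key (-u) ⟨x, hx, by simpa using h⟩ ?_
      rw [← neg_zero, ← hsum, ← Finset.sum_neg_distrib]
      refine Finset.sum_congr rfl fun y _ => ?_
      ext w
      simp
    · exact key u ⟨x, hx, h⟩ hsum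
  refine (Finset.card_le_card_shatterer 𝒩).trans (Finset.card_shatterer_le_sum_vcDim.trans ?_)
  refine Finset.sum_le_sum_of_subset fun l hl => ?_
  rw [Finset.mem_Iic] at hl
  rw [Finset.mem_range]
  omega

open Classical in
theorem card_filter_card_le (R : Type*) [Fintype R] (n : ℕ) :
    (Finset.univ.filter fun S : Finset R => S.card ≤ n).card =
      ∑ l ∈ Finset.range (n + 1), (Fintype.card R).choose l := by
  rw [Finset.card_eq_sum_card_fiberwise (f := Finset.card) (t := Finset.range (n + 1))]
  · refine Finset.sum_congr rfl fun l hl => ?_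
    rw [Finset.mem_range] at hl
    rw [← Finset.card_univ, ← Finset.card_powersetCard]
    congr 1
    ext S
    simp only [Finset.mem_filter, Finset.mem_univ, true_and, Finset.mem_powersetCard,
      Finset.subset_univ]
    omega
  · intro S hS
    simp only [Finset.coe_filter, Finset.mem_univ, true_and, Set.mem_ofPred_eq] at hS
    simp only [Finset.coe_range, Set.mem_Iio]
    omega

theorem sum_choose_mul_le (n q : ℕ) (hq : 0 < q) :
    ∑ l ∈ Finset.range (n + 1), (n * q).choose l ≤ q ^ n * 4 ^ n := by
  have hq' : (0 : ℝ) < q := by exact_mod_cast hq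
  have h1 : (∑ l ∈ Finset.range (n + 1), ((n * q).choose l : ℝ)) * (1 / q) ^ n ≤
      (1 / q + 1) ^ (n * q) := by
    rw [add_pow]
    simp only [one_pow, mul_one]
    rw [Finset.sum_mul]
    refine le_trans (Finset.sum_le_sum fun l hl => ?_) (Finset.sum_le_sum_of_subset_of_nonneg
      (Finset.range_subset_range.2 (Nat.succ_le_succ (Nat.le_mul_of_pos_right n hq)))
      fun l _ _ => by positivity)
    rw [mul_comm]
    refine mul_le_mul_of_nonneg_right ?_ (by positivity)
    refine pow_le_pow_of_le_one (by positivity) ?_ (by rw [Finset.mem_range] at hl; omega)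
    rw [div_le_one hq']
    exact_mod_cast hq
  have h2 : ((1 : ℝ) / q + 1) ^ (n * q) ≤ 4 ^ n := by
    calc ((1 : ℝ) / q + 1) ^ (n * q) ≤ (Real.exp (1 / q)) ^ (n * q) := by
          gcongr
          exact Real.add_one_le_exp _
      _ = (Real.exp 1) ^ n := by
          rw [← Real.exp_nat_mul, ← Real.exp_nat_mul]
          congr 1
          push_cast
          field_simp
      _ ≤ 4 ^ n := by
          gcongr
          linarith [Real.exp_one_lt_d9]
  have h3 : (∑ l ∈ Finset.range (n + 1), ((n * q).choose l : ℝ)) ≤ q ^ n * 4 ^ n := by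
    have h4 := h1.trans h2
    rw [one_div, inv_pow, ← div_eq_mul_inv, div_le_iff₀ (by positivity)] at h4
    linarith
  exact_mod_cast h3

end LinearForms

section Relabel

/-- A coordinate together with the bits of a leaf below a level. -/
abbrev Key (K : Type*) {d : ℕ} (i : Fin d) := K × ({l : Fin d // l < i} → Bool)

variable {K : Type*} {d : ℕ}

/-- The key of a leaf at a level. -/
def keyOf (k : K) (s : Leaf d) (i : Fin d) : Key K i := (k, fun l => s l)

theorem exists_leaf_of_rec (h : ∀ i : Fin d, ({l : Fin d // l < i} → Bool) → Bool) :
    ∃ t : Leaf d, ∀ i, t i = h i fun l => t l :=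
  ⟨IsWellFounded.fix (· < ·) fun i ih => h i fun l => ih l l.2, fun i =>
    IsWellFounded.fix_eq (· < ·) (fun (i : Fin d) ih => h i fun l => ih l l.2) i⟩

open Classical in
/-- The leaf obtained from `s` by flipping, from the lowest level on, the bits prescribed by `q`. -/
noncomputable def relabel (q : ∀ ν : Node d, Finset (Key K ν.1)) (k : K) (s : Leaf d) : Leaf d :=
  (exists_leaf_of_rec fun i h => xor (s i) (decide (((k, h) : Key K i) ∈ q (nodeOf s i)))).choose

open Classical in
theorem relabel_apply (q : ∀ ν : Node d, Finset (Key K ν.1)) (k : K) (s : Leaf d) (i : Fin d) :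
    relabel q k s i = xor (s i) (decide (keyOf k (relabel q k s) i ∈ q (nodeOf s i))) :=
  (exists_leaf_of_rec fun i h =>
    xor (s i) (decide (((k, h) : Key K i) ∈ q (nodeOf s i)))).choose_spec i

theorem eq_of_relabel_agree (q : ∀ ν : Node d, Finset (Key K ν.1)) (k : K) {s t : Leaf d}
    (h : ∀ i, s i ≠ t i → ∀ l ≤ i, relabel q k s l = relabel q k t l) : s = t := by
  classical
  by_contra hne
  obtain ⟨i₀, hi₀⟩ := Function.ne_iff.1 hne
  obtain ⟨i, hi, hmax⟩ := (Finset.univ.filter fun i => s i ≠ t i).exists_max_image id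
    ⟨i₀, by simpa using hi₀⟩
  have hi' : s i ≠ t i := by simpa using hi
  have hnd : (fun l : {l // i < l} => s l) = fun l : {l // i < l} => t l := by
    ext ⟨l, hl⟩
    have : s l = t l := by
      by_contra hc
      exact absurd (hmax l (by simpa using hc)) (not_le.2 hl)
    simp [this]
  have hkey : keyOf k (relabel q k s) i = keyOf k (relabel q k t) i := by
    unfold keyOf
    congr 1
    ext ⟨l, hl⟩
    rw [h i hi' l hl.le]
  have h1 := h i hi' i le_rfl
  rw [relabel_apply, relabel_apply, hkey] at h1
  unfold nodeOf at h1
  rw [hnd] at h1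
  exact hi' (by simpa using h1)

theorem relabel_injective (q : ∀ ν : Node d, Finset (Key K ν.1)) (k : K) :
    Function.Injective (relabel q k) := fun _ _ h =>
  eq_of_relabel_agree q k fun _ _ l _ => congrFun h l

open Classical in
/-- The pairs of a coordinate and a leaf at which some relevant form of the family is small. -/
noncomputable def badPairs [Fintype K] (q r : ∀ ν : Node d, Finset (Key K ν.1)) :
    Finset (K × Leaf d) :=
  Finset.univ.filter fun z => ∃ i, relabel q z.1 z.2 i = true ∧
    keyOf z.1 (relabel q z.1 z.2) i ∈ r (nodeOf z.2 i)

theorem sigma_key_eq {i j : Fin d} {f : {l : Fin d // i < l} → Bool}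
    {g : {l : Fin d // j < l} → Bool} {x : Key K i} {y : Key K j}
    (h : (⟨⟨i, f⟩, x⟩ : Σ ν : Node d, Key K ν.1) = ⟨⟨j, g⟩, y⟩) : i = j ∧ HEq f g ∧ HEq x y := by
  cases h
  exact ⟨rfl, HEq.rfl, HEq.rfl⟩

theorem card_badPairs_le [Fintype K] (q r : ∀ ν : Node d, Finset (Key K ν.1)) :
    (badPairs q r).card ≤ ∑ ν, (r ν).card := by
  classical
  rw [← Finset.card_sigma]
  refine Finset.card_le_card_of_forall_subsingleton
    (fun z x => ∃ i, relabel q z.1 z.2 i = true ∧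
      x = ⟨nodeOf z.2 i, keyOf z.1 (relabel q z.1 z.2) i⟩) (fun z hz => ?_) ?_
  · obtain ⟨i, hi, hi'⟩ := (Finset.mem_filter.1 hz).2
    exact ⟨_, Finset.mem_sigma.2 ⟨Finset.mem_univ _, hi'⟩, i, hi, rfl⟩
  · rintro x - ⟨k, s⟩ ⟨-, i, hi, hx⟩ ⟨k', t⟩ ⟨-, j, hj, rfl⟩
    obtain ⟨rfl, hf, hx⟩ := sigma_key_eq hx
    obtain ⟨rfl, hx⟩ := Prod.mk.inj (eq_of_heq hx)
    have hf := eq_of_heq hf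
    dsimp only at hi hj hx hf
    rw [eq_of_relabel_agree q k' (s := s) (t := t)]
    intro l hl l' hl'
    rcases lt_or_ge j l with h | h
    · exact absurd (congrFun hf ⟨l, h⟩).symm hl
    rcases (hl'.trans h).lt_or_eq with h' | rfl
    · exact (congrFun hx ⟨l', h'⟩).symm
    · rw [hi, hj]

end Relabel

section Interpolation

/-- The truncation of a real number to the unit interval, or its complement. -/
noncomputable def bweight (b : Bool) (w : ℝ) : ℝ :=
  if b then max 0 (min 1 w) else 1 - max 0 (min 1 w)

theorem continuous_bweight (b : Bool) : Continuous (bweight b) := by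
  unfold bweight
  cases b <;> simp <;> fun_prop

theorem sum_mul_prod_bweight {d : ℕ} (c : Leaf d → ℝ)
    (w : ∀ i : Fin d, ({l : Fin d // l < i} → Bool) → ℝ) (μ : Leaf d)
    (h1 : ∀ i, μ i = true → 1 ≤ w i fun l => μ l)
    (h0 : ∀ i, μ i = false → (w i fun l => μ l) ≤ 0) :
    ∑ t, c t * ∏ i, bweight (t i) (w i fun l => t l) = c μ := by
  classical
  have hμ : ∀ i, bweight (μ i) (w i fun l => μ l) = 1 ∧ bweight (!μ i) (w i fun l => μ l) = 0 := by
    intro i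
    cases h : μ i
    · have := h0 i h
      simp [bweight, min_eq_right (this.trans zero_le_one), max_eq_left this]
    · have := h1 i h
      simp [bweight, min_eq_left this]
  rw [Finset.sum_eq_single μ]
  · rw [Finset.prod_eq_one fun i _ => (hμ i).1, mul_one]
  · intro t _ hne
    obtain ⟨i₀, hi₀⟩ := Function.ne_iff.1 hne
    obtain ⟨i, hi, hmin⟩ := (Finset.univ.filter fun i => t i ≠ μ i).exists_min_image id
      ⟨i₀, by simpa using hi₀⟩
    have hi' : t i ≠ μ i := by simpa using hi
    rw [Finset.prod_eq_zero (Finset.mem_univ i), mul_zero]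
    have h2 : (fun l : {l : Fin d // l < i} => t l) = fun l : {l : Fin d // l < i} => μ l := by
      ext ⟨l, hl⟩
      have : t l = μ l := by
        by_contra hc
        exact absurd (hmin l (by simpa using hc)) (not_le.2 hl)
      simp [this]
    rw [h2, Bool.eq_not.2 hi']
    exact (hμ i).2
  · simp

end Interpolation

section Counting

open Classical in
/-- Few tables are constant on the classes of a given partition away from a small set. -/
theorem card_tables_le {K S : Type*} [Fintype K] [Fintype S] {V L : ℕ} (hL : 0 < L)
    (σ : K → S → S) (hσ : ∀ k, Function.Injective (σ k)) (bad : Finset (K × S)) (φ : S → Fin V) :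
    (Finset.univ.filter fun ξ : K → S → Fin L => ∀ k s t, (k, s) ∉ bad → (k, t) ∉ bad →
      φ s = φ t → ξ k (σ k s) = ξ k (σ k t)).card ≤ L ^ (Fintype.card K * V + bad.card) := by
  have hcard : Fintype.card ((K × Fin V → Fin L) × (bad → Fin L)) =
      L ^ (Fintype.card K * V + bad.card) := by
    simp [pow_add]
  rw [← hcard, ← Finset.card_univ]
  refine Finset.card_le_card_of_injOn (fun ξ => (fun z =>
    if h : ∃ s, (z.1, s) ∉ bad ∧ φ s = z.2 then ξ z.1 (σ z.1 h.choose) else ⟨0, hL⟩,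
    fun z => ξ z.1.1 (σ z.1.1 z.1.2))) (fun _ _ => Finset.mem_coe.2 (Finset.mem_univ _)) ?_
  intro ξ hξ η hη h
  have hξ' := (Finset.mem_filter.1 (Finset.mem_coe.1 hξ)).2
  have hη' := (Finset.mem_filter.1 (Finset.mem_coe.1 hη)).2
  obtain ⟨h1, h2⟩ := Prod.mk.injEq _ _ _ _ ▸ h
  ext k t : 2
  obtain ⟨s, rfl⟩ := (Finite.injective_iff_surjective.1 (hσ k)) t
  by_cases hs : (k, s) ∈ bad
  · exact congrFun h2 ⟨(k, s), hs⟩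
  · have hex : ∃ s', (k, s') ∉ bad ∧ φ s' = φ s := ⟨s, hs, rfl⟩
    have h3 := congrFun h1 (k, φ s)
    simp only [dif_pos hex] at h3
    rw [← hξ' k _ s hex.choose_spec.1 hs hex.choose_spec.2, h3,
      hη' k _ s hex.choose_spec.1 hs hex.choose_spec.2]

theorem sum_node_level_le (d : ℕ) : ∑ ν : Node d, (ν.1 : ℕ) ≤ 2 ^ d := by
  have h1 : ∑ ν : Node d, (ν.1 : ℕ) = ∑ i : Fin d, (i : ℕ) * 2 ^ (d - 1 - i) := by
    rw [Fintype.sum_sigma]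
    refine Finset.sum_congr rfl fun i _ => ?_
    simp only [Finset.sum_const, Finset.card_univ, Fintype.card_pi, Fintype.card_bool,
      Finset.prod_const, smul_eq_mul]
    rw [mul_comm]
    congr 2
    rw [Fintype.card_subtype]
    have : (Finset.univ.filter fun l => i < l) = Finset.Ioi i := by ext; simp
    rw [this, Fin.card_Ioi]
  rw [h1, Fin.sum_univ_eq_sum_range (fun i => i * 2 ^ (d - 1 - i))]
  have h2 : ∀ d : ℕ, ∑ i ∈ Finset.range d, i * 2 ^ (d - 1 - i) + d + 1 = 2 ^ d := by
    intro d
    induction d with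
    | zero => simp
    | succ d ih =>
      rw [Finset.sum_range_succ, pow_succ, ← ih]
      have : ∑ i ∈ Finset.range d, i * 2 ^ (d + 1 - 1 - i) =
          2 * ∑ i ∈ Finset.range d, i * 2 ^ (d - 1 - i) := by
        rw [Finset.mul_sum]
        refine Finset.sum_congr rfl fun i hi => ?_
        rw [Finset.mem_range] at hi
        rw [show d + 1 - 1 - i = (d - 1 - i) + 1 by omega, pow_succ]
        ring
      rw [this]
      simp
      ring
  have := h2 d
  omega

end Counting

section Waist

open Classical in
/-- A table of values that cannot be constant, up to few exceptions, on the classes of any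
partition into few classes. -/
theorem exists_table {K S Q : Type*} [Fintype K] [Fintype S] {V L bd : ℕ} (hL : 0 < L)
    (𝒬 : Finset Q) (σ : Q → K → S → S) (hσ : ∀ q k, Function.Injective (σ q k))
    (bad : Q → Finset (K × S)) (hbad : ∀ q ∈ 𝒬, (bad q).card ≤ bd)
    (hcount : 𝒬.card * V ^ Fintype.card S * L ^ (Fintype.card K * V + bd) <
      L ^ (Fintype.card S * Fintype.card K)) :
    ∃ ξ : K → S → Fin L, ∀ q ∈ 𝒬, ∀ φ : S → Fin V, ∃ k s t, (k, s) ∉ bad q ∧ (k, t) ∉ bad q ∧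
      φ s = φ t ∧ ξ k (σ q k s) ≠ ξ k (σ q k t) := by
  by_contra! hc
  let ℬ : Q × (S → Fin V) → Finset (K → S → Fin L) := fun z =>
    Finset.univ.filter fun ξ : K → S → Fin L => ∀ k s t, (k, s) ∉ bad z.1 → (k, t) ∉ bad z.1 →
      z.2 s = z.2 t → ξ k (σ z.1 k s) = ξ k (σ z.1 k t)
  have hcover : (Finset.univ : Finset (K → S → Fin L)) ⊆ (𝒬 ×ˢ Finset.univ).biUnion ℬ := by
    intro ξ _
    obtain ⟨q, hq, φ, h⟩ := hc ξ
    exact Finset.mem_biUnion.2 ⟨(q, φ), Finset.mem_product.2 ⟨hq, Finset.mem_univ _⟩,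
      Finset.mem_filter.2 ⟨Finset.mem_univ _, h⟩⟩
  have h1 := (Finset.card_le_card hcover).trans
    (Finset.card_biUnion_le_card_mul _ _ (L ^ (Fintype.card K * V + bd)) fun z hz =>
      (card_tables_le hL (σ z.1) (hσ z.1) (bad z.1) z.2).trans
        (Nat.pow_le_pow_right hL (Nat.add_le_add_left (hbad _ (Finset.mem_product.1 hz).1) _)))
  rw [Finset.card_product, Finset.card_univ, Finset.card_univ, Fintype.card_fun, Fintype.card_fun,
    Fintype.card_fun, Fintype.card_fin, Fintype.card_fin, ← pow_mul] at h1
  exact absurd hcount (not_lt.2 h1)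

theorem table_count {C A n m V p : ℕ} (hn : 0 < n) (hmn : A * m + n ≤ A * n)
    (hV : V ≤ C ^ n) (hp : 0 < p) (hpV : 2 * A * V ≤ p) :
    64 ^ (n * p) * V ^ p * ((64 * C + 1) ^ (2 * A)) ^ (n * V + m * p) <
      ((64 * C + 1) ^ (2 * A)) ^ (p * n) := by
  have h1 : 64 ^ (n * p) * V ^ p < (64 * C + 1) ^ (n * p) := by
    calc 64 ^ (n * p) * V ^ p ≤ 64 ^ (n * p) * (C ^ n) ^ p := by gcongr
      _ = (64 * C) ^ (n * p) := by rw [← pow_mul, mul_pow]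
      _ < (64 * C + 1) ^ (n * p) :=
        Nat.pow_lt_pow_left (Nat.lt_succ_self _) (Nat.mul_pos hn hp).ne'
  have hB : 0 < 64 * C + 1 := Nat.succ_pos _
  calc 64 ^ (n * p) * V ^ p * ((64 * C + 1) ^ (2 * A)) ^ (n * V + m * p)
      < (64 * C + 1) ^ (n * p) * ((64 * C + 1) ^ (2 * A)) ^ (n * V + m * p) :=
        Nat.mul_lt_mul_of_pos_right h1 (by positivity)
    _ = (64 * C + 1) ^ (n * p + 2 * A * (n * V + m * p)) := by rw [← pow_mul, ← pow_add]
    _ ≤ (64 * C + 1) ^ (2 * A * (p * n)) := by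
        refine Nat.pow_le_pow_right hB ?_
        have h2 := Nat.mul_le_mul_left n hpV
        have h3 := Nat.mul_le_mul_left (2 * p) hmn
        nlinarith
    _ = _ := by rw [pow_mul]

/-- The map attached to a table and a family of linear forms. -/
noncomputable def waistMap {K : Type*} {d m : ℕ} (c : K → Leaf d → ℝ)
    (Θ : ∀ i : Fin d, Key K i → (Fin (m + 1) → ℝ) →ₗ[ℝ] ℝ) (v : Fin d → Fin (m + 1) → ℝ) (k : K) :
    unitInterval :=
  Set.projIcc 0 1 zero_le_one
    (∑ t, c k t * ∏ i, bweight (t i) (Θ i (keyOf k t i) (v i)))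

theorem continuous_waistMap {K : Type*} {d m : ℕ} (c : K → Leaf d → ℝ)
    (Θ : ∀ i : Fin d, Key K i → (Fin (m + 1) → ℝ) →ₗ[ℝ] ℝ) : Continuous (waistMap c Θ) := by
  refine continuous_pi fun k => continuous_projIcc.comp ?_
  refine continuous_finsetSum _ fun t _ =>
    continuous_const.mul (continuous_finsetProd _ fun i _ => ?_)
  exact (continuous_bweight _).comp
    ((LinearMap.continuous_of_finiteDimensional _).comp (continuous_apply i))

open Classical in
theorem waistMap_path {K : Type*} [Fintype K] {d m : ℕ} (c : K → Leaf d → ℝ)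
    (hc : ∀ k t, c k t ∈ Set.Icc (0 : ℝ) 1)
    (Θ : ∀ i : Fin d, Key K i → (Fin (m + 1) → ℝ) →ₗ[ℝ] ℝ) (e : Node d → Fin (m + 1) → ℝ)
    (q r : ∀ ν : Node d, Finset (Key K ν.1))
    (hq : q = fun ν => Finset.univ.filter fun κ => Θ ν.1 κ (e ν) < 0)
    (hr : r = fun ν => Finset.univ.filter fun κ => |Θ ν.1 κ (e ν)| < 1)
    (k : K) (s : Leaf d) (hks : (k, s) ∉ badPairs q r) :
    (waistMap c Θ (path e s) k : ℝ) = c k (relabel q k s) := by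
  unfold waistMap
  have hmem : ∀ i, keyOf k (relabel q k s) i ∈ q (nodeOf s i) ↔
      Θ i (keyOf k (relabel q k s) i) (e (nodeOf s i)) < 0 := by
    intro i
    generalize keyOf k (relabel q k s) i = κ
    subst hq
    exact ⟨fun h => (Finset.mem_filter.1 h).2, fun h => Finset.mem_filter.2 ⟨Finset.mem_univ _, h⟩⟩
  have hgood : ∀ i, relabel q k s i = true →
      1 ≤ |Θ i (keyOf k (relabel q k s) i) (e (nodeOf s i))| := by
    intro i hi
    by_contra! hlt
    refine hks (Finset.mem_filter.2 ⟨Finset.mem_univ _, i, hi, ?_⟩)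
    subst hr
    exact Finset.mem_filter.2 ⟨Finset.mem_univ _, hlt⟩
  have hrel := fun i => relabel_apply q k s i
  have hsum : ∑ t, c k t * ∏ i, bweight (t i) (Θ i (keyOf k t i) (path e s i)) =
      c k (relabel q k s) := by
    refine sum_mul_prod_bweight (c k) (fun i h => Θ i (k, h) (path e s i)) (relabel q k s) ?_ ?_
    · intro i hi
      have h1 := hgood i hi
      have h2 := hrel i
      rw [hi] at h2
      change 1 ≤ Θ i (keyOf k (relabel q k s) i) (path e s i)
      unfold path
      by_cases hneg : Θ i (keyOf k (relabel q k s) i) (e (nodeOf s i)) < 0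
      · have h3 : s i = false := by simpa [(hmem i).2 hneg] using h2
        rw [h3, bflip_false, map_neg]
        rwa [abs_of_neg hneg] at h1
      · have h3 : s i = true := by simpa [mt (hmem i).1 hneg] using h2
        rw [h3, bflip_true]
        rwa [abs_of_nonneg (not_lt.1 hneg)] at h1
    · intro i hi
      have h2 := hrel i
      rw [hi] at h2
      change Θ i (keyOf k (relabel q k s) i) (path e s i) ≤ 0
      unfold path
      by_cases hneg : Θ i (keyOf k (relabel q k s) i) (e (nodeOf s i)) < 0
      · have h3 : s i = true := by simpa [(hmem i).2 hneg] using h2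
        rw [h3, bflip_true]
        exact hneg.le
      · have h3 : s i = false := by simpa [mt (hmem i).1 hneg] using h2
        rw [h3, bflip_false, map_neg]
        linarith
  rw [hsum, Set.projIcc_of_mem _ (hc k _)]

open Classical in
/-- The number of combinatorial types of a labelling of the tree. -/
theorem card_patterns_le {K : Type*} [Fintype K] {d m : ℕ} (hm : m < Fintype.card K)
    (Θ : ∀ i : Fin d, Key K i → (Fin (m + 1) → ℝ) →ₗ[ℝ] ℝ) :
    (Fintype.piFinset fun ν : Node d =>
      (Finset.univ.filter fun S : Finset (Key K ν.1) =>
        ∃ v, S = Finset.univ.filter fun κ => Θ ν.1 κ v < 0) ×ˢ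
      (Finset.univ.filter fun S : Finset (Key K ν.1) => S.card ≤ m)).card ≤
      64 ^ (Fintype.card K * 2 ^ d) := by
  set n := Fintype.card K
  rw [Fintype.card_piFinset]
  have hkey : ∀ i : Fin d, Fintype.card (Key K i) = n * 2 ^ (i : ℕ) := by
    intro i
    rw [Fintype.card_prod, Fintype.card_fun, Fintype.card_bool, Fintype.card_subtype]
    congr 2
    have : (Finset.univ.filter fun l => l < i) = Finset.Iio i := by ext; simp
    rw [this, Fin.card_Iio]
  have hmono : ∀ N l : ℕ, l ≤ n → ∑ j ∈ Finset.range (l + 1), N.choose j ≤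
      ∑ j ∈ Finset.range (n + 1), N.choose j := fun N l hl =>
    Finset.sum_le_sum_of_subset (Finset.range_subset_range.2 (Nat.succ_le_succ hl))
  have h1 : ∀ ν : Node d, ((Finset.univ.filter fun S : Finset (Key K ν.1) =>
        ∃ v, S = Finset.univ.filter fun κ => Θ ν.1 κ v < 0) ×ˢ
      (Finset.univ.filter fun S : Finset (Key K ν.1) => S.card ≤ m)).card ≤
      (4 ^ n) ^ (ν.1 : ℕ) * 16 ^ n := by
    intro ν
    have hb := sum_choose_mul_le n (2 ^ (ν.1 : ℕ)) (by positivity)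
    have h2 := (card_sign_patterns_le (Key K ν.1) m (Θ ν.1)).trans
      ((by rw [hkey]; exact hmono _ (m + 1) hm : _ ≤ _).trans hb)
    have h3 := (card_filter_card_le (Key K ν.1) m).le.trans
      ((by rw [hkey]; exact hmono _ m hm.le : _ ≤ _).trans hb)
    rw [Finset.card_product]
    refine (Nat.mul_le_mul h2 h3).trans (le_of_eq ?_)
    rw [show (16 : ℕ) = 4 * 4 by norm_num, mul_pow, ← pow_mul (4 : ℕ),
      show (4 : ℕ) ^ (n * (ν.1 : ℕ)) = (2 ^ (ν.1 : ℕ)) ^ n * (2 ^ (ν.1 : ℕ)) ^ n by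
        rw [← mul_pow, ← mul_pow, ← pow_mul, mul_comm n]; norm_num]
    ring
  refine (Finset.prod_le_prod' fun ν _ => h1 ν).trans ?_
  rw [Finset.prod_mul_distrib, Finset.prod_pow_eq_pow_sum, Finset.prod_const, Finset.card_univ,
    card_node]
  calc (4 ^ n) ^ (∑ ν : Node d, (ν.1 : ℕ)) * (16 ^ n) ^ (2 ^ d - 1)
      ≤ (4 ^ n) ^ (2 ^ d) * (16 ^ n) ^ (2 ^ d) := by
        gcongr
        · exact Nat.one_le_pow _ _ (by norm_num)
        · exact sum_node_level_le d
        · exact Nat.one_le_pow _ _ (by norm_num)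
        · exact Nat.sub_le _ _
    _ = 64 ^ (n * 2 ^ d) := by
        rw [← mul_pow, ← mul_pow, ← pow_mul]
        norm_num

/-- A continuous map from a cube to a space of smaller dimension has an almost fiber of large
complexity, at a scale which does not depend on the dimensions. -/
theorem exists_large_almost_fiber (C A : ℕ) :
    ∃ L : ℕ, 0 < L ∧ ∀ (K : Type) [Fintype K] (m V : ℕ), 0 < Fintype.card K →
      A * m + Fintype.card K ≤ A * Fintype.card K → V ≤ C ^ Fintype.card K →
      ∀ f : (K → unitInterval) → Fin m → ℝ, Continuous f → ∀ δ > 0,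
      ∃ (d : ℕ) (x : Leaf d → K → unitInterval), (∀ s t j, |f (x s) j - f (x t) j| < δ) ∧
        ∀ φ : Leaf d → Fin V, ∃ s t, φ s = φ t ∧ ∃ k, 1 / (L : ℝ) ≤ |(x s k : ℝ) - x t k| := by
  classical
  refine ⟨(64 * C + 1) ^ (2 * A), by positivity, ?_⟩
  intro K _ m V hK hmn hV f hf δ hδ
  set L := (64 * C + 1) ^ (2 * A) with hLdef
  have hL : 0 < L := by positivity
  have hLr : (0 : ℝ) < L := by exact_mod_cast hL
  have hm : m < Fintype.card K := by
    by_contra! hle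
    have := Nat.mul_le_mul_left A hle
    omega
  let d := 2 * A * V
  have hd : 2 * A * V ≤ 2 ^ d := Nat.lt_two_pow_self.le
  choose Θ hΘ using fun i : Fin d => exists_forms_few_small (Key K i) m
  let 𝒬 := Fintype.piFinset fun ν : Node d =>
      (Finset.univ.filter fun S : Finset (Key K ν.1) =>
        ∃ v, S = Finset.univ.filter fun κ => Θ ν.1 κ v < 0) ×ˢ
      (Finset.univ.filter fun S : Finset (Key K ν.1) => S.card ≤ m)
  have h𝒬 : 𝒬.card ≤ 64 ^ (Fintype.card K * 2 ^ d) := card_patterns_le hm Θ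
  have hbad : ∀ q ∈ 𝒬, (badPairs (fun ν => (q ν).1) fun ν => (q ν).2).card ≤ m * 2 ^ d := by
    intro q hq
    refine (card_badPairs_le _ _).trans ?_
    refine (Finset.sum_le_card_nsmul _ _ m fun ν _ => ?_).trans ?_
    · have := Fintype.mem_piFinset.1 hq ν
      exact (Finset.mem_filter.1 (Finset.mem_product.1 this).2).2
    · rw [Finset.card_univ, card_node, smul_eq_mul, mul_comm]
      exact Nat.mul_le_mul_left _ (Nat.sub_le _ _)
  have hleaf : Fintype.card (Leaf d) = 2 ^ d := by simp
  obtain ⟨ξ, hξ⟩ := exists_table (V := V) hL 𝒬 (fun q k s => relabel (fun ν => (q ν).1) k s)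
    (fun q k => relabel_injective _ k) _ hbad (by
      rw [hleaf]
      refine lt_of_le_of_lt ?_ (table_count hK hmn hV (Nat.two_pow_pos d) hd)
      gcongr)
  let c : K → Leaf d → ℝ := fun k t => (ξ k t : ℕ) / (L : ℝ)
  have hc : ∀ k t, c k t ∈ Set.Icc (0 : ℝ) 1 := fun k t =>
    ⟨by positivity, (div_le_one hLr).2 (by exact_mod_cast (ξ k t).2.le)⟩
  obtain ⟨e, he, hclose⟩ := exists_leaf_values_close (fun v => f (waistMap c Θ v))
    (hf.comp (continuous_waistMap c Θ)) hδ
  refine ⟨d, fun s => waistMap c Θ (path e s), hclose, fun φ => ?_⟩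
  obtain ⟨k, s, t, hs, ht, hst, hne⟩ := hξ
    (fun ν => (Finset.univ.filter fun κ => Θ ν.1 κ (e ν) < 0,
      Finset.univ.filter fun κ => |Θ ν.1 κ (e ν)| < 1))
    (Fintype.mem_piFinset.2 fun ν => Finset.mem_product.2
      ⟨Finset.mem_filter.2 ⟨Finset.mem_univ _, _, rfl⟩,
        Finset.mem_filter.2 ⟨Finset.mem_univ _, hΘ _ _ (he ν)⟩⟩) φ
  refine ⟨s, t, hst, k, ?_⟩
  rw [waistMap_path c hc Θ e _ _ rfl rfl k s hs, waistMap_path c hc Θ e _ _ rfl rfl k t ht,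
    ← sub_div, abs_div, abs_of_pos hLr]
  refine div_le_div_of_nonneg_right ?_ hLr.le
  have key : ∀ i j : Fin L, i ≠ j → 1 ≤ |((i : ℕ) : ℝ) - (j : ℕ)| := fun i j hij => by
    have h : ((i : ℕ) : ℤ) - (j : ℕ) ≠ 0 :=
      sub_ne_zero.2 fun h => hij (Fin.ext (by exact_mod_cast h))
    exact_mod_cast Int.one_le_abs h
  exact key _ _ hne

end Waist

section MinimalSystem

/-- A partially prescribed bi-infinite sequence: the entries outside of a periodic set of free
positions are those of a periodic sequence. -/
structure Pattern (K : Type*) where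
  /-- the period -/
  period : ℕ
  /-- the free positions -/
  free : Set ℤ
  /-- the prescribed values -/
  word : ℤ → K

namespace Pattern

variable {K : Type*}

/-- The sequences following a pattern. -/
def seqs (p : Pattern K) : Set (ℤ → K) := {x | ∀ t ∉ p.free, x t = p.word t}

open Classical in
/-- The free positions in one period. -/
noncomputable def freeBlock (p : Pattern K) : Finset ℤ :=
  (Finset.Ico (0 : ℤ) p.period).filter (· ∈ p.free)

theorem mem_freeBlock {p : Pattern K} {t : ℤ} :
    t ∈ p.freeBlock ↔ (0 ≤ t ∧ t < p.period) ∧ t ∈ p.free := by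
  classical
  simp only [freeBlock, Finset.mem_filter, Finset.mem_Ico]

/-- A pattern with all but a fraction `1 / D` of the positions free. -/
structure Good (D : ℕ) (p : Pattern K) : Prop where
  pos : 0 < p.period
  free_periodic : Function.Periodic (· ∈ p.free) (p.period : ℤ)
  word_periodic : Function.Periodic p.word (p.period : ℤ)
  dense : D * p.period < D * p.freeBlock.card + p.period

/-- A pattern refining another one, whose sequences contain approximations of all
sequences of the latter. -/
structure Refines [Dist K] (ε : ℝ) (p q : Pattern K) : Prop where
  lt : p.period < q.period
  seqs_subset : q.seqs ⊆ p.seqs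
  freeBlock_subset : (p.freeBlock : Set ℤ) ⊆ q.free
  approx : ∀ x ∈ q.seqs, ∀ y ∈ p.seqs, ∃ s : ℤ, ∀ t : ℤ, 0 ≤ t → t < 2 * p.period →
    dist (x (s + t)) (y t) < ε

theorem isClosed_seqs [TopologicalSpace K] [T2Space K] (p : Pattern K) : IsClosed p.seqs := by
  have : p.seqs = ⋂ t ∈ p.freeᶜ, {x | x t = p.word t} := by
    ext x
    simp [seqs]
  rw [this]
  exact isClosed_biInter fun t _ => isClosed_eq (continuous_apply t) continuous_const

theorem word_mem_seqs (p : Pattern K) : p.word ∈ p.seqs := fun _ _ => rfl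

theorem Good.translate_mem {D : ℕ} {p : Pattern K} (hp : p.Good D) {x : ℤ → K} (hx : x ∈ p.seqs)
    (k : ℤ) : (fun t => x (t + k * p.period)) ∈ p.seqs := by
  intro t ht
  have h1 : (t + k * p.period ∈ p.free) = (t ∈ p.free) := hp.free_periodic.int_mul k t
  have h2 : p.word (t + k * p.period) = p.word t := hp.word_periodic.int_mul k t
  change x (t + k * p.period) = _
  rw [hx _ (by rwa [h1]), h2]

theorem exists_net [MetricSpace K] [CompactSpace K] (p : Pattern K) {ε : ℝ} (hε : 0 < ε) (n : ℕ) :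
    ∃ (r : ℕ) (y : ℕ → ℤ → K), (∀ j, y j ∈ p.seqs) ∧ ∀ z ∈ p.seqs, ∃ j < r, ∀ t : ℤ, 0 ≤ t →
      t < n → dist (y j t) (z t) < ε := by
  classical
  have hcpt : IsCompact p.seqs := p.isClosed_seqs.isCompact
  let U : (ℤ → K) → Set (ℤ → K) := fun y => ⋂ t ∈ Set.Ico (0 : ℤ) n, {z | dist (y t) (z t) < ε}
  have hU : ∀ y, IsOpen (U y) := fun y =>
    (Set.finite_Ico _ _).isOpen_biInter fun t _ =>
      isOpen_lt (continuous_const.dist (continuous_apply t)) continuous_const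
  obtain ⟨T, hT, hcover⟩ := hcpt.elim_nhds_subcover U fun y _ =>
    (hU y).mem_nhds (by simp [U, hε])
  let y : ℕ → ℤ → K := fun j => if h : j < T.card then T.equivFin.symm ⟨j, h⟩ else p.word
  refine ⟨T.card, y, fun j => ?_, fun z hz => ?_⟩
  · by_cases h : j < T.card
    · simp only [y, dif_pos h]
      exact hT _ (T.equivFin.symm ⟨j, h⟩).2
    · simp only [y, dif_neg h]
      exact p.word_mem_seqs
  · obtain ⟨x, hx, hzx⟩ := Set.mem_iUnion₂.1 (hcover hz)
    refine ⟨T.equivFin ⟨x, hx⟩, (T.equivFin ⟨x, hx⟩).2, fun t h0 h1 => ?_⟩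
    have : y (T.equivFin ⟨x, hx⟩) = x := by
      simp [y]
    rw [this]
    exact Set.mem_iInter₂.1 hzx t ⟨h0, h1⟩

theorem Good.exists_refines [MetricSpace K] [CompactSpace K] {D : ℕ} {p : Pattern K}
    (hp : p.Good D) {ε : ℝ} (hε : 0 < ε) : ∃ q : Pattern K, q.Good D ∧ Refines ε p q := by
  classical
  obtain ⟨r, y, hy, hnet⟩ := p.exists_net hε (2 * p.period)
  set N := p.period with hN
  have hNpos := hp.pos
  rw [← hN] at hNpos
  set M := 2 * r * D * N + 2 with hM
  set N' := (M + 2 * r) * N with hN'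
  have hN'pos : (0 : ℤ) < N' := by positivity
  have hNz : (0 : ℤ) < N := by exact_mod_cast hNpos
  have hN'z : (N' : ℤ) = (M + 2 * r) * N := by rw [hN']; push_cast; ring
  have hfree : ∀ t k : ℤ, (t + k * N ∈ p.free) = (t ∈ p.free) := fun t k =>
    hp.free_periodic.int_mul k t
  have hword : ∀ t k : ℤ, p.word (t + k * N) = p.word t := fun t k =>
    hp.word_periodic.int_mul k t
  let q : Pattern K :=
    { period := N'
      free := {t | t ∈ p.free ∧ t % N' < M * N}
      word := fun t => if t % N' < M * N then p.word t else
        y ((t % N' - M * N) / (2 * N)).toNat ((t % N' - M * N) % (2 * N)) }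
  have hM2 : (2 : ℤ) ≤ M := by rw [hM]; push_cast; nlinarith [Nat.zero_le (2 * r * D * N)]
  have hMN : (N : ℤ) ≤ M * N := by nlinarith
  have hr0 : (0 : ℤ) ≤ r := Int.natCast_nonneg r
  have hNN' : (N : ℤ) < N' := by rw [hN'z]; nlinarith
  have hsub : q.seqs ⊆ p.seqs := by
    intro x hx t ht
    have h1 : x t = q.word t := hx t fun h => ht h.1
    rw [h1]
    by_cases h : t % N' < M * N
    · exact if_pos h
    · have h2 : q.word t = y ((t % N' - M * N) / (2 * N)).toNat ((t % N' - M * N) % (2 * N)) :=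
        if_neg h
      rw [h2]
      obtain ⟨k, hk⟩ : ∃ k : ℤ, (t % N' - M * N) % (2 * N) = t + k * N := by
        refine ⟨-(t / N') * (M + 2 * r) - M - (t % N' - M * N) / (2 * N) * 2, ?_⟩
        have e1 := Int.emod_add_mul_ediv t N'
        have e2 := Int.emod_add_mul_ediv (t % N' - M * N) (2 * N)
        generalize (t % N' - M * N) / (2 * (N : ℤ)) = u at *
        generalize t / (N' : ℤ) = v at *
        rw [hN'z] at e1 e2 ⊢
        linear_combination e2 + e1
      rw [hk, hy _ _ (by rwa [hfree]), hword]
  refine ⟨q, ⟨?_, ?_, ?_, ?_⟩, ⟨?_, hsub, ?_, ?_⟩⟩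
  · exact_mod_cast hN'pos
  · intro t
    have h1 := hfree t (M + 2 * r)
    rw [← hN'z] at h1
    change (t + N' ∈ p.free ∧ (t + N') % N' < M * N) = (t ∈ p.free ∧ t % N' < M * N)
    rw [h1, Int.add_emod_right]
  · intro t
    have h1 := hword t (M + 2 * r)
    rw [← hN'z] at h1
    change (if (t + N') % (N' : ℤ) < M * N then p.word (t + N') else _) = if _ then _ else _
    rw [h1]
    simp only [q, Int.add_emod_right]
  · have hcard : M * p.freeBlock.card ≤ q.freeBlock.card := by
      rw [← Finset.card_range M, ← Finset.card_product]
      refine Finset.card_le_card_of_injOn (fun z => z.2 + z.1 * N) ?_ ?_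
      · rintro ⟨k, t⟩ hz
        obtain ⟨hk, ht⟩ := Finset.mem_product.1 (Finset.mem_coe.1 hz)
        obtain ⟨ht1, ht2⟩ := mem_freeBlock.1 ht
        rw [← hN] at ht1
        have hk' : (k : ℤ) + 1 ≤ M := by exact_mod_cast Finset.mem_range.1 hk
        have hlt : t + k * N < M * N := by nlinarith [ht1.2]
        have h0 : 0 ≤ t + k * N := by nlinarith [ht1.1, Int.natCast_nonneg k]
        have hlt' : t + k * N < N' := by rw [hN'z]; nlinarith
        refine Finset.mem_coe.2 (mem_freeBlock.2 ⟨⟨h0, hlt'⟩, ?_, ?_⟩)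
        · change t + k * N ∈ p.free
          rwa [hfree]
        · change (t + k * N) % (N' : ℤ) < M * N
          rwa [Int.emod_eq_of_lt h0 hlt']
      · rintro ⟨k, t⟩ hz ⟨k', t'⟩ hz' h
        have ht := (mem_freeBlock.1 (Finset.mem_product.1 hz).2).1
        have ht' := (mem_freeBlock.1 (Finset.mem_product.1 hz').2).1
        dsimp only at h ht ht'
        have e1 : t = t' := by
          have := congrArg (· % (N : ℤ)) h
          simp only [Int.add_mul_emod_self_right] at this
          rwa [Int.emod_eq_of_lt ht.1 ht.2, Int.emod_eq_of_lt ht'.1 ht'.2] at this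
        subst e1
        have e2 : (k : ℤ) = k' := mul_right_cancel₀ hNz.ne' (add_left_cancel h)
        rw [Nat.cast_inj.1 e2]
    have hd := hp.dense
    rw [← hN] at hd
    have h1 : D * N' < D * (M * p.freeBlock.card) + N' := by
      rw [hN']
      have h2 := Nat.mul_le_mul_left M (Nat.succ_le_of_lt hd)
      have h3 : D * (2 * r) * N < M := by rw [hM]; nlinarith
      nlinarith [Nat.zero_le (2 * r * N)]
    change D * N' < D * q.freeBlock.card + N'
    have h2 := Nat.mul_le_mul_left D hcard
    omega
  · change N < N'
    exact_mod_cast hNN'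
  · intro t ht
    obtain ⟨h1, h2⟩ := mem_freeBlock.1 (Finset.mem_coe.1 ht)
    rw [← hN] at h1
    refine ⟨h2, ?_⟩
    rw [Int.emod_eq_of_lt h1.1 (h1.2.trans hNN')]
    exact h1.2.trans_le hMN
  · intro x hx z hz
    obtain ⟨j, hj, hjz⟩ := hnet z hz
    refine ⟨M * N + j * (2 * N), fun t h0 h1 => ?_⟩
    have hjr : (j : ℤ) + 1 ≤ r := by exact_mod_cast hj
    have hj0 : (0 : ℤ) ≤ j := Int.natCast_nonneg j
    have hmod : (M * N + j * (2 * N) + t : ℤ) % N' = M * N + j * (2 * N) + t := by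
      refine Int.emod_eq_of_lt (by nlinarith) ?_
      rw [hN'z]
      nlinarith
    have hge : ¬ (M * N + j * (2 * N) + t : ℤ) % N' < M * N := by
      rw [hmod]
      nlinarith
    have hxw : x (M * N + j * (2 * N) + t) = y j t := by
      rw [hx _ fun h => hge h.2]
      refine (if_neg hge).trans ?_
      have e : (M * N + j * (2 * N) + t - M * N : ℤ) = t + j * (2 * N) := by ring
      rw [hmod, e, Int.add_mul_emod_self_right, Int.add_mul_ediv_right _ _ (by positivity),
        Int.emod_eq_of_lt h0 h1, Int.ediv_eq_zero_of_lt h0 h1]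
      simp
    rw [hxw]
    exact hjz t h0 (by exact_mod_cast h1)

/-- The minimal subshift generated by a sequence of patterns. -/
def subshift (p : ℕ → Pattern K) : Set (ℤ → K) :=
  {x | ∀ i, ∃ c : ℤ, (fun t => x (t + c)) ∈ (p i).seqs}

theorem isClosed_subshift [TopologicalSpace K] [T2Space K] {D : ℕ} {p : ℕ → Pattern K}
    (hp : ∀ i, (p i).Good D) : IsClosed (subshift p) := by
  have : subshift p = ⋂ i, ⋃ c ∈ Set.Ico (0 : ℤ) (p i).period,
      (fun x t => x (t + c)) ⁻¹' (p i).seqs := by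
    ext x
    simp only [subshift, Set.mem_ofPred_eq, Set.mem_iInter, Set.mem_iUnion, Set.mem_preimage]
    refine forall_congr' fun i => ⟨fun ⟨c, hc⟩ => ?_, fun ⟨c, _, hc⟩ => ⟨c, hc⟩⟩
    have hpos : (0 : ℤ) < (p i).period := by exact_mod_cast (hp i).pos
    refine ⟨c % (p i).period, ⟨Int.emod_nonneg _ hpos.ne', Int.emod_lt_of_pos _ hpos⟩, ?_⟩
    convert (hp i).translate_mem hc (-(c / (p i).period)) using 3 with t
    have := Int.emod_add_mul_ediv c (p i).period
    linear_combination this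
  rw [this]
  refine isClosed_iInter fun i => (Set.finite_Ico _ _).isClosed_biUnion fun c _ => ?_
  exact (p i).isClosed_seqs.preimage (continuous_pi fun t => continuous_apply (t + c))

theorem shift_image_subshift (p : ℕ → Pattern K) : shift '' subshift p = subshift p := by
  refine Set.Subset.antisymm ?_ fun x hx => ⟨fun t => x (t - 1), fun i => ?_, ?_⟩
  · rintro _ ⟨x, hx, rfl⟩ i
    obtain ⟨c, hc⟩ := hx i
    refine ⟨c - 1, ?_⟩
    convert hc using 2 with t
    simp only [shift]
    congr 1
    ring
  · obtain ⟨c, hc⟩ := hx i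
    refine ⟨c + 1, ?_⟩
    convert hc using 3 with t
    ring
  · ext t
    simp [shift]

theorem subshift_subset_closure [MetricSpace K] {D : ℕ} {p : ℕ → Pattern K}
    (hp : ∀ i, (p i).Good D) (hr : ∀ i : ℕ, Refines (1 / ((i : ℝ) + 1)) (p i) (p (i + 1)))
    {x : ℤ → K} (hx : x ∈ subshift p) :
    subshift p ⊆ closure {y | ∃ n : ℤ, y = fun k => x (k + n)} := by
  intro z hz
  rw [mem_closure_iff_nhds]
  intro W hW
  rw [nhds_pi, Filter.mem_pi] at hW
  obtain ⟨I, hI, s, hs, hsW⟩ := hW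
  have hε : ∀ᶠ i : ℕ in Filter.atTop, ∀ t ∈ I, Metric.ball (z t) (1 / ((i : ℝ) + 1)) ⊆ s t := by
    rw [hI.eventually_all]
    intro t _
    obtain ⟨ε, hε, hball⟩ := Metric.mem_nhds_iff.1 (hs t)
    filter_upwards [tendsto_one_div_add_atTop_nhds_zero_nat.eventually (gt_mem_nhds hε)] with i hi
    exact (Metric.ball_subset_ball hi.le).trans hball
  have hmono : StrictMono fun i => (p i).period := strictMono_nat_of_lt_succ fun i => (hr i).lt
  obtain ⟨R, hR⟩ : ∃ R : ℕ, ∀ t ∈ I, -(R : ℤ) ≤ t ∧ t ≤ R := by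
    obtain ⟨R, hR⟩ := (hI.image Int.natAbs).bddAbove
    refine ⟨R, fun t ht => ?_⟩
    have := hR (Set.mem_image_of_mem _ ht)
    omega
  obtain ⟨i, hi, hiR⟩ := (hε.and (Filter.eventually_gt_atTop (2 * R))).exists
  have hN : 2 * R < (p i).period := hiR.trans_le (hmono.id_le i)
  set N := (p i).period with hNdef
  have hNz : (0 : ℤ) < N := by omega
  obtain ⟨c, hc⟩ := hz i
  obtain ⟨c', hc'⟩ := hx (i + 1)
  let k := (-(R : ℤ) - c) / N
  have hk := Int.emod_add_mul_ediv (-(R : ℤ) - c) N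
  have hk0 := Int.emod_nonneg (-(R : ℤ) - c) hNz.ne'
  have hk1 := Int.emod_lt_of_pos (-(R : ℤ) - c) hNz
  obtain ⟨u, hu⟩ := (hr i).approx _ hc' _ ((hp i).translate_mem hc k)
  refine ⟨_, hsW fun t ht => hi t ht ?_, u + c' - (c + k * N), rfl⟩
  obtain ⟨h1, h2⟩ := hR t ht
  have hk' : N * k + (-(R : ℤ) - c) % N = -R - c := by linarith
  have := hu (t - (c + k * N)) (by linarith) (by rw [← hNdef]; linarith)
  rw [Metric.mem_ball]
  convert this using 3
  · ring
  · rw [← hNdef]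
    ring

theorem exists_mem_seqs_modify [MetricSpace K] [CompactSpace K] {p : ℕ → Pattern K} {ε : ℕ → ℝ}
    (hr : ∀ i : ℕ, Refines (ε i) (p i) (p (i + 1))) :
    ∃ x : ℤ → K, ∀ i, ∀ y : ℤ → K, (∀ t ∉ (p i).freeBlock, y t = x t) → ∀ j, y ∈ (p j).seqs := by
  have hanti : Antitone fun i => (p i).seqs := antitone_nat_of_succ_le fun i => (hr i).seqs_subset
  have hmono : StrictMono fun i => (p i).period := strictMono_nat_of_lt_succ fun i => (hr i).lt
  have hfree : ∀ i, Monotone fun j => (p (i + j)).freeBlock := fun i =>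
    monotone_nat_of_le_succ fun j t ht => mem_freeBlock.2
      ⟨⟨(mem_freeBlock.1 ht).1.1, (mem_freeBlock.1 ht).1.2.trans (by exact_mod_cast (hr _).lt)⟩,
        (hr _).freeBlock_subset ht⟩
  obtain ⟨x, hx⟩ := IsCompact.nonempty_iInter_of_sequence_nonempty_isCompact_isClosed
    (fun i => (p i).seqs) (fun i => (hr i).seqs_subset) (fun i => ⟨_, (p i).word_mem_seqs⟩)
    (p 0).isClosed_seqs.isCompact fun i => (p i).isClosed_seqs
  rw [Set.mem_iInter] at hx
  refine ⟨x, fun i y hy j => ?_⟩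
  refine hanti (Nat.le_add_left j i) fun t ht => ?_
  rw [hy t fun h => ht ((mem_freeBlock.1 (hfree i (Nat.zero_le j) h)).2), hx (i + j) t ht]

end Pattern

/-- There are minimal subshifts containing large families of sequences which are
free outside of a small fraction of a long window. -/
theorem exists_minimal_subshift (K : Type*) [MetricSpace K] [CompactSpace K] [Nonempty K] (D : ℕ) :
    ∃ X : Set (ℤ → K), X.Nonempty ∧ IsClosed X ∧ shift '' X = X ∧
      (∀ x ∈ X, X ⊆ closure {y | ∃ n : ℤ, y = fun k => x (k + n)}) ∧
      ∃ x : ℤ → K, ∀ N₀ : ℕ, ∃ N > N₀, ∃ F : Finset ℤ, F ⊆ Finset.Ico (0 : ℤ) N ∧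
        D * N < D * F.card + N ∧ ∀ y : ℤ → K, (∀ t ∉ F, y t = x t) → y ∈ X := by
  classical
  let w : K := Classical.arbitrary K
  let p₀ : Pattern K := ⟨1, Set.univ, fun _ => w⟩
  have hp₀ : p₀.Good D := by
    refine ⟨one_pos, fun _ => rfl, fun _ => rfl, ?_⟩
    have : p₀.freeBlock = {0} := by
      ext t
      rw [Pattern.mem_freeBlock]
      simp only [p₀, Set.mem_univ, and_true, Finset.mem_singleton]
      push_cast
      omega
    simp [this, p₀]
  choose! next hnext using fun (p : Pattern K) (ε : ℝ) (h : p.Good D ∧ 0 < ε) =>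
    h.1.exists_refines h.2
  obtain ⟨p, hp0, hps⟩ : ∃ p : ℕ → Pattern K, p 0 = p₀ ∧
      ∀ i : ℕ, p (i + 1) = next (p i) (1 / ((i : ℝ) + 1)) :=
    ⟨fun i => Nat.rec p₀ (fun i q => next q (1 / ((i : ℝ) + 1))) i, rfl, fun _ => rfl⟩
  have hp : ∀ i, (p i).Good D := by
    intro i
    induction i with
    | zero => rwa [hp0]
    | succ i ih =>
      rw [hps]
      exact (hnext (p i) _ ⟨ih, by positivity⟩).1
  have hr : ∀ i : ℕ, Pattern.Refines (1 / ((i : ℝ) + 1)) (p i) (p (i + 1)) := fun i => by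
    rw [hps]
    exact (hnext (p i) _ ⟨hp i, by positivity⟩).2
  have hmono : StrictMono fun i => (p i).period := strictMono_nat_of_lt_succ fun i => (hr i).lt
  obtain ⟨x, hx⟩ := Pattern.exists_mem_seqs_modify hr
  have hX : ∀ i, ∀ y : ℤ → K, (∀ t ∉ (p i).freeBlock, y t = x t) → y ∈ Pattern.subshift p :=
    fun i y hy j => ⟨0, by simpa using hx i y hy j⟩
  refine ⟨Pattern.subshift p, ⟨x, hX 0 x fun _ _ => rfl⟩, Pattern.isClosed_subshift hp,
    Pattern.shift_image_subshift p, fun _ h => Pattern.subshift_subset_closure hp hr h, x,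
    fun N₀ => ⟨(p (N₀ + 1)).period, (Nat.lt_succ_self _).trans_le (hmono.id_le _),
      (p (N₀ + 1)).freeBlock, fun t ht => ?_, (hp _).dense, hX _⟩⟩
  exact Finset.mem_Ico.2 (Pattern.mem_freeBlock.1 ht).1

end MinimalSystem

section ShiftDist

variable {a : ℕ}

theorem cubeDist_eq_dist (x y : Cube a) : cubeDist x y = dist x y := by
  rw [cubeDist, ← dist_eq_norm]
  rfl

theorem dist_cube_le_one (x y : Cube a) : dist x y ≤ 1 :=
  (dist_pi_le_iff zero_le_one).2 fun i => by
    rw [Subtype.dist_eq, Real.dist_eq, abs_le]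
    have hx := (x i).2
    have hy := (y i).2
    constructor <;> linarith [hx.1, hx.2, hy.1, hy.2]

theorem summable_two_zpow_neg_abs : Summable fun n : ℤ => (2 : ℝ) ^ (-|n|) := by
  have h : Summable fun n : ℕ => (2 : ℝ) ^ (-|(n : ℤ)|) := by
    have h2 := summable_geometric_of_lt_one (r := (1 / 2 : ℝ)) (by norm_num) (by norm_num)
    refine h2.congr fun n => ?_
    rw [abs_of_nonneg (Int.natCast_nonneg n), zpow_neg, zpow_natCast, one_div, inv_pow]
  refine Summable.of_nat_of_neg h ?_
  simpa only [abs_neg] using h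

theorem shiftDist_term_nonneg (x y : FullShift a) (n : ℤ) :
    0 ≤ (2 : ℝ) ^ (-|n|) * cubeDist (x n) (y n) := by
  rw [cubeDist_eq_dist]
  positivity

theorem shiftDist_term_le (x y : FullShift a) (n : ℤ) :
    (2 : ℝ) ^ (-|n|) * cubeDist (x n) (y n) ≤ (2 : ℝ) ^ (-|n|) := by
  rw [cubeDist_eq_dist]
  exact mul_le_of_le_one_right (by positivity) (dist_cube_le_one _ _)

theorem summable_shiftDist (x y : FullShift a) :
    Summable fun n : ℤ => (2 : ℝ) ^ (-|n|) * cubeDist (x n) (y n) :=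
  summable_two_zpow_neg_abs.of_nonneg_of_le (shiftDist_term_nonneg x y) (shiftDist_term_le x y)

theorem shiftDist_self (x : FullShift a) : shiftDist x x = 0 := by
  simp [shiftDist, cubeDist_eq_dist]

theorem shiftDist_comm (x y : FullShift a) : shiftDist x y = shiftDist y x := by
  simp only [shiftDist, cubeDist_eq_dist, dist_comm]

theorem shiftDist_triangle (x y z : FullShift a) :
    shiftDist x z ≤ shiftDist x y + shiftDist y z := by
  unfold shiftDist
  rw [← (summable_shiftDist x y).tsum_add (summable_shiftDist y z)]
  refine (summable_shiftDist x z).tsum_le_tsum (fun n => ?_)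
    ((summable_shiftDist x y).add (summable_shiftDist y z))
  simp only [cubeDist_eq_dist]
  rw [← mul_add]
  exact mul_le_mul_of_nonneg_left (dist_triangle _ _ _) (by positivity)

theorem continuous_shiftDist :
    Continuous fun z : FullShift a × FullShift a => shiftDist z.1 z.2 := by
  unfold shiftDist
  refine continuous_tsum (fun n => ?_) summable_two_zpow_neg_abs fun n z => ?_
  · simp only [cubeDist_eq_dist]
    fun_prop
  · rw [Real.norm_of_nonneg (shiftDist_term_nonneg _ _ _)]
    exact shiftDist_term_le _ _ _

theorem abs_sub_le_shiftDist (x y : FullShift a) (i : Fin a) :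
    |(x 0 i : ℝ) - y 0 i| ≤ shiftDist x y := by
  refine le_trans ?_ ((summable_shiftDist x y).le_tsum 0 fun n _ => shiftDist_term_nonneg x y n)
  rw [cubeDist_eq_dist]
  simpa [Subtype.dist_eq, Real.dist_eq] using dist_le_pi_dist (x 0) (y 0) i

end ShiftDist

section Covers

theorem dynDist_lt_iff {X : Type*} (T : X → X) (d : X → X → ℝ) {N : ℕ} (hN : 0 < N) (x y : X)
    (r : ℝ) : dynDist T d N x y < r ↔ ∀ n < N, d (T^[n] x) (T^[n] y) < r := by
  have hset : {r : ℝ | ∃ n, n < N ∧ r = d (T^[n] x) (T^[n] y)} =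
      (fun n => d (T^[n] x) (T^[n] y)) '' Set.Iio N := by
    ext r
    simp [eq_comm]
  rw [dynDist, hset, Set.Finite.csSup_lt_iff ((Set.finite_Iio N).image _) ⟨_, 0, hN, rfl⟩]
  simp

theorem le_dynDist {X : Type*} (T : X → X) (d : X → X → ℝ) {N n : ℕ} (hn : n < N) (x y : X) :
    d (T^[n] x) (T^[n] y) ≤ dynDist T d N x y := by
  by_contra! h
  exact lt_irrefl _ ((dynDist_lt_iff T d (Nat.zero_lt_of_lt hn) x y _).1 h n hn)

/-- Entropy below a threshold gives, at all small scales, efficient covers of fibers. -/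
theorem exists_supLogCov_lt {X Y : Type*} {T : X → X} {d : X → X → ℝ} {π : X → Y}
    (h : condEntropy π T d ≠ ⊤) :
    ∃ r : ℝ, 0 < r ∧ ∀ ε₀ > 0, ∃ ε, 0 < ε ∧ ε < ε₀ ∧ ∃ N : ℕ, 0 < N ∧
      supLogCov π (dynDist T d N) ε < r * N := by
  obtain ⟨r₀, hr₀, -⟩ := EReal.lt_iff_exists_real_btwn.1 (lt_top_iff_ne_top.2 h)
  have hr : condEntropy π T d < ((max r₀ 1 : ℝ) : EReal) :=
    hr₀.trans_le (EReal.coe_le_coe_iff.2 (le_max_left _ _))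
  refine ⟨max r₀ 1, by positivity, fun ε₀ hε₀ => ?_⟩
  obtain ⟨ε, hε, hε1⟩ := ((Filter.eventually_lt_of_limsup_lt hr).and
    (Ioo_mem_nhdsGT hε₀)).exists
  obtain ⟨N, hN, hN1⟩ :=
    ((Filter.frequently_lt_of_liminf_lt (by isBoundedDefault) hε).and_eventually
    (Filter.eventually_gt_atTop 0)).exists
  refine ⟨ε, hε1.1, hε1.2, N, hN1, ?_⟩
  rw [EReal.coe_lt_coe_iff, div_lt_iff₀ (by exact_mod_cast hN1)] at hN
  exact hN

variable {X Y : Type*} [TopologicalSpace X] {T : X → X} {d : X → X → ℝ}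

theorem isOpen_dynDist_lt (hT : Continuous T) (hd : Continuous fun z : X × X => d z.1 z.2) {N : ℕ}
    (hN : 0 < N) (x : X) (r : ℝ) : IsOpen {y | dynDist T d N x y < r} := by
  have : {y | dynDist T d N x y < r} = ⋂ n ∈ Set.Iio N, {y | d (T^[n] x) (T^[n] y) < r} := by
    ext y
    simp [dynDist_lt_iff T d hN]
  rw [this]
  refine (Set.finite_Iio N).isOpen_biInter fun n _ => isOpen_lt ?_ continuous_const
  exact hd.comp (continuous_const.prodMk (hT.iterate n))

theorem ROpen.isOpen (hT : Continuous T) (hd : Continuous fun z : X × X => d z.1 z.2)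
    (hself : ∀ x, d x x = 0) {N : ℕ} (hN : 0 < N) {U : Set X} (hU : ROpen (dynDist T d N) U) :
    IsOpen U := by
  refine isOpen_iff_mem_nhds.2 fun x hx => ?_
  obtain ⟨δ, hδ, h⟩ := hU x hx
  refine Filter.mem_of_superset ((isOpen_dynDist_lt hT hd hN x δ).mem_nhds ?_) h
  exact (dynDist_lt_iff T d hN x x δ).2 fun n _ => by rwa [hself]

theorem exists_cover [CompactSpace X] (hT : Continuous T)
    (hd : Continuous fun z : X × X => d z.1 z.2) (hself : ∀ x, d x x = 0)
    (hcomm : ∀ x y, d x y = d y x) (htri : ∀ x y z, d x z ≤ d x y + d y z) {N : ℕ} (hN : 0 < N)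
    {ε : ℝ} (hε : 0 < ε) : ∃ (n : ℕ) (U : Fin n → Set X), (∀ i, ROpen (dynDist T d N) (U i)) ∧
      (∀ i, setEDiam (dynDist T d N) (U i) < ENNReal.ofReal ε) ∧ Set.univ ⊆ ⋃ i, U i := by
  obtain ⟨t, -, ht⟩ := (isCompact_univ (X := X)).elim_nhds_subcover
    (fun x => {y | dynDist T d N x y < ε / 3}) fun x _ =>
      (isOpen_dynDist_lt hT hd hN x _).mem_nhds
        ((dynDist_lt_iff T d hN x x _).2 fun n _ => by rw [hself]; positivity)
  refine ⟨t.card, fun i => {y | dynDist T d N (t.equivFin.symm i : X) y < ε / 3},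
    fun i y hy => ?_, fun i => ?_, fun y _ => ?_⟩
  · refine ⟨ε / 3 - dynDist T d N (t.equivFin.symm i : X) y, sub_pos.2 hy, fun z hz => ?_⟩
    refine (dynDist_lt_iff T d hN _ _ _).2 fun n hn => ?_
    have h1 := (dynDist_lt_iff T d hN _ _ _).1 hz n hn
    have h2 := le_dynDist T d hn (t.equivFin.symm i : X) y
    linarith [htri (T^[n] (t.equivFin.symm i : X)) (T^[n] y) (T^[n] z)]
  · refine lt_of_le_of_lt (b := ENNReal.ofReal (2 * ε / 3)) ?_
      ((ENNReal.ofReal_lt_ofReal_iff hε).2 (by linarith))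
    refine iSup₂_le fun y hy => iSup₂_le fun z hz => ENNReal.ofReal_le_ofReal (le_of_lt ?_)
    refine (dynDist_lt_iff T d hN _ _ _).2 fun n hn => ?_
    have h1 := (dynDist_lt_iff T d hN _ _ _).1 hy n hn
    have h2 := (dynDist_lt_iff T d hN _ _ _).1 hz n hn
    have h3 := htri (T^[n] y) (T^[n] (t.equivFin.symm i : X)) (T^[n] z)
    rw [hcomm (T^[n] y) (T^[n] (t.equivFin.symm i : X))] at h3
    linarith
  · obtain ⟨x, hx, hy⟩ := Set.mem_iUnion₂.1 (ht (Set.mem_univ y))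
    refine Set.mem_iUnion.2 ⟨t.equivFin ⟨x, hx⟩, ?_⟩
    simpa using hy

/-- Fibers can be covered efficiently by small open sets. -/
theorem exists_cover_of_supLogCov_lt [CompactSpace X] (hT : Continuous T)
    (hd : Continuous fun z : X × X => d z.1 z.2) (hself : ∀ x, d x x = 0)
    (hcomm : ∀ x y, d x y = d y x) (htri : ∀ x y z, d x z ≤ d x y + d y z) {N : ℕ} (hN : 0 < N)
    {ε : ℝ} (hε : 0 < ε) (π : X → Y) {s : ℝ} (hs : supLogCov π (dynDist T d N) ε < s) (y : Y) :
    ∃ U : Fin ⌊Real.exp s⌋₊ → Set X, (∀ i, IsOpen (U i)) ∧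
      (∀ i, ∀ x ∈ U i, ∀ x' ∈ U i, ∀ n < N, d (T^[n] x) (T^[n] x') < ε) ∧
      π ⁻¹' {y} ⊆ ⋃ i, U i := by
  obtain ⟨n, U₀, hU₀⟩ := exists_cover hT hd hself hcomm htri hN hε
  have hmem : ∀ E : Set X, n ∈ {n : ℕ | ∃ U : Fin n → Set X, (∀ i, ROpen (dynDist T d N) (U i)) ∧
      (∀ i, setEDiam (dynDist T d N) (U i) < ENNReal.ofReal ε) ∧ E ⊆ ⋃ i, U i} := fun E =>
    ⟨U₀, hU₀.1, hU₀.2.1, (Set.subset_univ E).trans hU₀.2.2⟩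
  have hle : ∀ E, covNum (dynDist T d N) ε E ≤ n := fun E => Nat.sInf_le (hmem E)
  have hlog : ∀ E, Real.log (covNum (dynDist T d N) ε E) ≤ n := fun E =>
    (Real.log_le_self (Nat.cast_nonneg _)).trans (by exact_mod_cast hle E)
  have hle_floor : covNum (dynDist T d N) ε (π ⁻¹' {y}) ≤ ⌊Real.exp s⌋₊ := by
    rcases Nat.eq_zero_or_pos (covNum (dynDist T d N) ε (π ⁻¹' {y})) with h | h
    · rw [h]
      exact Nat.zero_le _
    · refine Nat.le_floor ?_
      rw [← Real.log_le_iff_le_exp (by exact_mod_cast h)]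
      refine le_trans ?_ hs.le
      exact le_ciSup (f := fun y => Real.log (covNum (dynDist T d N) ε (π ⁻¹' {y}) : ℝ))
        ⟨n, by rintro _ ⟨y, rfl⟩; exact hlog _⟩ y
  obtain ⟨U, hU1, hU2, hU3⟩ := Nat.sInf_mem ⟨n, hmem (π ⁻¹' {y})⟩
  refine ⟨fun i => if h : (i : ℕ) < covNum (dynDist T d N) ε (π ⁻¹' {y}) then U ⟨i, h⟩ else ∅,
    fun i => ?_, fun i x hx x' hx' m hm => ?_, fun x hx => ?_⟩
  · dsimp only
    split_ifs with h
    · exact (hU1 ⟨i, h⟩).isOpen hT hd hself hN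
    · exact isOpen_empty
  · dsimp only at hx hx'
    split_ifs at hx hx' with h
    · refine (le_dynDist T d hm x x').trans_lt ?_
      rw [← ENNReal.ofReal_lt_ofReal_iff hε]
      refine lt_of_le_of_lt ?_ (hU2 ⟨i, h⟩)
      exact le_iSup₂_of_le x hx (le_iSup₂_of_le x' hx' le_rfl)
    · exact absurd hx (Set.notMem_empty x)
  · obtain ⟨i, hi⟩ := Set.mem_iUnion.1 (hU3 hx)
    refine Set.mem_iUnion.2 ⟨⟨i, i.2.trans_le hle_floor⟩, ?_⟩
    dsimp only
    rw [dif_pos (show (i : ℕ) < covNum (dynDist T d N) ε (π ⁻¹' {y}) from i.2)]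
    exact hi

/-- A uniform neighborhood of each fiber of a continuous map is covered as the fiber itself. -/
theorem exists_uniform_cover [CompactSpace X] {b : ℕ} {π : X → FullShift b} (hπ : Continuous π)
    {ι : Type*} {p : (ι → Set X) → Prop} (hp : ∀ U, p U → ∀ i, IsOpen (U i))
    (h : ∀ y, ∃ U : ι → Set X, p U ∧ π ⁻¹' {y} ⊆ ⋃ i, U i) :
    ∃ (R : ℕ) (δ : ℝ), 0 < δ ∧ ∀ y : FullShift b, ∃ U : ι → Set X, p U ∧ ∀ x,
      (∀ t : ℤ, |t| ≤ R → ∀ k, |(π x t k : ℝ) - y t k| < δ) → ∃ i, x ∈ U i := by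
  choose U hU hcover using h
  let W : FullShift b → Set (FullShift b) := fun y => (π '' (⋃ i, U y i)ᶜ)ᶜ
  have hW : ∀ y, IsOpen (W y) := fun y =>
    (((isOpen_iUnion fun i =>
      hp _ (hU y) i).isClosed_compl.isCompact.image hπ).isClosed).isOpen_compl
  have hWcov : Set.univ ⊆ ⋃ y, W y := fun y _ => Set.mem_iUnion.2 ⟨y, by
    rintro ⟨x, hx, rfl⟩
    exact hx (hcover _ rfl)⟩
  obtain ⟨V, hV, hball⟩ := lebesgue_number_lemma isCompact_univ hW hWcov
  rw [Pi.uniformity, Filter.mem_iInf] at hV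
  obtain ⟨I, hI, S, hS, rfl⟩ := hV
  have hδ : ∀ t : I, ∃ δ > 0, ∀ x y : FullShift b, dist (x t) (y t) < δ → (x, y) ∈ S t := by
    intro t
    obtain ⟨S', hS', hsub⟩ := hS t
    obtain ⟨δ, hδ, h⟩ := Metric.mem_uniformity_dist.1 hS'
    exact ⟨δ, hδ, fun x y hxy => hsub (h hxy)⟩
  choose δ hδ0 hδ using hδ
  have := hI.to_subtype
  obtain ⟨δ₀, hδ₀, hδ₀'⟩ : ∃ δ₀ > 0, ∀ t, δ₀ ≤ δ t := by
    rcases isEmpty_or_nonempty I with hE | hE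
    · exact ⟨1, one_pos, fun t => isEmptyElim t⟩
    · obtain ⟨t₀, ht₀⟩ := Finite.exists_min δ
      exact ⟨δ t₀, hδ0 t₀, ht₀⟩
  obtain ⟨R, hR⟩ := (hI.image Int.natAbs).bddAbove
  refine ⟨R, δ₀, hδ₀, fun y => ?_⟩
  obtain ⟨y', hy'⟩ := hball y (Set.mem_univ y)
  refine ⟨U y', hU y', fun x hx => ?_⟩
  have hmem : π x ∈ W y' := by
    refine hy' (Set.mem_iInter.2 fun t => hδ t _ _ ?_)
    rw [dist_comm, dist_pi_lt_iff (hδ0 t)]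
    intro k
    refine (hx t ?_ k).trans_le (hδ₀' t)
    have := hR (Set.mem_image_of_mem _ t.2)
    rw [Int.abs_eq_natAbs]
    exact_mod_cast this
  by_contra hc
  exact hmem ⟨x, by simpa using hc, rfl⟩

end Covers

section Entropy

theorem iterate_shift_apply {X α : Type*} {T : X → X} {π : X → ℤ → α}
    (h : ∀ x, π (T x) = shift (π x)) (k : ℕ) (x : X) (t : ℤ) :
    π (T^[k] x) t = π x (t + k) := by
  induction k generalizing x t with
  | zero => simp
  | succ k ih =>
    rw [Function.iterate_succ_apply, ih, h, shift]
    congr 1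
    push_cast
    ring

theorem card_constraints_le {a b R N c : ℕ} (hab : b < a) (hN : 4 * b * (2 * R + 1) ≤ N)
    (hc : c ≤ N) (hD : 2 * a * N < 2 * a * c + N) :
    4 * a * (b * (N + 2 * R + 1)) + c * a ≤ 4 * a * (c * a) := by
  have h1 : (b + 1) * N ≤ a * N := Nat.mul_le_mul_right N hab
  have h2 : 4 * (b * (N + 2 * R + 1)) + N ≤ 4 * (c * a) := by nlinarith
  have h3 := Nat.mul_le_mul_left a h2
  nlinarith [Nat.mul_le_mul_right a hc]

theorem floor_exp_pow_le {h : ℝ} (hh : 0 < h) {C N₀ N n : ℕ} (hC : Real.exp (4 * h) ≤ C)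
    (hN : N₀ ≤ N) (hn : N ≤ 2 * n) :
    ⌊Real.exp (h * N₀)⌋₊ ^ (N / N₀ + 1) ≤ C ^ n := by
  have hJ : ((N / N₀ + 1 : ℕ) : ℝ) * N₀ ≤ 4 * n := by
    have h1 := Nat.div_mul_le_self N N₀
    have h2 : (N / N₀ + 1) * N₀ ≤ 4 * n := by
      rw [add_mul]
      omega
    exact_mod_cast h2
  have key : ((⌊Real.exp (h * N₀)⌋₊ : ℝ)) ^ (N / N₀ + 1) ≤ (C : ℝ) ^ n :=
    calc ((⌊Real.exp (h * N₀)⌋₊ : ℝ)) ^ (N / N₀ + 1)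
        ≤ Real.exp (h * N₀) ^ (N / N₀ + 1) :=
          pow_le_pow_left₀ (Nat.cast_nonneg _) (Nat.floor_le (Real.exp_pos _).le) _
      _ = Real.exp (((N / N₀ + 1 : ℕ) : ℝ) * (h * N₀)) := (Real.exp_nat_mul _ _).symm
      _ ≤ Real.exp (n * (4 * h)) := Real.exp_le_exp.2 (by nlinarith)
      _ = Real.exp (4 * h) ^ n := Real.exp_nat_mul _ _
      _ ≤ (C : ℝ) ^ n := pow_le_pow_left₀ (Real.exp_pos _).le hC _
  exact_mod_cast key

/-- The configuration with prescribed coordinates on a finite set of times, and equal to a given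
configuration at all other times. -/
def fillIn {a : ℕ} (F : Finset ℤ) (x : FullShift a) (z : {t // t ∈ F} × Fin a → unitInterval) :
    FullShift a :=
  fun t => if h : t ∈ F then fun k => z (⟨t, h⟩, k) else x t

theorem continuous_fillIn {a : ℕ} (F : Finset ℤ) (x : FullShift a) : Continuous (fillIn F x) := by
  refine continuous_pi fun t => ?_
  by_cases h : t ∈ F
  · simp only [fillIn, h, dite_true]
    fun_prop
  · simp only [fillIn, h, dite_false]
    exact continuous_const

/-- A subshift with many free coordinates at arbitrarily large scales has infinite conditional
entropy over every map to a full shift on a cube of smaller dimension. -/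
theorem condEntropy_eq_top {a b : ℕ} (hab : b < a) {X : Set (FullShift a)} (hX : IsClosed X)
    {x₀ : FullShift a}
    (hfree : ∀ N₀ : ℕ, ∃ N > N₀, ∃ F : Finset ℤ, F ⊆ Finset.Ico (0 : ℤ) N ∧
      2 * a * N < 2 * a * F.card + N ∧ ∀ y : FullShift a, (∀ t ∉ F, y t = x₀ t) → y ∈ X)
    {T : X → X} (hT : ∀ x : X, (T x : FullShift a) = shift (x : FullShift a))
    {π : X → FullShift b} (hπ : Continuous π) (hπT : ∀ x, π (T x) = shift (π x)) :
    condEntropy π T (fun x y : X => shiftDist (x : FullShift a) (y : FullShift a)) = ⊤ := by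
  by_contra hne
  obtain ⟨h, hh, hcov⟩ := exists_supLogCov_lt hne
  obtain ⟨L, hL, hwaist⟩ := exists_large_almost_fiber ⌈Real.exp (4 * h)⌉₊ (4 * a)
  obtain ⟨ε, hε, hεL, N₀, hN₀, hsup⟩ := hcov (1 / L) (by positivity)
  have : CompactSpace X := isCompact_iff_compactSpace.1 hX.isCompact
  have hTc : Continuous T := by
    refine continuous_induced_rng.2 ?_
    have : (Subtype.val ∘ T : X → FullShift a) = fun x : X => shift (x : FullShift a) := funext hT
    rw [this]
    exact continuous_pi fun n => (continuous_apply (n + 1)).comp continuous_subtype_val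
  have hdc : Continuous fun z : X × X => shiftDist (z.1 : FullShift a) (z.2 : FullShift a) :=
    continuous_shiftDist.comp
      ((continuous_subtype_val.comp continuous_fst).prodMk
        (continuous_subtype_val.comp continuous_snd))
  obtain ⟨R, δ, hδ, huni⟩ := exists_uniform_cover (ι := Fin ⌊Real.exp (h * N₀)⌋₊)
    (p := fun U => (∀ i, IsOpen (U i)) ∧ ∀ i, ∀ x ∈ U i, ∀ x' ∈ U i, ∀ n < N₀,
      shiftDist (T^[n] x : FullShift a) (T^[n] x' : FullShift a) < ε) hπ (fun U hU => hU.1)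
    fun y => by
      obtain ⟨U, h1, h2, h3⟩ := exists_cover_of_supLogCov_lt
        (d := fun x y : X => shiftDist (x : FullShift a) (y : FullShift a)) hTc hdc
        (fun x => shiftDist_self x.1) (fun x y => shiftDist_comm x.1 y.1)
        (fun x y z => shiftDist_triangle x.1 y.1 z.1) hN₀ hε π hsup y
      exact ⟨U, ⟨h1, h2⟩, h3⟩
  obtain ⟨N, hN, F, hFN, hcard, hmem⟩ := hfree (max N₀ (4 * b * (2 * R + 1)))
  have hN1 : N₀ ≤ N := (le_max_left _ _).trans hN.le
  have hN2 : 4 * b * (2 * R + 1) ≤ N := (le_max_right _ _).trans hN.le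
  have hFcard : F.card ≤ N := by simpa using Finset.card_le_card hFN
  have hn : N ≤ 2 * (F.card * a) := by
    have : 1 * N ≤ a * N := Nat.mul_le_mul_right N (by omega)
    nlinarith
  set ι : ({t // t ∈ F} × Fin a → unitInterval) → X := fun z =>
    ⟨fillIn F x₀ z, hmem _ fun t ht => by simp [fillIn, ht]⟩ with hι
  have hιc : Continuous ι := (continuous_fillIn F x₀).subtype_mk _
  have hcardK : Fintype.card ({t // t ∈ F} × Fin a) = F.card * a := by simp
  set W := Finset.Icc (-(R : ℤ)) (N + R) with hW
  have hcardW : Fintype.card (W × Fin b) = b * (N + 2 * R + 1) := by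
    rw [Fintype.card_prod, Fintype.card_coe, Int.card_Icc, Fintype.card_fin, mul_comm]
    congr 1
    omega
  set e : W × Fin b ≃ Fin (b * (N + 2 * R + 1)) := Fintype.equivFinOfCardEq hcardW
  set J := N / N₀ + 1 with hJ
  set Q := ⌊Real.exp (h * N₀)⌋₊ with hQ
  set code : (Fin J → Fin Q) ≃ Fin (Q ^ J) := Fintype.equivFinOfCardEq (by simp)
  obtain ⟨d, x, hx, hxφ⟩ := hwaist ({t // t ∈ F} × Fin a) (b * (N + 2 * R + 1)) (Q ^ J)
    (by rw [hcardK]; omega) (by rw [hcardK]; exact card_constraints_le hab hN2 hFcard hcard)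
    (by rw [hcardK]; exact floor_exp_pow_le hh (Nat.le_ceil _) hN1 hn)
    (fun z j => (π (ι z) (e.symm j).1 (e.symm j).2 : ℝ))
    (continuous_pi fun j => continuous_subtype_val.comp
      ((continuous_apply _).comp ((continuous_apply _).comp (hπ.comp hιc)))) δ hδ
  have hclose : ∀ s t, ∀ τ ∈ W, ∀ k, |(π (ι (x s)) τ k : ℝ) - π (ι (x t)) τ k| < δ := by
    intro s t τ hτ k
    simpa using hx s t (e (⟨τ, hτ⟩, k))
  choose U hU hUmem using fun i : Fin J => huni (π (T^[i * N₀] (ι (x fun _ => true))))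
  have hblock : ∀ s (i : Fin J), ∃ j, T^[i * N₀] (ι (x s)) ∈ U i j := by
    intro s i
    refine hUmem i _ fun t ht k => ?_
    rw [iterate_shift_apply hπT, iterate_shift_apply hπT]
    refine hclose _ _ _ ?_ k
    have h1 : (i : ℕ) * N₀ ≤ N :=
      (Nat.mul_le_mul_right N₀ (Nat.lt_succ_iff.1 i.2)).trans (Nat.div_mul_le_self N N₀)
    rw [abs_le] at ht
    rw [hW, Finset.mem_Icc]
    have h2 : (((i : ℕ) * N₀ : ℕ) : ℤ) ≤ N := by exact_mod_cast h1
    constructor <;> omega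
  choose φ hφ using hblock
  obtain ⟨s, t, hst, ⟨⟨τ, hτ⟩, k⟩, hk⟩ := hxφ fun s => code (φ s)
  have hst' : φ s = φ t := code.injective hst
  obtain ⟨hτ0, hτN⟩ := Finset.mem_Ico.1 (hFN hτ)
  obtain ⟨τ, rfl⟩ := Int.eq_ofNat_of_zero_le hτ0
  have hi : τ / N₀ < J := Nat.lt_succ_of_le (Nat.div_le_div_right (by omega))
  have hsmall := (hU ⟨τ / N₀, hi⟩).2 _ _ (hφ s ⟨τ / N₀, hi⟩) _
    (hst' ▸ hφ t ⟨τ / N₀, hi⟩) (τ % N₀) (Nat.mod_lt _ hN₀)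
  have hcoord := abs_sub_le_shiftDist
    (T^[τ % N₀] (T^[τ / N₀ * N₀] (ι (x s))) : FullShift a)
    (T^[τ % N₀] (T^[τ / N₀ * N₀] (ι (x t))) : FullShift a) k
  have hval : ∀ s, (T^[τ % N₀] (T^[τ / N₀ * N₀] (ι (x s))) : FullShift a) 0 k =
      x s (⟨(τ : ℤ), hτ⟩, k) := by
    intro s
    rw [← Function.iterate_add_apply, Nat.mod_add_div',
      iterate_shift_apply (π := fun x : X => (x : FullShift a)) hT, zero_add]
    simp [hι, fillIn, hτ]
  rw [hval, hval] at hcoord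
  exact absurd (hk.trans hcoord) (not_le.2 (hsmall.trans hεL))

end Entropy

/-- For `a > b` there is a minimal closed subset `X ⊆ ([0,1]^a)^ℤ` such that
every equivariant continuous map `π : (X, σ) → (([0,1]^b)^ℤ, σ)` has infinite topological
conditional entropy. -/
theorem stmt_1 (a b : ℕ) (hab : b < a) :
    ∃ X : Set (FullShift a), X.Nonempty ∧ IsClosed X ∧ shift '' X = X ∧
      (∀ x ∈ X, X ⊆ closure {y : FullShift a | ∃ n : ℤ, y = fun k => x (k + n)}) ∧
      ∀ T : X → X, (∀ x : X, (T x : FullShift a) = shift (x : FullShift a)) →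
        ∀ π : X → FullShift b, Continuous π → (∀ x, π (T x) = shift (π x)) →
          condEntropy π T (fun x y : X => shiftDist (x : FullShift a) (y : FullShift a)) = ⊤ := by
  obtain ⟨X, hne, hcl, hshift, hmin, x₀, hfree⟩ := exists_minimal_subshift (Cube a) (2 * a)
  exact ⟨X, hne, hcl, hshift, hmin, fun T hT π hπ hπT =>
    condEntropy_eq_top hab hcl hfree hT hπ hπT⟩
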